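/- arXiv:1705.04255 — 2 statements merged into one kernel-verified Lean document; each statement's English description precedes it below -/
import Mathlib

section
/- There exists a constant c > 0 such that for every prime p > 2 and every finite set A ⊆ F_p with |A| ≤ p^(2/3), the set (A-A)·(A-A) = {(a-b)·(c-d) : a,b,c,d ∈ A} has cardinality at least c·|A|^(3/2). -/
open Finset


@[ext] structure Ln (K : Type*) where
  s : K
  c : K
  v : K

namespace Ln
noncomputable section
variable {K : Type*} [Field K]

/-- restriction of a polynomial to a line -/
def res (l : Ln K) : MvPolynomial (Fin 3) K →ₐ[K] Polynomial K :=
  MvPolynomial.aeval ![Polynomial.X, Polynomial.C l.c - Polynomial.C l.s * Polynomial.X,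
    Polynomial.C (l.v - l.s * l.c) + Polynomial.C (l.s ^ 2) * Polynomial.X]

def meet (l m : Ln K) : Prop := m.s * l.c + l.v = l.s * m.c + m.v

lemma meet.symm {l m : Ln K} (h : meet l m) : meet m l := by
  unfold meet at *; exact h.symm

lemma res_X0 (l : Ln K) : res l (MvPolynomial.X 0) = Polynomial.X := by simp [res]
lemma res_X1 (l : Ln K) : res l (MvPolynomial.X 1) =
    Polynomial.C l.c - Polynomial.C l.s * Polynomial.X := by simp [res]
lemma res_X2 (l : Ln K) : res l (MvPolynomial.X 2) =
    Polynomial.C (l.v - l.s * l.c) + Polynomial.C (l.s ^ 2) * Polynomial.X := by simp [res]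
lemma res_C (l : Ln K) (a : K) : res l (MvPolynomial.C a) = Polynomial.C a := by
  simp [res]

lemma natDegree_res_le (l : Ln K) (f : MvPolynomial (Fin 3) K) :
    (res l f).natDegree ≤ f.totalDegree := by
  unfold res
  rw [MvPolynomial.aeval_def, MvPolynomial.eval₂_eq']
  apply Polynomial.natDegree_sum_le_of_forall_le
  intro d hd
  refine le_trans ?_ (MvPolynomial.le_totalDegree hd)
  refine le_trans (Polynomial.natDegree_C_mul_le _ _) ?_
  rw [Finsupp.sum_fintype _ _ (by simp)]
  refine le_trans (Polynomial.natDegree_prod_le _ _) ?_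
  apply Finset.sum_le_sum
  intro i _
  refine le_trans Polynomial.natDegree_pow_le ?_
  have : (![Polynomial.X, Polynomial.C l.c - Polynomial.C l.s * Polynomial.X,
    Polynomial.C (l.v - l.s * l.c) + Polynomial.C (l.s ^ 2) * Polynomial.X] i).natDegree ≤ 1 := by
    fin_cases i
    · simp
    · simp only [Fin.mk_one, Fin.isValue, Matrix.cons_val_one, Matrix.cons_val_zero]
      compute_degree
    · simp only [Fin.reduceFinMk, Matrix.cons_val]
      compute_degree
  calc _ ≤ d i * 1 := Nat.mul_le_mul_left _ this
    _ = _ := by simp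

lemma eval_res (l : Ln K) (t : K) (f : MvPolynomial (Fin 3) K) :
    (res l f).eval t = MvPolynomial.eval ![t, l.c - l.s * t, (l.v - l.s * l.c) + l.s ^ 2 * t] f := by
  have : ((Polynomial.aeval t).comp (res l)) =
      MvPolynomial.aeval (R := K) ![t, l.c - l.s * t, (l.v - l.s * l.c) + l.s ^ 2 * t] := by
    ext i
    fin_cases i <;> simp [res]
  have h2 := congrArg (fun g => g f) this
  simpa [Polynomial.aeval_def, MvPolynomial.aeval_eq_eval] using h2

def mt (l m : Ln K) : K := (l.c - m.c) / (l.s - m.s)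

lemma eval_meet {l m : Ln K} (h : meet l m) (hs : l.s ≠ m.s) (f : MvPolynomial (Fin 3) K) :
    (res l f).eval (mt l m) = (res m f).eval (mt l m) := by
  rw [eval_res, eval_res]
  have h1 : l.s - m.s ≠ 0 := sub_ne_zero.2 hs
  have e1 : l.c - l.s * mt l m = m.c - m.s * mt l m := by
    unfold mt; field_simp; ring
  have e2 : (l.v - l.s * l.c) + l.s ^ 2 * mt l m = (m.v - m.s * m.c) + m.s ^ 2 * mt l m := by
    have : l.v = l.s * m.c + m.v - m.s * l.c := by unfold meet at h; linear_combination h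
    rw [this]; unfold mt; field_simp; ring
  rw [e1, e2]

lemma mt_inj {l m m' : Ln K} (h : meet l m) (hs : l.s ≠ m.s) (h' : meet l m') (hs' : l.s ≠ m'.s)
    (e : mt l m = mt l m') : meet m m' := by
  have h1 : l.s - m.s ≠ 0 := sub_ne_zero.2 hs
  have h2 : l.s - m'.s ≠ 0 := sub_ne_zero.2 hs'
  have a1 : mt l m * (l.s - m.s) = l.c - m.c := by unfold mt; field_simp
  have a2 : mt l m * (l.s - m'.s) = l.c - m'.c := by rw [e]; unfold mt; field_simp
  unfold meet at *
  have a3 : m.c = l.c - mt l m * (l.s - m.s) := by linear_combination a1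
  have a4 : m'.c = l.c - mt l m * (l.s - m'.s) := by linear_combination a2
  rw [a3] at h ⊢
  rw [a4] at h' ⊢
  linear_combination h' - h

/-- derivative in direction of slope `s` -/
def D (s : K) (f : MvPolynomial (Fin 3) K) : MvPolynomial (Fin 3) K :=
  MvPolynomial.pderiv 0 f - MvPolynomial.C s * MvPolynomial.pderiv 1 f
    + MvPolynomial.C (s ^ 2) * MvPolynomial.pderiv 2 f

lemma res_deriv (l : Ln K) (f : MvPolynomial (Fin 3) K) :
    Polynomial.derivative (res l f) = res l (D l.s f) := by
  induction f using MvPolynomial.induction_on with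
  | C a => simp [D, res]
  | add p q hp hq => simp only [map_add, hp, hq, D]; simp only [map_add, map_mul, map_sub]; ring
  | mul_X p i hp =>
    rw [map_mul, Polynomial.derivative_mul, hp]
    fin_cases i <;>
    · simp [D, MvPolynomial.pderiv_X, res, Polynomial.derivative_pow]
      ring

end
end Ln

namespace Ln
noncomputable section
variable {K : Type*} [Field K]

abbrev Pm (K : Type*) [Field K] (m : ℕ) : Submodule K (MvPolynomial (Fin 3) K) :=
  MvPolynomial.restrictTotalDegree (Fin 3) K m

lemma finrank_Pm (m : ℕ) : 6 * Module.finrank K (Pm K m) = (m+1)*(m+2)*(m+3) := by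
  have h1 : Module.finrank K (Pm K m) = Nat.card {n : Fin 3 →₀ ℕ | (n.sum fun _ e => e) ≤ m} :=
    Module.finrank_eq_nat_card_basis (MvPolynomial.basisRestrictSupport K _)
  have h2 : {n : Fin 3 →₀ ℕ | (n.sum fun _ e => e) ≤ m} =
      ((range (m+1)).biUnion (fun j => (univ : Finset (Fin 3)).finsuppAntidiag j) : Finset _) := by
    ext n
    simp [Finsupp.sum_fintype, Finset.mem_finsuppAntidiag]
  rw [h1, h2, Nat.card_coe_set_eq, Set.ncard_coe_finset, Finset.card_biUnion]
  · simp only [Finset.card_finsuppAntidiag_nat_eq_choose]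
    clear h1 h2
    induction m with
    | zero => simp
    | succ m ih =>
      rw [Finset.sum_range_succ, mul_add, ih]
      have : ∀ n : ℕ, 2 * Nat.choose (n+2) 2 = (n+1)*(n+2) := by
        intro n
        induction n with
        | zero => simp
        | succ n ih =>
          rw [show n + 1 + 2 = (n + 2) + 1 by ring, Nat.choose_succ_succ' (n+2) 1, mul_add, ih]
          simp; ring
      have h := this (m+1)
      have h3 : (3 + m).choose (m + 1) = (m + 1 + 2).choose 2 := by
        rw [show 3 + m = m + 1 + 2 by ring]
        exact Nat.choose_symm_add
      simp [h3]
      linear_combination 3 * h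
  · intro i _ j _ hij
    rw [Function.onFun, Finset.disjoint_left]
    intro n hn hn'
    simp [Finset.mem_finsuppAntidiag] at hn hn'
    exact hij (hn.symm.trans hn')

lemma mem_Pm {m : ℕ} {f : MvPolynomial (Fin 3) K} : f ∈ Pm K m ↔ f.totalDegree ≤ m :=
  MvPolynomial.mem_restrictTotalDegree _ _ _

/-- a polynomial of degree at most one vanishing on `j` but not on `i` -/
lemma exists_plane {i j : Ln K} (h : i ≠ j) : ∃ f : MvPolynomial (Fin 3) K,
    f.totalDegree ≤ 1 ∧ res j f = 0 ∧ res i f ≠ 0 := by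
  have hd : ∀ (a b : Fin 3) (s c : K), (MvPolynomial.X a + MvPolynomial.C s * MvPolynomial.X b
      - MvPolynomial.C c : MvPolynomial (Fin 3) K).totalDegree ≤ 1 := by
    intro a b s c
    refine (MvPolynomial.totalDegree_sub _ _).trans (max_le ((MvPolynomial.totalDegree_add _ _).trans
      (max_le ?_ ((MvPolynomial.totalDegree_mul _ _).trans ?_))) ?_) <;> simp
  by_cases h1 : i.s = j.s ∧ i.c = j.c
  · obtain ⟨h1, h2⟩ := h1
    refine ⟨MvPolynomial.X 2 + MvPolynomial.C j.s * MvPolynomial.X 1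
      - MvPolynomial.C j.v, hd _ _ _ _, ?_, ?_⟩
    · simp only [map_sub, map_add, map_mul, res_X2, res_X1, res_C, map_pow]; ring
    · have : res i (MvPolynomial.X 2 + MvPolynomial.C j.s * MvPolynomial.X 1
        - MvPolynomial.C j.v) = Polynomial.C (i.v - j.v) := by
        simp only [map_sub, map_add, map_mul, res_X2, res_X1, res_C, map_pow, h1, h2]; ring
      rw [this, Ne, Polynomial.C_eq_zero, sub_eq_zero]
      intro h3
      exact h (Ln.ext h1 h2 h3)
  · refine ⟨MvPolynomial.X 1 + MvPolynomial.C j.s * MvPolynomial.X 0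
      - MvPolynomial.C j.c, hd _ _ _ _, ?_, ?_⟩
    · simp only [map_sub, map_add, map_mul, res_X0, res_X1, res_C]; ring
    · have : res i (MvPolynomial.X 1 + MvPolynomial.C j.s * MvPolynomial.X 0
        - MvPolynomial.C j.c) = Polynomial.C (j.s - i.s) * Polynomial.X + Polynomial.C (i.c - j.c) := by
        simp only [map_sub, map_add, map_mul, res_X0, res_X1, res_C]; ring
      rw [this]
      intro h0
      apply h1
      have a1 := congrArg (Polynomial.coeff · 1) h0
      have a0 := congrArg (Polynomial.coeff · 0) h0
      simp [Polynomial.coeff_C, -map_sub] at a1 a0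
      exact ⟨(sub_eq_zero.1 a1).symm, sub_eq_zero.1 a0⟩

/-- For each line of a finset `S`, a polynomial of degree `≤ |S|` vanishing on all other lines. -/
lemma exists_sep [DecidableEq (Ln K)] (S : Finset (Ln K)) (i : Ln K) (hi : i ∉ S) :
    ∃ f : MvPolynomial (Fin 3) K,
    f.totalDegree ≤ S.card ∧ (∀ j ∈ S, res j f = 0) ∧ res i f ≠ 0 := by
  induction S using Finset.induction_on with
  | empty => exact ⟨1, by simp, by simp, by simp⟩
  | insert a S ha ih =>
    obtain ⟨f, hf, h1, h2⟩ := ih (fun h => hi (Finset.mem_insert_of_mem h))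
    obtain ⟨g, hg, h3, h4⟩ := exists_plane (i := i) (j := a) (by rintro rfl; simp at hi)
    refine ⟨f * g, ?_, ?_, ?_⟩
    · rw [Finset.card_insert_of_notMem ha]
      exact (MvPolynomial.totalDegree_mul _ _).trans (by omega)
    · intro j hj
      rw [map_mul]
      rcases Finset.mem_insert.1 hj with rfl | hj
      · rw [h3, mul_zero]
      · rw [h1 j hj, zero_mul]
    · rw [map_mul]; exact mul_ne_zero h2 h4
end
end Ln

namespace Ln
noncomputable section
variable {K : Type*} [Field K]

lemma totalDegree_aeval_X0 (q : Polynomial K) :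
    (Polynomial.aeval (MvPolynomial.X 0 : MvPolynomial (Fin 3) K) q).totalDegree ≤ q.natDegree := by
  rw [Polynomial.aeval_eq_sum_range]
  refine MvPolynomial.totalDegree_finsetSum_le ?_
  intro i hi
  refine (MvPolynomial.totalDegree_smul_le _ _).trans ?_
  refine (MvPolynomial.totalDegree_pow _ _).trans ?_
  simp at hi ⊢; omega

lemma res_aeval_X0 (l : Ln K) (q : Polynomial K) :
    res l (Polynomial.aeval (MvPolynomial.X 0 : MvPolynomial (Fin 3) K) q) = q := by
  rw [← Polynomial.aeval_algHom_apply, res_X0, Polynomial.aeval_X_left_apply]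

theorem bezout_aux {π g : MvPolynomial (Fin 3) K} (hπ : Irreducible π) (hg : ¬ π ∣ g)
    (S : Finset (Ln K)) (hS : ∀ l ∈ S, res l π = 0 ∧ res l g = 0) (M k m : ℕ)
    (hm : m = M + π.totalDegree + g.totalDegree) (hk : S.card + k ≤ m + 2) (hS0 : 0 < S.card) :
    Module.finrank K (Pm K (M + g.totalDegree)) + Module.finrank K (Pm K (M + π.totalDegree))
      + S.card * k ≤ Module.finrank K (Pm K m) + Module.finrank K (Pm K M) := by
  classical
  have hsep : ∀ i : S, ∃ f : MvPolynomial (Fin 3) K,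
      f.totalDegree ≤ S.card - 1 ∧ (∀ j ∈ S, j ≠ i.1 → res j f = 0) ∧ res i.1 f ≠ 0 := by
    intro i
    obtain ⟨f, h1, h2, h3⟩ := exists_sep (S.erase i.1) i.1 (by simp)
    refine ⟨f, by rwa [Finset.card_erase_of_mem i.2] at h1, fun j hj hne => h2 j (by simp [hj, hne]), h3⟩
  choose F hF1 hF2 hF3 using hsep
  have hg0 : g ≠ 0 := by rintro rfl; exact hg (dvd_zero _)
  have hπ0 := hπ.ne_zero
  let T3 : (S → Polynomial.degreeLT K k) →ₗ[K] MvPolynomial (Fin 3) K :=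
    ∑ i : S, (LinearMap.mulLeft K (F i)) ∘ₗ (Polynomial.aeval (MvPolynomial.X 0)).toLinearMap ∘ₗ
      (Polynomial.degreeLT K k).subtype ∘ₗ LinearMap.proj i
  have hT3 : ∀ q, T3 q = ∑ i : S, F i * Polynomial.aeval (MvPolynomial.X 0) (q i).1 := by
    intro q; simp [T3]
  let T : (Pm K (M + g.totalDegree) × Pm K (M + π.totalDegree) × (S → Polynomial.degreeLT K k))
      →ₗ[K] MvPolynomial (Fin 3) K :=
    ((LinearMap.mulLeft K π) ∘ₗ (Pm K _).subtype).coprod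
      (((LinearMap.mulLeft K g) ∘ₗ (Pm K _).subtype).coprod T3)
  have hT : ∀ x, T x = π * x.1.1 + (g * x.2.1.1 + T3 x.2.2) := by
    intro x; simp [T]
  have hrange : LinearMap.range T ≤ Pm K m := by
    rintro _ ⟨⟨a, b, q⟩, rfl⟩
    rw [hT]
    refine Submodule.add_mem _ ?_ (Submodule.add_mem _ ?_ ?_)
    · rw [mem_Pm]
      have := mem_Pm.1 a.2
      exact (MvPolynomial.totalDegree_mul _ _).trans (by simp only; omega)
    · rw [mem_Pm]
      have := mem_Pm.1 b.2
      exact (MvPolynomial.totalDegree_mul _ _).trans (by simp only; omega)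
    · rw [hT3]
      refine Submodule.sum_mem _ ?_
      intro i _
      rw [mem_Pm]
      have h1 := hF1 i
      have h2 := totalDegree_aeval_X0 (q i).1
      by_cases h0 : (q i).1 = 0
      · simp [h0]
      refine (MvPolynomial.totalDegree_mul _ _).trans ?_
      have h3 : (q i).1.natDegree < k := by
        have := Polynomial.mem_degreeLT.1 (q i).2
        exact (Polynomial.natDegree_lt_iff_degree_lt h0).2 this
      simp only at *
      omega
  let G : Pm K M →ₗ[K] (Pm K (M + g.totalDegree) × Pm K (M + π.totalDegree) ×
      (S → Polynomial.degreeLT K k)) :=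
    LinearMap.prod (((LinearMap.mulLeft K g) ∘ₗ (Pm K M).subtype).codRestrict _ (by
      intro c
      rw [mem_Pm]
      have := mem_Pm.1 c.2
      exact (MvPolynomial.totalDegree_mul _ _).trans (by simp only [Submodule.subtype_apply]; omega)))
      (LinearMap.prod (((LinearMap.mulLeft K (-π)) ∘ₗ (Pm K M).subtype).codRestrict _ (by
      intro c
      rw [mem_Pm]
      have := mem_Pm.1 c.2
      exact (MvPolynomial.totalDegree_mul _ _).trans (by
        simp only [Submodule.subtype_apply, MvPolynomial.totalDegree_neg]; omega))) 0)
  have hker : LinearMap.ker T ≤ LinearMap.range G := by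
    rintro ⟨a, b, q⟩ h
    rw [LinearMap.mem_ker, hT] at h
    simp only at h
    have hq : q = 0 := by
      funext i
      have h1 := congrArg (res i.1) h
      rw [map_add, map_add, map_mul, map_mul, (hS i.1 i.2).1, (hS i.1 i.2).2, hT3, map_sum] at h1
      rw [Finset.sum_eq_single i] at h1
      · rw [map_mul, res_aeval_X0] at h1
        simp only [zero_mul, zero_add, map_zero, mul_eq_zero] at h1
        rcases h1 with h1 | h1
        · exact absurd h1 (hF3 i)
        · exact Subtype.ext h1
      · intro j _ hj
        rw [map_mul, hF2 j i.1 i.2 (by intro e; exact hj (Subtype.ext e.symm)), zero_mul]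
      · simp
    subst hq
    rw [map_zero, add_zero] at h
    have hdvd : π ∣ b.1 := by
      have : π ∣ g * b.1 := ⟨-a.1, by linear_combination h⟩
      exact (hπ.prime.dvd_or_dvd this).resolve_left hg
    obtain ⟨c, hc⟩ := hdvd
    have hdeg : c.totalDegree ≤ M := by
      by_cases hc0 : c = 0
      · simp [hc0]
      have := mem_Pm.1 b.2
      rw [hc, MvPolynomial.totalDegree_mul_of_isDomain hπ0 hc0] at this
      omega
    have ha : a.1 = - (g * c) := by
      apply mul_left_cancel₀ hπ0
      rw [hc] at h
      linear_combination h
    refine ⟨⟨-c, by rw [mem_Pm, MvPolynomial.totalDegree_neg]; exact hdeg⟩, ?_⟩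
    refine Prod.ext (Subtype.ext ?_) (Prod.ext (Subtype.ext ?_) ?_)
    · simp [G, ha]
    · simp [G, hc]
    · simp [G]
  have hfd : ∀ n, FiniteDimensional K (Pm K n) := fun n => inferInstance
  have hfd2 : Module.finrank K (Polynomial.degreeLT K k) = k := by
    rw [(Polynomial.degreeLTEquiv K k).finrank_eq]; simp
  have : FiniteDimensional K (Polynomial.degreeLT K k) :=
    Module.Finite.equiv (Polynomial.degreeLTEquiv K k).symm
  have h1 := LinearMap.finrank_range_add_finrank_ker T
  have h2 := Submodule.finrank_mono hrange
  have h3 := Submodule.finrank_mono hker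
  have h4 := LinearMap.finrank_range_le G
  rw [Module.finrank_prod, Module.finrank_prod, Module.finrank_pi_fintype] at h1
  simp only [hfd2, Finset.sum_const, Finset.card_univ, Fintype.card_coe, smul_eq_mul] at h1
  omega

theorem bezout {π g : MvPolynomial (Fin 3) K} (hπ : Irreducible π) (hg : ¬ π ∣ g)
    (S : Finset (Ln K)) (hS : ∀ l ∈ S, res l π = 0 ∧ res l g = 0) :
    S.card ≤ π.totalDegree * g.totalDegree := by
  by_contra hlt
  push Not at hlt
  obtain ⟨S', hS', hc⟩ := Finset.exists_subset_card_eq (Nat.succ_le_of_lt hlt)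
  set a := π.totalDegree
  set b := g.totalDegree
  have key := bezout_aux hπ hg S' (fun l hl => hS l (hS' hl)) ((a*b)^2+2*(a*b))
    ((a*b)^2+2*(a*b)+a+b+1-a*b) _ rfl
    (by rw [hc]; have : a * b ≤ (a*b)^2+2*(a*b)+a+b+1 := by nlinarith
        simp only [a, b] at *
        omega) (by omega)
  have e1 := finrank_Pm (K := K) ((a*b)^2+2*(a*b) + b)
  have e2 := finrank_Pm (K := K) ((a*b)^2+2*(a*b) + a)
  have e3 := finrank_Pm (K := K) ((a*b)^2+2*(a*b) + a + b)
  have e4 := finrank_Pm (K := K) ((a*b)^2+2*(a*b))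
  obtain ⟨k, hk⟩ : ∃ k, (a*b)^2+2*(a*b)+a+b+1 = a*b + k :=
    Nat.exists_eq_add_of_le (by nlinarith)
  rw [hc, hk, Nat.add_sub_cancel_left] at key
  generalize Module.finrank K (Pm K ((a*b)^2+2*(a*b) + b)) = x1 at *
  generalize Module.finrank K (Pm K ((a*b)^2+2*(a*b) + a)) = x2 at *
  generalize Module.finrank K (Pm K ((a*b)^2+2*(a*b) + a + b)) = x3 at *
  generalize Module.finrank K (Pm K ((a*b)^2+2*(a*b))) = x4 at *
  clear_value a b
  zify at *
  have hk' : (k : ℤ) = (a*b)^2+(a*b)+a+b+1 := by linear_combination -hk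
  rw [hk'] at key
  have hp : (0:ℤ) ≤ (a + b) * (3 * (a * b) + 6) := by positivity
  nlinarith
end
end Ln

namespace Ln
noncomputable section
variable {K : Type*} [Field K]
open Polynomial in
lemma X_mul_deriv (u : Polynomial K) : (X * derivative u).natDegree ≤ u.natDegree ∧
    (X * derivative u).coeff u.natDegree = u.natDegree * u.leadingCoeff := by
  rcases h : u.natDegree with _ | a
  · rw [derivative_of_natDegree_zero h]; simp
  · constructor
    · refine natDegree_mul_le.trans ?_
      have := natDegree_derivative_le u
      rw [natDegree_X]; omega
    · rw [coeff_X_mul, coeff_derivative, leadingCoeff, h]; push_cast; ring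

open Polynomial in
lemma wr_deg {p : ℕ} [CharP K p] {u v : Polynomial K} (hu : u ≠ 0) (hv : v ≠ 0)
    (h : derivative u * v = u * derivative v) (du : u.natDegree < p) (dv : v.natDegree < p) :
    u.natDegree = v.natDegree := by
  have h1 : (X * derivative u) * v = u * (X * derivative v) := by linear_combination X * h
  have h2 := congrArg (coeff · (u.natDegree + v.natDegree)) h1
  rw [coeff_mul_add_eq_of_natDegree_le (X_mul_deriv u).1 le_rfl,
    coeff_mul_add_eq_of_natDegree_le le_rfl (X_mul_deriv v).1, (X_mul_deriv u).2, (X_mul_deriv v).2] at h2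
  have h3 : ((u.natDegree : K) - v.natDegree) * (u.leadingCoeff * v.leadingCoeff) = 0 := by
    simp only [leadingCoeff] at *
    linear_combination h2
  have h4 : (u.natDegree : K) = v.natDegree := by
    rcases mul_eq_zero.1 h3 with h | h
    · exact sub_eq_zero.1 h
    · rcases mul_eq_zero.1 h with h | h
      · exact absurd (leadingCoeff_eq_zero.1 h) hu
      · exact absurd (leadingCoeff_eq_zero.1 h) hv
  have := (CharP.natCast_eq_natCast K p).1 h4
  rwa [Nat.ModEq, Nat.mod_eq_of_lt du, Nat.mod_eq_of_lt dv] at this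

open Polynomial in
lemma wr {p : ℕ} [CharP K p] {u v : Polynomial K} (hv : v ≠ 0)
    (h : derivative u * v = u * derivative v) (du : u.natDegree < p) (dv : v.natDegree < p) :
    ∃ c : K, u = C c * v := by
  by_cases hu : u = 0
  · exact ⟨0, by simp [hu]⟩
  have e := wr_deg (p := p) hu hv h du dv
  have hl : v.leadingCoeff ≠ 0 := leadingCoeff_ne_zero.2 hv
  refine ⟨u.leadingCoeff / v.leadingCoeff, ?_⟩
  set c := u.leadingCoeff / v.leadingCoeff with hc
  by_contra hne
  have hw : u - C c * v ≠ 0 := sub_ne_zero.2 hne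
  have hc1 : c * v.leadingCoeff = u.leadingCoeff := by rw [hc]; field_simp
  have hd : (u - C c * v).degree < u.degree := by
    have hc0 : c ≠ 0 := div_ne_zero (leadingCoeff_ne_zero.2 hu) hl
    refine degree_sub_lt_left ?_ hu ?_
    · rw [degree_C_mul hc0, degree_eq_natDegree hu, degree_eq_natDegree hv, e]
    · rw [leadingCoeff_mul, leadingCoeff_C, hc1]
  have hd2 := natDegree_lt_natDegree hw hd
  have := wr_deg (p := p) hw hv (by simp; linear_combination h) (by omega) dv
  omega

open Polynomial in
/-- a second order ODE forcing `W = (cX+b) P`. -/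
lemma ode {p : ℕ} [CharP K p] {P W : Polynomial K} (hP : P ≠ 0) {d : ℕ} (dP : P.natDegree ≤ d)
    (dW : W.natDegree ≤ d) (hd : 2 * d + 1 < p)
    (h : P * (W * derivative (derivative P) - P * derivative (derivative W)) =
      2 * derivative P * (W * derivative P - P * derivative W)) :
    ∃ c b : K, W = (C c * X + C b) * P := by
  set N := derivative W * P - W * derivative P with hN
  have hN' : derivative N = derivative (derivative W) * P - W * derivative (derivative P) := by
    rw [hN]; simp; ring
  have dN : N.natDegree ≤ 2 * d := by
    rw [hN]
    have h1 := natDegree_derivative_le W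
    have h2 := natDegree_derivative_le P
    refine (natDegree_sub_le _ _).trans (max_le ?_ ?_) <;>
    · refine natDegree_mul_le.trans ?_; omega
  have dP2 : (P^2).natDegree ≤ 2 * d := by
    rw [natDegree_pow]; omega
  obtain ⟨c, hc⟩ := wr (p := p) (u := N) (v := P^2) (pow_ne_zero 2 hP)
    (by rw [hN', pow_two, derivative_mul, hN]; linear_combination -P * h) (by omega) (by omega)
  obtain ⟨b, hb⟩ := wr (p := p) (u := W - C c * X * P) (v := P) hP
    (by
      simp
      rw [hN] at hc
      linear_combination hc)
    (by
      have h1 : (C c * X).natDegree ≤ 1 := by compute_degree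
      have h2 : (C c * X * P).natDegree ≤ 1 + d := natDegree_mul_le.trans (by omega)
      have h3 := natDegree_sub_le W (C c * X * P)
      have h4 : W.natDegree ≤ 1 + d := by omega
      have := h3.trans (max_le h4 h2)
      omega) (by omega)
  exact ⟨c, b, by linear_combination hb⟩
end
end Ln

namespace Ln
noncomputable section
variable {K : Type*} [Field K]

lemma mt_injOn {l : Ln K} {T : Set (Ln K)} (hm : ∀ m ∈ T, meet l m) (hs : ∀ m ∈ T, l.s ≠ m.s)
    (hsk : ∀ m ∈ T, ∀ m' ∈ T, m ≠ m' → ¬ meet m m') : Set.InjOn (mt l) T := by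
  intro m h m' h' e
  by_contra hne
  exact hsk m h m' h' hne (mt_inj (hm m h) (hs m h) (hm m' h') (hs m' h') e)

lemma many_roots {l : Ln K} {T : Finset (Ln K)} (hm : ∀ m ∈ T, meet l m) (hs : ∀ m ∈ T, l.s ≠ m.s)
    (hsk : ∀ m ∈ T, ∀ m' ∈ T, m ≠ m' → ¬ meet m m') (q : Polynomial K)
    (hq : ∀ m ∈ T, q.eval (mt l m) = 0) (hd : q.natDegree < T.card) : q = 0 := by
  classical
  refine Polynomial.eq_zero_of_natDegree_lt_card_of_eval_eq_zero' q (T.image (mt l)) ?_ ?_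
  · intro t ht
    obtain ⟨m, hm, rfl⟩ := Finset.mem_image.1 ht
    exact hq m hm
  · rwa [Finset.card_image_of_injOn (mt_injOn hm hs hsk)]

/-- few roots version -/
lemma few_roots {l : Ln K} {T : Finset (Ln K)} (hm : ∀ m ∈ T, meet l m) (hs : ∀ m ∈ T, l.s ≠ m.s)
    (hsk : ∀ m ∈ T, ∀ m' ∈ T, m ≠ m' → ¬ meet m m') (f : MvPolynomial (Fin 3) K)
    (hq : ∀ m ∈ T, res m f = 0) (hd : f.totalDegree < T.card) : res l f = 0 := by
  refine many_roots hm hs hsk _ ?_ ((natDegree_res_le l f).trans_lt hd)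
  intro m h
  rw [eval_meet (hm m h) (hs m h), hq m h, Polynomial.eval_zero]

def clo (d : ℕ) (T : Finset (Ln K)) (l : Ln K) : Prop :=
  ∀ f : MvPolynomial (Fin 3) K, f.totalDegree ≤ d → (∀ m ∈ T, res m f = 0) → res l f = 0

open Classical in
theorem greedy (U V : Finset (Ln K)) (D d : ℕ)
    (hV : ∀ v ∈ V, D ≤ (U.filter (fun u => meet v u)).card)
    (skU : ∀ u ∈ U, ∀ u' ∈ U, u ≠ u' → ¬ meet u u')
    (skV : ∀ u ∈ V, ∀ u' ∈ V, u ≠ u' → ¬ meet u u')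
    (sl : ∀ u ∈ U, ∀ v ∈ V, u.s ≠ v.s) (hdD : d < D) :
    ∃ T ⊆ V, T.card * (D - d) ≤ U.card * (d + 1) ∧ ∀ v ∈ V, clo d T v := by
  let cnt : Finset (Ln K) → Ln K → ℕ := fun T u => (V.filter (fun v => meet u v ∧ clo d T v)).card
  let Φ : Finset (Ln K) → ℕ := fun T => ∑ u ∈ U, min (d + 1) (cnt T u)
  have hΦ : ∀ T, Φ T ≤ U.card * (d + 1) := by
    intro T
    refine (Finset.sum_le_card_nsmul _ _ (d+1) (fun u _ => min_le_left _ _)).trans (by simp)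
  obtain ⟨T, hT, hmax⟩ := Finset.exists_max_image
    (V.powerset.filter (fun T => T.card * (D - d) ≤ Φ T)) Finset.card ⟨∅, by simp⟩
  rw [Finset.mem_filter, Finset.mem_powerset] at hT
  refine ⟨T, hT.1, hT.2.trans (hΦ T), ?_⟩
  intro v hv
  by_contra hcl
  have hvT : v ∉ T := fun h => hcl (fun f _ h2 => h2 v h)
  have mono : ∀ w, clo d T w → clo d (insert v T) w := fun w hw f hf h =>
    hw f hf (fun m hm => h m (Finset.mem_insert_of_mem hm))
  have hvin : clo d (insert v T) v := fun f _ h => h v (Finset.mem_insert_self _ _)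
  let B := U.filter (fun u => meet v u ∧ cnt T u < d + 1)
  have hB : D - d ≤ B.card := by
    by_contra hlt
    apply hcl
    intro f hf hfT
    let B' := U.filter (fun u => meet v u ∧ ¬ cnt T u < d + 1)
    have hBB : B.card + B'.card = (U.filter (fun u => meet v u)).card := by
      rw [← Finset.card_filter_add_card_filter_not (s := U.filter (fun u => meet v u))
        (fun u => cnt T u < d + 1)]
      simp only [Finset.filter_filter, B, B']
    have hB' : d < B'.card := by have := hV v hv; omega
    refine few_roots (T := B') ?_ ?_ ?_ f ?_ (by omega)
    · intro m hm; exact (Finset.mem_filter.1 hm).2.1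
    · intro m hm; exact (sl m (Finset.mem_filter.1 hm).1 v hv).symm
    · intro m hm m' hm'
      exact skU m (Finset.mem_filter.1 hm).1 m' (Finset.mem_filter.1 hm').1
    · intro u hu
      obtain ⟨hu1, hu2, hu3⟩ := Finset.mem_filter.1 hu
      refine few_roots (T := V.filter (fun v => meet u v ∧ clo d T v)) ?_ ?_ ?_ f ?_ ?_
      · intro m hm; exact (Finset.mem_filter.1 hm).2.1
      · intro m hm; exact (sl u hu1 m (Finset.mem_filter.1 hm).1)
      · intro m hm m' hm'
        exact skV m (Finset.mem_filter.1 hm).1 m' (Finset.mem_filter.1 hm').1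
      · intro m hm; exact (Finset.mem_filter.1 hm).2.2 f hf hfT
      · change f.totalDegree < cnt T u
        omega
  have hstep : Φ T + B.card ≤ Φ (insert v T) := by
    have : B.card = ∑ u ∈ U, if meet v u ∧ cnt T u < d + 1 then 1 else 0 := by
      rw [Finset.card_filter]
    rw [this, ← Finset.sum_add_distrib]
    refine Finset.sum_le_sum ?_
    intro u hu
    have hsub : V.filter (fun v => meet u v ∧ clo d T v) ⊆
        V.filter (fun w => meet u w ∧ clo d (insert v T) w) := by
      intro w hw
      rw [Finset.mem_filter] at hw ⊢
      exact ⟨hw.1, hw.2.1, mono w hw.2.2⟩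
    have h1 : cnt T u ≤ cnt (insert v T) u := Finset.card_le_card hsub
    split_ifs with h
    · have : cnt T u < cnt (insert v T) u := by
        refine Finset.card_lt_card ⟨hsub, fun hs => ?_⟩
        have := hs (Finset.mem_filter.2 ⟨hv, h.1.symm, hvin⟩)
        exact hcl (Finset.mem_filter.1 this).2.2
      omega
    · omega
  have := hmax (insert v T) (by
    rw [Finset.mem_filter, Finset.mem_powerset]
    refine ⟨Finset.insert_subset hv hT.1, ?_⟩
    rw [Finset.card_insert_of_notMem hvT, add_mul, one_mul]
    have := hT.2
    omega)
  rw [Finset.card_insert_of_notMem hvT] at this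
  omega

lemma exists_vanish (T : Finset (Ln K)) (d : ℕ) (h : 6 * T.card < (d+2)*(d+3)) :
    ∃ f : MvPolynomial (Fin 3) K, f ≠ 0 ∧ f.totalDegree ≤ d ∧ ∀ l ∈ T, res l f = 0 := by
  classical
  let R : Pm K d →ₗ[K] (T → Polynomial.degreeLT K (d+1)) :=
    LinearMap.pi (fun i => (((res i.1).toLinearMap ∘ₗ (Pm K d).subtype).codRestrict _ (by
      intro c
      have h1 := mem_Pm.1 c.2
      have h2 := natDegree_res_le i.1 c.1
      rw [Polynomial.mem_degreeLT]
      refine Polynomial.degree_le_natDegree.trans_lt ?_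
      simp only [LinearMap.comp_apply, Submodule.subtype_apply, AlgHom.toLinearMap_apply]
      exact_mod_cast by omega)))
  have hfd2 : Module.finrank K (Polynomial.degreeLT K (d+1)) = d+1 := by
    rw [(Polynomial.degreeLTEquiv K (d+1)).finrank_eq]; simp
  have : FiniteDimensional K (Polynomial.degreeLT K (d+1)) :=
    Module.Finite.equiv (Polynomial.degreeLTEquiv K (d+1)).symm
  have hker : LinearMap.ker R ≠ ⊥ := by
    apply LinearMap.ker_ne_bot_of_finrank_lt
    rw [Module.finrank_pi_fintype]
    simp only [hfd2, Finset.sum_const, Finset.card_univ, Fintype.card_coe, smul_eq_mul]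
    have := finrank_Pm (K := K) d
    nlinarith
  obtain ⟨f, hf, hf0⟩ := Submodule.exists_mem_ne_zero_of_ne_bot hker
  refine ⟨f.1, fun h => hf0 (Subtype.ext h), mem_Pm.1 f.2, ?_⟩
  intro l hl
  have := congrArg Subtype.val (congrFun (LinearMap.mem_ker.1 hf) ⟨l, hl⟩)
  simpa [R] using this

open Classical in
theorem exists_low (U V : Finset (Ln K)) (D d : ℕ)
    (hU : ∀ u ∈ U, D ≤ (V.filter (fun v => meet u v)).card)
    (hV : ∀ v ∈ V, D ≤ (U.filter (fun u => meet v u)).card)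
    (skU : ∀ u ∈ U, ∀ u' ∈ U, u ≠ u' → ¬ meet u u')
    (skV : ∀ u ∈ V, ∀ u' ∈ V, u ≠ u' → ¬ meet u u')
    (sl : ∀ u ∈ U, ∀ v ∈ V, u.s ≠ v.s) (hdD : d < D)
    (hc : 6 * (U.card * (d+1)) < (d+2)*(d+3) * (D - d)) :
    ∃ f : MvPolynomial (Fin 3) K, f ≠ 0 ∧ f.totalDegree ≤ d ∧ (∀ l ∈ U, res l f = 0) ∧
      ∀ l ∈ V, res l f = 0 := by
  obtain ⟨T, hT, h1, h2⟩ := greedy U V D d hV skU skV sl hdD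
  obtain ⟨f, hf0, hfd, hf⟩ := exists_vanish T d (by
    by_contra hlt
    push Not at hlt
    have := Nat.mul_le_mul_right (D - d) hlt
    nlinarith)
  have hfV : ∀ l ∈ V, res l f = 0 := fun l hl => h2 l hl f hfd hf
  refine ⟨f, hf0, hfd, ?_, hfV⟩
  intro u hu
  refine few_roots (T := V.filter (fun v => meet u v)) ?_ ?_ ?_ f ?_ ?_
  · intro m hm; exact (Finset.mem_filter.1 hm).2
  · intro m hm; exact (sl u hu m (Finset.mem_filter.1 hm).1)
  · intro m hm m' hm'
    exact skV m (Finset.mem_filter.1 hm).1 m' (Finset.mem_filter.1 hm').1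
  · intro m hm; exact hfV m (Finset.mem_filter.1 hm).1
  · have := hU u hu
    omega
end
end Ln

namespace Ln
noncomputable section
variable {K : Type*} [Field K]

lemma irr_deg_pos {f : MvPolynomial (Fin 3) K} (hf : Irreducible f) : 0 < f.totalDegree := by
  by_contra h
  have h0 : f.totalDegree = 0 := by omega
  rw [MvPolynomial.totalDegree_eq_zero_iff_eq_C] at h0
  apply hf.not_isUnit
  have hc : MvPolynomial.coeff 0 f ≠ 0 := by
    intro e; rw [e, map_zero] at h0; exact hf.ne_zero h0
  rw [h0]
  exact (isUnit_iff_ne_zero.2 hc).map MvPolynomial.C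

open Classical in
theorem exists_factor (f : MvPolynomial (Fin 3) K) (hf0 : f ≠ 0) :
    ∀ U : Finset (Ln K), U.Nonempty → (∀ u ∈ U, res u f = 0) →
    ∃ π, Irreducible π ∧ π ∣ f ∧
      U.card * π.totalDegree ≤ (U.filter (fun u => res u π = 0)).card * f.totalDegree := by
  induction f using UniqueFactorizationMonoid.induction_on_prime with
  | h₁ => exact absurd rfl hf0
  | h₂ x hx =>
    intro U ⟨u, hu⟩ h
    have := hx.map (res u)
    rw [h u hu] at this
    exact absurd this not_isUnit_zero
  | h₃ g π hg hπ ih =>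
    intro U hU h
    have hdeg : (π * g).totalDegree = π.totalDegree + g.totalDegree :=
      MvPolynomial.totalDegree_mul_of_isDomain hπ.ne_zero hg
    by_cases hle : U.card * π.totalDegree ≤
        (U.filter (fun u => res u π = 0)).card * (π * g).totalDegree
    · exact ⟨π, hπ.irreducible, dvd_mul_right _ _, hle⟩
    push Not at hle
    have hcard := Finset.card_filter_add_card_filter_not (s := U) (fun u => res u π = 0)
    set U1 := U.filter (fun u => res u π = 0)
    set U2 := U.filter (fun u => ¬ res u π = 0) with hU2
    rw [hdeg, ← hcard] at hle
    have h1 : U1.card * g.totalDegree < U2.card * π.totalDegree := by nlinarith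
    obtain ⟨σ, hσ, hd, hn⟩ := ih hg U2 (by
      rw [← Finset.card_pos]; by_contra h0
      have : U2.card = 0 := by omega
      rw [this] at h1; omega) (by
      intro u hu
      obtain ⟨hu1, hu2⟩ := Finset.mem_filter.1 hu
      have := h u hu1
      rw [map_mul] at this
      exact (mul_eq_zero.1 this).resolve_left hu2)
    refine ⟨σ, hσ, hd.mul_left _, ?_⟩
    have hsub : (U2.filter (fun u => res u σ = 0)).card ≤ (U.filter (fun u => res u σ = 0)).card :=
      Finset.card_le_card (Finset.filter_subset_filter _ (Finset.filter_subset _ _))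
    refine le_trans ?_ (Nat.mul_le_mul_right _ hsub)
    set n2 := (U2.filter (fun u => res u σ = 0)).card
    have hσd := irr_deg_pos hσ
    have hU2p : 0 < U2.card := by
      by_contra h0
      have : U2.card = 0 := by omega
      rw [this] at h1; omega
    have hgd : 0 < g.totalDegree := by
      by_contra h0
      have h0 : g.totalDegree = 0 := by omega
      rw [h0] at hn
      have := Nat.mul_pos hU2p hσd
      omega
    rw [hdeg, ← hcard, add_mul, mul_add]
    have h2 : U1.card * σ.totalDegree ≤ n2 * π.totalDegree := by
      apply Nat.le_of_mul_le_mul_right _ hgd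
      calc U1.card * σ.totalDegree * g.totalDegree = (U1.card * g.totalDegree) * σ.totalDegree := by ring
        _ ≤ (U2.card * π.totalDegree) * σ.totalDegree := Nat.mul_le_mul_right _ h1.le
        _ = (U2.card * σ.totalDegree) * π.totalDegree := by ring
        _ ≤ (n2 * g.totalDegree) * π.totalDegree := Nat.mul_le_mul_right _ hn
        _ = _ := by ring
    omega
end
end Ln

namespace Ln
noncomputable section
set_option linter.unusedSimpArgs false
variable {K : Type*} [Field K]

abbrev MP (K : Type*) [Field K] := MvPolynomial (Fin 3) K

lemma pderiv_comm (i j : Fin 3) (f : MP K) : MvPolynomial.pderiv i (MvPolynomial.pderiv j f) =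
    MvPolynomial.pderiv j (MvPolynomial.pderiv i f) := by
  have : ⁅(MvPolynomial.pderiv i : Derivation K (MP K) (MP K)), (MvPolynomial.pderiv j : Derivation K (MP K) (MP K))⁆ = 0 := by
    apply MvPolynomial.derivation_ext
    intro k
    rw [Derivation.commutator_apply]
    simp only [MvPolynomial.pderiv_X, Pi.single_apply]
    split_ifs <;> simp
  have h := congrArg (fun d : Derivation K (MP K) (MP K) => d f) this
  simp only [Derivation.commutator_apply] at h
  exact sub_eq_zero.1 h

lemma totalDegree_pderiv_lt (i : Fin 3) (f : MP K) (h : MvPolynomial.pderiv i f ≠ 0) :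
    (MvPolynomial.pderiv i f).totalDegree < f.totalDegree := by
  have key : ∀ m ∈ (MvPolynomial.pderiv i f).support, (m.sum fun _ e => e) + 1 ≤ f.totalDegree := by
    intro m hm
    rw [MvPolynomial.mem_support_iff, MvPolynomial.coeff_pderiv] at hm
    have h1 : m + Finsupp.single i 1 ∈ f.support := by
      rw [MvPolynomial.mem_support_iff]; exact left_ne_zero_of_mul hm
    have h2 := MvPolynomial.le_totalDegree h1
    rw [Finsupp.sum_add_index' (by simp) (by simp)] at h2
    simpa using h2
  have hpos : 0 < f.totalDegree := by
    obtain ⟨m, hm⟩ := MvPolynomial.support_nonempty.2 h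
    have := key m hm; omega
  have : (MvPolynomial.pderiv i f).totalDegree ≤ f.totalDegree - 1 := by
    refine Finset.sup_le ?_
    intro m hm
    have := key m hm
    omega
  omega

lemma totalDegree_pderiv_le (i : Fin 3) (f : MP K) :
    (MvPolynomial.pderiv i f).totalDegree ≤ f.totalDegree := by
  by_cases h : MvPolynomial.pderiv i f = 0
  · simp [h]
  · exact (totalDegree_pderiv_lt i f h).le

/-- an irreducible polynomial of degree `< p` has a non-zero partial derivative -/
lemma exists_pderiv_ne {p : ℕ} [CharP K p] {f : MP K} (h0 : 0 < f.totalDegree)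
    (hp : f.totalDegree < p) : ∃ i, MvPolynomial.pderiv i f ≠ 0 := by
  by_contra hall
  push Not at hall
  have : f.totalDegree = 0 := by
    rw [MvPolynomial.totalDegree_eq_zero_iff]
    intro m hm i
    by_contra hne
    obtain ⟨m', hm'⟩ : ∃ m', m = m' + Finsupp.single i 1 := by
      refine ⟨m - Finsupp.single i 1, ?_⟩
      rw [tsub_add_cancel_of_le]
      rw [Finsupp.single_le_iff]; omega
    have h1 := MvPolynomial.coeff_pderiv (i := i) f m'
    rw [hall i, ← hm', MvPolynomial.coeff_zero] at h1
    have h2 : ((m' i + 1 : ℕ) : K) = 0 := by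
      push_cast
      exact (mul_eq_zero.1 h1.symm).resolve_left (MvPolynomial.mem_support_iff.1 hm)
    rw [CharP.cast_eq_zero_iff K p] at h2
    have h3 := Nat.le_of_dvd (by omega) h2
    have h4 := MvPolynomial.le_totalDegree hm
    have h5 : m i ≤ m.sum fun _ e => e := by
      rw [Finsupp.sum_fintype _ _ (by simp)]
      exact Finset.single_le_sum (f := fun i => m i) (fun _ _ => Nat.zero_le _) (Finset.mem_univ i)
    have h6 : m i = m' i + 1 := by rw [hm']; simp
    omega
  omega

section forms
variable (d1 d2 d3 : Derivation K (MP K) (MP K))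

def formA (f : MP K) : MP K :=
  -2 * d1 (d2 f) * d3 f ^ 3 + (d2 (d2 f) + 2 * d1 (d3 f)) * d3 f ^ 2 * d2 f
   - 2 * d2 (d3 f) * d3 f * (d2 f ^ 2 - d1 f * d3 f)
   + d3 (d3 f) * (d2 f ^ 3 - 2 * d2 f * d1 f * d3 f)

def formB (f : MP K) : MP K :=
  d1 (d1 f) * d3 f ^ 3 - (d2 (d2 f) + 2 * d1 (d3 f)) * d3 f ^ 2 * d1 f
   + 2 * d2 (d3 f) * d3 f * d2 f * d1 f
   - d3 (d3 f) * d1 f * (d2 f ^ 2 - d1 f * d3 f)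
end forms

def E1 (x : K) : Derivation K (MP K) (MP K) :=
  MvPolynomial.pderiv 0 - x • MvPolynomial.pderiv 1 + x^2 • MvPolynomial.pderiv 2
def E2 (x : K) : Derivation K (MP K) (MP K) :=
  MvPolynomial.pderiv 1 - (2 * x) • MvPolynomial.pderiv 2
def E3 : Derivation K (MP K) (MP K) := MvPolynomial.pderiv 2

def AA (f : MP K) : MP K :=
  formA (MvPolynomial.pderiv 0) (MvPolynomial.pderiv 1) (MvPolynomial.pderiv 2) f
def BB (f : MP K) : MP K :=
  formB (MvPolynomial.pderiv 0) (MvPolynomial.pderiv 1) (MvPolynomial.pderiv 2) f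

lemma E1_apply (x : K) (f : MP K) : E1 x f = MvPolynomial.pderiv 0 f
    - MvPolynomial.C x * MvPolynomial.pderiv 1 f + MvPolynomial.C x ^ 2 * MvPolynomial.pderiv 2 f := by
  simp [E1, MvPolynomial.smul_eq_C_mul]
lemma E2_apply (x : K) (f : MP K) : E2 x f = MvPolynomial.pderiv 1 f
    - 2 * MvPolynomial.C x * MvPolynomial.pderiv 2 f := by
  simp only [E2, MvPolynomial.smul_eq_C_mul, Derivation.sub_apply, Derivation.smul_apply, map_mul]
  rw [show (MvPolynomial.C (2:K) : MP K) = 2 from map_ofNat _ 2]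
lemma E3_apply (f : MP K) : E3 f = MvPolynomial.pderiv 2 f := rfl

lemma pderiv_Cx (i : Fin 3) (x : K) (f : MP K) : MvPolynomial.pderiv i (MvPolynomial.C x * f) =
    MvPolynomial.C x * MvPolynomial.pderiv i f := by simp
lemma pderiv_Cx2 (i : Fin 3) (x : K) (f : MP K) : MvPolynomial.pderiv i (MvPolynomial.C x ^ 2 * f) =
    MvPolynomial.C x ^ 2 * MvPolynomial.pderiv i f := by
  rw [← map_pow, pderiv_Cx]
lemma pderiv_Cx3 (i : Fin 3) (x : K) (f : MP K) : MvPolynomial.pderiv i (2 * MvPolynomial.C x * f) =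
    2 * MvPolynomial.C x * MvPolynomial.pderiv i f := by
  rw [show (2:MP K) = MvPolynomial.C (2:K) from (map_ofNat _ 2).symm, ← map_mul, pderiv_Cx]

lemma formA_E (x : K) (f : MP K) : formA (E1 x) (E2 x) E3 f = AA f := by
  have h1 := pderiv_comm 1 0 f
  have h2 := pderiv_comm 2 0 f
  have h3 := pderiv_comm 2 1 f
  simp only [formA, AA, E1_apply, E2_apply, E3_apply, map_sub, map_add, pderiv_Cx, pderiv_Cx2, pderiv_Cx3,
    h1, h2, h3]
  ring

lemma formB_E (x : K) (f : MP K) : formB (E1 x) (E2 x) E3 f = BB f + MvPolynomial.C x * AA f := by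
  have h1 := pderiv_comm 1 0 f
  have h2 := pderiv_comm 2 0 f
  have h3 := pderiv_comm 2 1 f
  simp only [formA, formB, AA, BB, E1_apply, E2_apply, E3_apply, map_sub, map_add, pderiv_Cx, pderiv_Cx2, pderiv_Cx3,
    h1, h2, h3]
  ring

lemma E21_comm (x : K) (f : MP K) : E2 x (E1 x f) = E1 x (E2 x f) := by
  have h1 := pderiv_comm 1 0 f
  have h2 := pderiv_comm 2 0 f
  have h3 := pderiv_comm 2 1 f
  simp only [E1_apply, E2_apply, map_sub, map_add, pderiv_Cx, pderiv_Cx2, pderiv_Cx3,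
    h1, h2, h3]
  ring
lemma E31_comm (x : K) (f : MP K) : E3 (E1 x f) = E1 x (E3 f) := by
  have h1 := pderiv_comm 1 0 f
  have h2 := pderiv_comm 2 0 f
  have h3 := pderiv_comm 2 1 f
  simp only [E1_apply, E3_apply, map_sub, map_add, pderiv_Cx, pderiv_Cx2, pderiv_Cx3,
    h1, h2, h3]

lemma res_E1 (l : Ln K) (f : MP K) : res l (E1 l.s f) = Polynomial.derivative (res l f) := by
  rw [res_deriv]; congr 1; rw [E1_apply, D, map_pow]

/-- The ODE on a line of `Z(f)` when `f` divides both `AA f`, `BB f`. -/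
theorem line_ode (l : Ln K) (f : MP K) (hf : res l f = 0) (hA : f ∣ AA f) (hB : f ∣ BB f)
    (hW : res l (E3 f) ≠ 0) :
    res l (E2 l.s f) * (res l (E3 f) * Polynomial.derivative (Polynomial.derivative (res l (E2 l.s f)))
      - res l (E2 l.s f) * Polynomial.derivative (Polynomial.derivative (res l (E3 f)))) =
    2 * Polynomial.derivative (res l (E2 l.s f)) *
     (res l (E3 f) * Polynomial.derivative (res l (E2 l.s f))
       - res l (E2 l.s f) * Polynomial.derivative (res l (E3 f))) := by
  set x := l.s with hx
  have r1 : res l (E1 x f) = 0 := by rw [hx, res_E1, hf, Polynomial.derivative_zero]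
  have r11 : res l (E1 x (E1 x f)) = 0 := by rw [hx, res_E1, ← hx, r1, Polynomial.derivative_zero]
  have r12 : res l (E1 x (E2 x f)) = Polynomial.derivative (res l (E2 x f)) := by rw [hx, res_E1]
  have r13 : res l (E1 x (E3 f)) = Polynomial.derivative (res l (E3 f)) := by rw [hx, res_E1]
  have r112 : res l (E2 x (E1 x (E1 x f))) =
      Polynomial.derivative (Polynomial.derivative (res l (E2 x f))) := by
    rw [E21_comm, E21_comm, hx, res_E1, res_E1]
  have r113 : res l (E3 (E1 x (E1 x f))) =
      Polynomial.derivative (Polynomial.derivative (res l (E3 f))) := by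
    rw [E31_comm, E31_comm, hx, res_E1, res_E1]
  -- A
  have hA0 : res l (formA (E1 x) (E2 x) E3 f) = 0 := by
    rw [formA_E]; obtain ⟨h, hh⟩ := hA; rw [hh, map_mul, hf, zero_mul]
  simp only [formA, map_add, map_sub, map_mul, map_pow, map_neg, map_ofNat, r12, r13, r1] at hA0
  -- B
  obtain ⟨h, hh⟩ : f ∣ formB (E1 x) (E2 x) E3 f := by
    rw [formB_E]; exact dvd_add hB (hA.mul_left _)
  have der : ∀ E : Derivation K (MP K) (MP K), res l (E f) * res l h =
      res l (E (E1 x (E1 x f))) * res l (E3 f) ^ 3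
      - (res l (E2 x (E2 x f)) + 2 * Polynomial.derivative (res l (E3 f))) * res l (E3 f) ^ 2
        * res l (E (E1 x f))
      + 2 * res l (E2 x (E3 f)) * res l (E3 f) * res l (E2 x f) * res l (E (E1 x f))
      - res l (E3 (E3 f)) * res l (E (E1 x f)) * res l (E2 x f) ^ 2 := by
    intro E
    have e1 : res l (E (f * h)) = res l (E f) * res l h := by
      rw [Derivation.leibniz]
      simp only [smul_eq_mul, map_add, map_mul, hf]; ring
    rw [← e1, ← hh, formB]
    simp only [map_add, map_sub, Derivation.leibniz, smul_eq_mul, map_mul, map_pow, r1, r11, r13,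
      map_ofNat]
    ring
  have d2 := der (E2 x)
  have d3 := der E3
  rw [r112, E21_comm, r12] at d2
  rw [r113, E31_comm, r13] at d3
  apply mul_left_cancel₀ (pow_ne_zero 3 hW)
  generalize Polynomial.derivative (Polynomial.derivative (res l (E2 x f))) = P2 at *
  generalize Polynomial.derivative (Polynomial.derivative (res l (E3 f))) = W2 at *
  generalize Polynomial.derivative (res l (E2 x f)) = P1 at *
  generalize Polynomial.derivative (res l (E3 f)) = W1 at *
  generalize res l (E2 x f) = P at *
  generalize res l (E3 f) = W at *
  generalize res l (E2 x (E2 x f)) = f11 at *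
  generalize res l (E2 x (E3 f)) = f12 at *
  generalize res l (E3 (E3 f)) = f22 at *
  linear_combination (W * P1 - P * W1) * hA0 + P * (P * d3 - W * d2)
end
end Ln

namespace Ln
noncomputable section
variable {K : Type*} [Field K]

lemma D_eq_E1 (x : K) (f : MP K) : D x f = E1 x f := by rw [E1_apply, D, map_pow]

/-- on a line in `Z(f)`: `A s + B = 0` -/
lemma line_AB (l : Ln K) (f : MP K) (hf : res l f = 0) :
    res l (AA f) * Polynomial.C l.s + res l (BB f) = 0 := by
  have r1 : res l (E1 l.s f) = 0 := by rw [res_E1, hf, Polynomial.derivative_zero]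
  have r11 : res l (E1 l.s (E1 l.s f)) = 0 := by rw [res_E1, r1, Polynomial.derivative_zero]
  have h := congrArg (res l) (formB_E l.s f)
  rw [map_add, map_mul, res_C] at h
  rw [mul_comm, add_comm, ← h]
  simp only [formB, map_add, map_sub, map_mul, map_pow, r1, r11]
  ring

lemma cross {l m : Ln K} {f : MP K} (hl : res l f = 0) (hm : res m f = 0) (h : meet l m)
    (hs : l.s ≠ m.s) :
    (res l (AA f)).eval (mt l m) = 0 ∧ (res l (BB f)).eval (mt l m) = 0 ∧
    ((res l (MvPolynomial.pderiv 2 f)).eval (mt l m) = 0 → 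
      ∀ i, (res l (MvPolynomial.pderiv i f)).eval (mt l m) = 0) ∧
    (res l (E2 l.s f)).eval (mt l m) = (m.s - l.s) * (res l (E3 f)).eval (mt l m) := by
  have hs' : l.s - m.s ≠ 0 := sub_ne_zero.2 hs
  have a1 := congrArg (Polynomial.eval (mt l m)) (line_AB l f hl)
  have a2 := congrArg (Polynomial.eval (mt l m)) (line_AB m f hm)
  simp only [Polynomial.eval_add, Polynomial.eval_mul, Polynomial.eval_C, Polynomial.eval_zero,
    ← eval_meet h hs] at a1 a2
  have hA : (res l (AA f)).eval (mt l m) = 0 := by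
    apply mul_left_cancel₀ hs'; linear_combination a1 - a2
  have b1 : res l (E1 l.s f) = 0 := by rw [res_E1, hl, Polynomial.derivative_zero]
  have b2 : res m (E1 m.s f) = 0 := by rw [res_E1, hm, Polynomial.derivative_zero]
  replace b1 := congrArg (Polynomial.eval (mt l m)) b1
  replace b2 := congrArg (Polynomial.eval (mt l m)) b2
  simp only [E1_apply, map_add, map_sub, map_mul, map_pow, res_C, Polynomial.eval_add,
    Polynomial.eval_sub, Polynomial.eval_pow,
    Polynomial.eval_mul, Polynomial.eval_C, Polynomial.eval_zero, ← eval_meet h hs] at b1 b2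
  have b3 : (res l (MvPolynomial.pderiv 1 f)).eval (mt l m) =
      (l.s + m.s) * (res l (MvPolynomial.pderiv 2 f)).eval (mt l m) := by
    apply mul_left_cancel₀ hs'; linear_combination b2 - b1
  refine ⟨hA, by rw [hA] at a1; linear_combination a1, ?_, ?_⟩
  · intro h2
    rw [h2, mul_zero] at b3
    rw [b3, h2] at b1
    intro i
    fin_cases i
    · simpa using b1
    · exact b3
    · exact h2
  · simp only [E2_apply, E3_apply, map_sub, map_mul, map_ofNat, res_C, Polynomial.eval_sub,
      Polynomial.eval_mul, Polynomial.eval_C, Polynomial.eval_ofNat, b3]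
    ring

lemma two_deg : (2 : MP K).totalDegree = 0 := by
  rw [show (2:MP K) = MvPolynomial.C (2:K) from (map_ofNat _ 2).symm]; simp

lemma deg_forms (f : MP K) : (AA f).totalDegree ≤ 4 * f.totalDegree ∧
    (BB f).totalDegree ≤ 4 * f.totalDegree := by
  set d := f.totalDegree
  have h1 : ∀ i, MvPolynomial.pderiv i f ∈ Pm K d := fun i => mem_Pm.2 (totalDegree_pderiv_le i f)
  have h2 : ∀ i j, MvPolynomial.pderiv i (MvPolynomial.pderiv j f) ∈ Pm K d := fun i j =>
    mem_Pm.2 ((totalDegree_pderiv_le i _).trans (totalDegree_pderiv_le j f))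
  have mul : ∀ (a b c : ℕ) (u v : MP K), a + b = c → u ∈ Pm K a → v ∈ Pm K b → u * v ∈ Pm K c := by
    intro a b c u v h hu hv
    rw [mem_Pm] at *
    exact (MvPolynomial.totalDegree_mul _ _).trans (by omega)
  have two : (2 : MP K) ∈ Pm K 0 := by rw [mem_Pm, two_deg]
  have ntwo : (-2 : MP K) ∈ Pm K 0 := Submodule.neg_mem _ two
  have pow : ∀ (n a c : ℕ) (u : MP K), n * a = c → u ∈ Pm K a → u ^ n ∈ Pm K c := by
    intro n a c u h hu
    rw [mem_Pm] at *
    refine (MvPolynomial.totalDegree_pow _ _).trans ?_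
    rw [← h]; exact Nat.mul_le_mul_left _ hu
  rw [← mem_Pm, ← mem_Pm]
  have hq : ∀ i j k l, MvPolynomial.pderiv i (MvPolynomial.pderiv j f) +
      2 * MvPolynomial.pderiv k (MvPolynomial.pderiv l f) ∈ Pm K d := fun i j k l =>
    Submodule.add_mem _ (h2 i j) (mul 0 d d _ _ (by omega) two (h2 k l))
  have hsq : ∀ i j k, MvPolynomial.pderiv i f ^ 2 - MvPolynomial.pderiv j f * MvPolynomial.pderiv k f
      ∈ Pm K (2 * d) := fun i j k =>
    Submodule.sub_mem _ (pow 2 d _ _ rfl (h1 i)) (mul d d _ _ _ (by omega) (h1 j) (h1 k))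
  constructor
  · unfold AA formA
    refine Submodule.add_mem _ (Submodule.sub_mem _ (Submodule.add_mem _ ?_ ?_) ?_) ?_
    · exact mul d (3*d) _ _ _ (by omega) (mul 0 d _ _ _ (by omega) ntwo (h2 _ _)) (pow 3 d _ _ rfl (h1 _))
    · exact mul (3*d) d _ _ _ (by omega) (mul d (2*d) _ _ _ (by omega) (hq _ _ _ _) (pow 2 d _ _ rfl (h1 _))) (h1 _)
    · exact mul (2*d) (2*d) _ _ _ (by omega) (mul d d _ _ _ (by omega)
        (mul 0 d _ _ _ (by omega) two (h2 _ _)) (h1 _)) (hsq _ _ _)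
    · refine mul d (3*d) _ _ _ (by omega) (h2 _ _) (Submodule.sub_mem _ (pow 3 d _ _ rfl (h1 _)) ?_)
      exact mul (2*d) d _ _ _ (by omega) (mul d d _ _ _ (by omega)
        (mul 0 d _ _ _ (by omega) two (h1 _)) (h1 _)) (h1 _)
  · unfold BB formB
    refine Submodule.sub_mem _ (Submodule.add_mem _ (Submodule.sub_mem _ ?_ ?_) ?_) ?_
    · exact mul d (3*d) _ _ _ (by omega) (h2 _ _) (pow 3 d _ _ rfl (h1 _))
    · exact mul (3*d) d _ _ _ (by omega) (mul d (2*d) _ _ _ (by omega) (hq _ _ _ _) (pow 2 d _ _ rfl (h1 _))) (h1 _)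
    · exact mul (3*d) d _ _ _ (by omega) (mul (2*d) d _ _ _ (by omega) (mul d d _ _ _ (by omega)
        (mul 0 d _ _ _ (by omega) two (h2 _ _)) (h1 _)) (h1 _)) (h1 _)
    · exact mul (2*d) (2*d) _ _ _ (by omega) (mul d d _ _ _ (by omega) (h2 _ _) (h1 _)) (hsq _ _ _)
end
end Ln

namespace Ln
noncomputable section
variable {K : Type*} [Field K]

open Classical in
theorem core2 {p : ℕ} [CharP K p] {f : MP K} (hf : Irreducible f) (hp : 3 * f.totalDegree < p)
    (G : Finset (Ln K)) (N : Ln K → Finset (Ln K)) (k : ℕ)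
    (hG : 4 * f.totalDegree ^ 2 < G.card) (hGf : ∀ u ∈ G, res u f = 0)
    (hNf : ∀ u ∈ G, ∀ v ∈ N u, res v f = 0)
    (hNm : ∀ u ∈ G, ∀ v ∈ N u, meet u v)
    (hNs : ∀ u ∈ G, ∀ v ∈ N u, u.s ≠ v.s)
    (hNk : ∀ u ∈ G, ∀ v ∈ N u, ∀ v' ∈ N u, v ≠ v' → ¬ meet v v')
    (hN4 : ∀ u ∈ G, 4 * f.totalDegree < (N u).card)
    (hNc : ∀ u ∈ G, k + f.totalDegree < (N u).card)
    (hk : ∀ u ∈ G, ∀ c b : K,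
      ((N u).filter (fun v => c * (v.c - u.c) + b * (v.s - u.s) = 1)).card ≤ k) : False := by
  have hpos := irr_deg_pos hf
  set δ := f.totalDegree with hδ
  have step : ∀ g : MP K, g.totalDegree ≤ 4 * δ → (∀ u ∈ G, res u g = 0) → f ∣ g := by
    intro g hg h
    by_contra hd
    have := bezout hf hd G (fun u hu => ⟨hGf u hu, h u hu⟩)
    nlinarith
  have hA : f ∣ AA f := by
    refine step _ (deg_forms f).1 ?_
    intro u hu
    refine many_roots (hNm u hu) (hNs u hu) (hNk u hu) _ ?_ 
      (((natDegree_res_le _ _).trans (deg_forms f).1).trans_lt (hN4 u hu))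
    intro v hv
    exact (cross (hGf u hu) (hNf u hu v hv) (hNm u hu v hv) (hNs u hu v hv)).1
  have hB : f ∣ BB f := by
    refine step _ (deg_forms f).2 ?_
    intro u hu
    refine many_roots (hNm u hu) (hNs u hu) (hNk u hu) _ ?_ 
      (((natDegree_res_le _ _).trans (deg_forms f).2).trans_lt (hN4 u hu))
    intro v hv
    exact (cross (hGf u hu) (hNf u hu v hv) (hNm u hu v hv) (hNs u hu v hv)).2.1
  have nd : ∀ i, MvPolynomial.pderiv i f ≠ 0 → ¬ f ∣ MvPolynomial.pderiv i f := by
    intro i hi hd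
    have h1 := totalDegree_pderiv_lt i f hi
    have h2 := MvPolynomial.totalDegree_le_of_dvd_of_isDomain hd hi
    omega
  have hf2 : MvPolynomial.pderiv 2 f ≠ 0 := by
    intro h0
    obtain ⟨i, hi⟩ := exists_pderiv_ne (p := p) (f := f) hpos (by omega)
    refine nd i hi (step _ ((totalDegree_pderiv_le i f).trans (by omega)) ?_)
    intro u hu
    refine many_roots (hNm u hu) (hNs u hu) (hNk u hu) _ ?_ 
      (((natDegree_res_le _ _).trans (totalDegree_pderiv_le i f)).trans_lt (by have := hN4 u hu; omega))
    intro v hv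
    exact (cross (hGf u hu) (hNf u hu v hv) (hNm u hu v hv) (hNs u hu v hv)).2.2.1 
      (by rw [h0]; simp) i
  obtain ⟨u, hu, hW⟩ : ∃ u ∈ G, res u (MvPolynomial.pderiv 2 f) ≠ 0 := by
    by_contra hall
    push Not at hall
    exact nd 2 hf2 (step _ ((totalDegree_pderiv_le 2 f).trans (by omega)) hall)
  have hode := line_ode u f (hGf u hu) hA hB hW
  have hX := fun v hv => (cross (hGf u hu) (hNf u hu v hv) (hNm u hu v hv) (hNs u hu v hv)).2.2.2
  have dW : (res u (E3 f)).natDegree ≤ δ := (natDegree_res_le _ _).trans (totalDegree_pderiv_le 2 f)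
  have dP : (res u (E2 u.s f)).natDegree ≤ δ := by
    refine (natDegree_res_le _ _).trans ?_
    rw [E2_apply, ← mem_Pm]
    refine Submodule.sub_mem _ (mem_Pm.2 (totalDegree_pderiv_le 1 f)) (mem_Pm.2 ?_)
    refine (MvPolynomial.totalDegree_mul _ _).trans ?_
    have h1 := MvPolynomial.totalDegree_mul (2 : MP K) (MvPolynomial.C u.s)
    rw [two_deg, MvPolynomial.totalDegree_C] at h1
    have := totalDegree_pderiv_le 2 f
    omega
  set W := res u (E3 f) with hWdef
  set P := res u (E2 u.s f) with hPdef
  have hW0 : W ≠ 0 := hW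
  have hcard := Finset.card_filter_add_card_filter_not (s := N u) (fun v => W.eval (mt u v) = 0)
  have hfew : ((N u).filter (fun v => W.eval (mt u v) = 0)).card ≤ δ := by
    by_contra hlt
    push Not at hlt
    apply hW0
    refine many_roots (l := u) (T := (N u).filter (fun v => W.eval (mt u v) = 0)) ?_ ?_ ?_ W ?_ (by omega)
    · intro m hm; exact hNm u hu m (Finset.mem_filter.1 hm).1
    · intro m hm; exact hNs u hu m (Finset.mem_filter.1 hm).1
    · intro m hm m' hm'; exact hNk u hu m (Finset.mem_filter.1 hm).1 m' (Finset.mem_filter.1 hm').1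
    · intro m hm; exact (Finset.mem_filter.1 hm).2
  have hNu := hNc u hu
  have hbig : k < ((N u).filter (fun v => ¬ W.eval (mt u v) = 0)).card := by omega
  obtain ⟨v0, hv0⟩ := Finset.card_pos.1 (Nat.zero_lt_of_lt hbig)
  rw [Finset.mem_filter] at hv0
  have hP0 : P ≠ 0 := by
    intro h0
    have := hX v0 hv0.1
    rw [h0, Polynomial.eval_zero] at this
    rcases mul_eq_zero.1 this.symm with h | h
    · exact hNs u hu v0 hv0.1 (sub_eq_zero.1 h).symm
    · exact hv0.2 h
  obtain ⟨c, b, hcb⟩ := ode (p := p) hP0 dP dW (by omega) hode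
  have hsub : (N u).filter (fun v => ¬ W.eval (mt u v) = 0) ⊆
      (N u).filter (fun v => c * (v.c - u.c) + b * (v.s - u.s) = 1) := by
    intro v hv
    obtain ⟨hv1, hv2⟩ := Finset.mem_filter.1 hv
    refine Finset.mem_filter.2 ⟨hv1, ?_⟩
    have e1 := hX v hv1
    have e2 := congrArg (Polynomial.eval (mt u v)) hcb
    rw [Polynomial.eval_mul, e1] at e2
    simp only [Polynomial.eval_add, Polynomial.eval_mul, Polynomial.eval_C, Polynomial.eval_X] at e2
    have e3 : (c * mt u v + b) * (v.s - u.s) = 1 := by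
      apply mul_right_cancel₀ hv2
      linear_combination -e2
    have hs : u.s - v.s ≠ 0 := sub_ne_zero.2 (hNs u hu v hv1)
    have e4 : mt u v * (u.s - v.s) = u.c - v.c := by unfold mt; field_simp
    linear_combination e3 + c * e4
  have := (Finset.card_le_card hsub).trans (hk u hu c b)
  omega

open Classical in
theorem core {p : ℕ} [CharP K p] (U V : Finset (Ln K)) (D k : ℕ) (hne : U.Nonempty)
    (hU : ∀ u ∈ U, D ≤ (V.filter (fun v => meet u v)).card)
    (hV : ∀ v ∈ V, D ≤ (U.filter (fun u => meet v u)).card)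
    (skU : ∀ u ∈ U, ∀ u' ∈ U, u ≠ u' → ¬ meet u u')
    (skV : ∀ u ∈ V, ∀ u' ∈ V, u ≠ u' → ¬ meet u u')
    (sl : ∀ u ∈ U, ∀ v ∈ V, u.s ≠ v.s)
    (hD : 2000 * U.card ≤ D ^ 2) (hp : U.card < p ^ 2) (hDk : 4 * k < D)
    (hk : ∀ u ∈ U, ∀ c b : K,
      (V.filter (fun v => meet u v ∧ c * (v.c - u.c) + b * (v.s - u.s) = 1)).card ≤ k) : False := by
  have hDpos : 0 < D := by omega
  have hUp := hne.card_pos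
  have hnD : D ≤ U.card := by
    obtain ⟨u, hu⟩ := hne
    have : 0 < (V.filter (fun v => meet u v)).card := hDpos.trans_le (hU u hu)
    obtain ⟨v, hv⟩ := Finset.card_pos.1 this
    exact (hV v (Finset.mem_filter.1 hv).1).trans (Finset.card_le_card (Finset.filter_subset _ _))
  set n := U.card with hn
  obtain ⟨d, hd⟩ : ∃ d, d = 12 * n / D + 1 := ⟨_, rfl⟩
  have hd1 : D * d ≤ 13 * n := by
    have := Nat.mul_div_le (12 * n) D
    rw [hd, mul_add]; omega
  have hd2 : 12 * n < D * d := by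
    rw [hd]; exact Nat.lt_mul_div_succ _ hDpos
  have hd0 : 0 < d := by rw [hd]; exact Nat.succ_pos _
  have hdD : 2000 * d ≤ 13 * D := by
    apply Nat.le_of_mul_le_mul_left _ hDpos
    nlinarith
  have hdn : 2000 * d ^ 2 ≤ 169 * n := by
    apply Nat.le_of_mul_le_mul_left _ hUp
    calc n * (2000 * d^2) = (2000 * n) * d^2 := by ring
      _ ≤ D^2 * d^2 := Nat.mul_le_mul_right _ hD
      _ = (D * d) * (D * d) := by ring
      _ ≤ (13 * n) * (13 * n) := Nat.mul_le_mul hd1 hd1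
      _ = n * (169 * n) := by ring
  have hd3 : 3 * d < p := by
    by_contra hlt
    push Not at hlt
    have := Nat.pow_le_pow_left hlt 2
    nlinarith
  have hlow := exists_low U V D d hU hV skU skV sl (by omega) (by
    obtain ⟨e, he⟩ : ∃ e, D = d + e := Nat.exists_eq_add_of_le (by omega)
    have h1 : 152 * d ≤ e := by omega
    have h2 : D - d = e := by omega
    rw [h2]
    rw [he] at hd2
    nlinarith)
  have hex : ∃ e, ∃ f : MP K, f ≠ 0 ∧ f.totalDegree = e ∧ (∀ l ∈ U, res l f = 0) ∧
      ∀ l ∈ V, res l f = 0 := by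
    obtain ⟨f, h1, h2, h3⟩ := hlow
    exact ⟨_, f, h1, rfl, h3⟩
  obtain ⟨f, hf0, hfe, hfU, hfV⟩ := Nat.find_spec hex
  have hmin : ∀ g : MP K, g ≠ 0 → (∀ l ∈ U, res l g = 0) → (∀ l ∈ V, res l g = 0) →
      f.totalDegree ≤ g.totalDegree := by
    intro g h1 h2 h3
    rw [hfe]
    exact Nat.find_min' hex ⟨g, h1, rfl, h2, h3⟩
  have hfd : f.totalDegree ≤ d := by
    obtain ⟨g, h1, h2, h3, h4⟩ := hlow
    exact (hmin g h1 h3 h4).trans h2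
  obtain ⟨π, hπ, ⟨g, hg⟩, hπn⟩ := exists_factor f hf0 U hne hfU
  have hπpos := irr_deg_pos hπ
  have hg0 : g ≠ 0 := by rintro rfl; exact hf0 (by rw [hg, mul_zero])
  have hdeg : f.totalDegree = π.totalDegree + g.totalDegree := by
    rw [hg]; exact MvPolynomial.totalDegree_mul_of_isDomain hπ.ne_zero hg0
  have hπg : ¬ π ∣ g := by
    intro hdv
    have key : ∀ l, res l f = 0 → res l g = 0 := by
      intro l hl
      rw [hg, map_mul] at hl
      rcases mul_eq_zero.1 hl with h | h
      · obtain ⟨q, hq⟩ := hdv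
        rw [hq, map_mul, h, zero_mul]
      · exact h
    have := hmin g hg0 (fun l hl => key l (hfU l hl)) (fun l hl => key l (hfV l hl))
    omega
  set nπ := (U.filter (fun u => res u π = 0)).card with hnπ
  set δ0 := f.totalDegree with hδ0
  have hcard := Finset.card_filter_add_card_filter_not (s := U.filter (fun u => res u π = 0))
    (fun u => res u g = 0)
  rw [← hnπ, Finset.filter_filter, Finset.filter_filter] at hcard
  have hbez := bezout hπ hπg (U.filter (fun u => res u π = 0 ∧ res u g = 0)) (by
    intro l hl; exact (Finset.mem_filter.1 hl).2)
  set G := U.filter (fun u => res u π = 0 ∧ ¬ res u g = 0) with hG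
  have h10 : 10 * δ0 ^ 2 ≤ n := by
    have := Nat.pow_le_pow_left hfd 2
    omega
  have hnb : 10 * δ0 * π.totalDegree ≤ nπ := by
    apply Nat.le_of_mul_le_mul_right _ (show 0 < δ0 by omega)
    calc 10 * δ0 * π.totalDegree * δ0 = (10 * δ0^2) * π.totalDegree := by ring
      _ ≤ n * π.totalDegree := Nat.mul_le_mul_right _ h10
      _ ≤ _ := hπn
  refine core2 (p := p) hπ (by omega) G (fun u => V.filter (fun v => meet u v ∧ res v π = 0)) k
    ?_ ?_ ?_ ?_ ?_ ?_ ?_ ?_ ?_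
  · have h1 : π.totalDegree * g.totalDegree ≤ δ0 * π.totalDegree := by rw [hdeg]; nlinarith
    have h2 : π.totalDegree ^ 2 ≤ δ0 * π.totalDegree := by rw [hdeg]; nlinarith
    have h3 : 0 < π.totalDegree ^ 2 := by positivity
    have h4 : 10 * (δ0 * π.totalDegree) ≤ nπ := by rw [← mul_assoc]; exact hnb
    omega
  · intro u hu; exact (Finset.mem_filter.1 hu).2.1
  · intro u hu v hv; exact (Finset.mem_filter.1 hv).2.2
  · intro u hu v hv; exact (Finset.mem_filter.1 hv).2.1
  · intro u hu v hv; exact sl u (Finset.mem_filter.1 hu).1 v (Finset.mem_filter.1 hv).1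
  · intro u hu v hv v' hv'; exact skV v (Finset.mem_filter.1 hv).1 v' (Finset.mem_filter.1 hv').1
  all_goals
    intro u hu
    obtain ⟨hu1, hu2, hu3⟩ := Finset.mem_filter.1 hu
  rotate_left 2
  · intro c b
    refine le_trans (Finset.card_le_card ?_) (hk u hu1 c b)
    intro v hv
    simp only [Finset.mem_filter] at hv ⊢
    tauto
  all_goals
    have hc2 := Finset.card_filter_add_card_filter_not (s := V.filter (fun v => meet u v))
      (fun v => res v π = 0)
    rw [Finset.filter_filter, Finset.filter_filter] at hc2
    have hfew : (V.filter (fun v => meet u v ∧ ¬ res v π = 0)).card ≤ g.totalDegree := by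
      by_contra hlt
      push Not at hlt
      apply hu3
      refine few_roots (T := V.filter (fun v => meet u v ∧ ¬ res v π = 0)) ?_ ?_ ?_ g ?_ hlt
      · intro m hm; exact (Finset.mem_filter.1 hm).2.1
      · intro m hm; exact (sl u hu1 m (Finset.mem_filter.1 hm).1)
      · intro m hm m' hm'
        exact skV m (Finset.mem_filter.1 hm).1 m' (Finset.mem_filter.1 hm').1
      · intro m hm
        have h1 := hfV m (Finset.mem_filter.1 hm).1
        rw [hg, map_mul] at h1
        exact (mul_eq_zero.1 h1).resolve_left (Finset.mem_filter.1 hm).2.2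
    have := hU u hu1
    omega
end
end Ln

namespace Ln
noncomputable section

open Classical in
lemma prune {α : Type*} (R : α → α → Prop) (D : ℕ) : ∀ (N : ℕ) (U V : Finset α), U.card + V.card = N →
    D * (U.card + V.card) < ∑ u ∈ U, (V.filter (fun v => R u v)).card →
    ∃ U' ⊆ U, ∃ V' ⊆ V, U'.Nonempty ∧ (∀ u ∈ U', D ≤ (V'.filter (fun v => R u v)).card) ∧
      (∀ v ∈ V', D ≤ (U'.filter (fun u => R u v)).card) := by
  intro N
  induction N with
  | zero =>
    intro U V h1 h2
    have : U = ∅ := by rw [← Finset.card_eq_zero]; omega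
    subst this
    simp at h2
  | succ N ih =>
    intro U V h1 h2
    by_cases hu : ∃ u ∈ U, (V.filter (fun v => R u v)).card < D
    · obtain ⟨u, hu, hlt⟩ := hu
      have hc := Finset.card_erase_add_one hu
      have hs := Finset.add_sum_erase U (fun u => (V.filter (fun v => R u v)).card) hu
      obtain ⟨U', hU', V', hV', h⟩ := ih (U.erase u) V (by omega) (by
        have : D * (U.card + V.card) = D * ((U.erase u).card + V.card) + D := by rw [← hc]; ring
        omega)
      exact ⟨U', hU'.trans (Finset.erase_subset _ _), V', hV', h⟩
    by_cases hv : ∃ v ∈ V, (U.filter (fun u => R u v)).card < D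
    · obtain ⟨v, hv, hlt⟩ := hv
      have hc := Finset.card_erase_add_one hv
      have hs := Finset.add_sum_erase V (fun v => (U.filter (fun u => R u v)).card) hv
      have sw : ∀ V : Finset α, ∑ u ∈ U, (V.filter (fun v => R u v)).card =
        ∑ v ∈ V, (U.filter (fun u => R u v)).card := fun V =>
        Finset.sum_card_bipartiteAbove_eq_sum_card_bipartiteBelow R
      rw [sw] at h2
      obtain ⟨U', hU', V', hV', h⟩ := ih U (V.erase v) (by omega) (by
        rw [sw]
        have : D * (U.card + V.card) = D * (U.card + (V.erase v).card) + D := by rw [← hc]; ring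
        omega)
      exact ⟨U', hU', V', hV'.trans (Finset.erase_subset _ _), h⟩
    push Not at hu hv
    refine ⟨U, Finset.Subset.refl _, V, Finset.Subset.refl _, ?_, hu, hv⟩
    rw [Finset.nonempty_iff_ne_empty]
    rintro rfl
    simp at h2

/-- Cauchy Schwarz for fibres -/
lemma cs {α β : Type*} [DecidableEq β] (Q : Finset α) (φ : α → β) :
    Q.card ^ 2 ≤ (Q.image φ).card * ∑ q ∈ Q, (Q.filter (fun q' => φ q' = φ q)).card := by
  have h1 : Q.card = ∑ y ∈ Q.image φ, (Q.filter (fun q => φ q = y)).card :=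
    Finset.card_eq_sum_card_image φ Q
  have h2 : ∑ q ∈ Q, (Q.filter (fun q' => φ q' = φ q)).card =
      ∑ y ∈ Q.image φ, (Q.filter (fun q => φ q = y)).card ^ 2 := by
    rw [← Finset.sum_fiberwise_of_maps_to (g := φ) (t := Q.image φ)
      (fun q hq => Finset.mem_image_of_mem φ hq)]
    refine Finset.sum_congr rfl ?_
    intro y _
    rw [Finset.sum_congr rfl (g := fun _ => (Q.filter (fun q => φ q = y)).card)]
    · rw [Finset.sum_const, smul_eq_mul, sq]
    · intro q hq
      rw [(Finset.mem_filter.1 hq).2]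
  rw [h2]
  conv_lhs => rw [h1]
  exact sq_sum_le_card_mul_sum_sq

lemma edges {F : Type*} [Field F] [DecidableEq F] (X A : Finset F) :
    (∑ q ∈ X ×ˢ A ×ˢ A, ((X ×ˢ A ×ˢ A).filter (fun q' =>
      q.1 * (q'.2.1 - q.2.2) = q'.1 * (q.2.1 - q'.2.2))).card) =
    ∑ q ∈ X ×ˢ A ×ˢ A, ((X ×ˢ A ×ˢ A).filter (fun q' =>
      q'.1 * (q'.2.1 - q'.2.2) = q.1 * (q.2.1 - q.2.2))).card := by
  rw [← Finset.card_sigma, ← Finset.card_sigma]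
  refine Finset.card_nbij' (fun r => ⟨(r.2.1, r.1.2.1, r.2.2.2), (r.1.1, r.2.2.1, r.1.2.2)⟩)
    (fun r => ⟨(r.2.1, r.1.2.1, r.2.2.2), (r.1.1, r.2.2.1, r.1.2.2)⟩) ?_ ?_ ?_ ?_
  · rintro ⟨⟨x, c, d⟩, ⟨x', c', d'⟩⟩ h
    simp at h ⊢
    tauto
  · rintro ⟨⟨x, c, d⟩, ⟨x', c', d'⟩⟩ h
    simp at h ⊢
    tauto
  · rintro ⟨⟨x, c, d⟩, ⟨x', c', d'⟩⟩ h; rfl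
  · rintro ⟨⟨x, c, d⟩, ⟨x', c', d'⟩⟩ h; rfl

variable {K : Type*} [Field K]

lemma exists_theta_eta (F : Type*) [Field F] [Finite F] [Algebra F K] [Infinite K] :
    ∃ θ η : K, (∀ a : F, algebraMap F K a ≠ θ) ∧ 
      (∀ x1 c1 d1 x2 c2 d2 : F, x1 ≠ x2 → 
        (algebraMap F K (x1 - x2)) * η ≠ θ * algebraMap F K (x1 * c2 - x2 * c1) +
          algebraMap F K (x2 * d2 - x1 * d1)) ∧
      (∀ x1 c1 d1 x2 c2 d2 : F, x1 ≠ x2 → 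
        (algebraMap F K (x2 - x1)) * η ≠ algebraMap F K (x1 * c2 - x2 * c1) +
          θ * algebraMap F K (x2 * d2 - x1 * d1)) := by
  obtain ⟨θ, hθ⟩ := (Set.finite_range (algebraMap F K)).infinite_compl.nonempty
  let e1 : F × F × F × F × F × F → K := fun ⟨x1, c1, d1, x2, c2, d2⟩ =>
    (θ * algebraMap F K (x1 * c2 - x2 * c1) +
          algebraMap F K (x2 * d2 - x1 * d1)) / algebraMap F K (x1 - x2)
  let e2 : F × F × F × F × F × F → K := fun ⟨x1, c1, d1, x2, c2, d2⟩ =>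
    (algebraMap F K (x1 * c2 - x2 * c1) +
          θ * algebraMap F K (x2 * d2 - x1 * d1)) / algebraMap F K (x2 - x1)
  obtain ⟨η, hη⟩ := ((Set.finite_range e1).union (Set.finite_range e2)).infinite_compl.nonempty
  refine ⟨θ, η, fun a h => hθ ⟨a, h⟩, ?_, ?_⟩
  · intro x1 c1 d1 x2 c2 d2 hx h
    have h0 : algebraMap F K (x1 - x2) ≠ 0 := by
      rw [Ne, map_eq_zero]; exact sub_ne_zero.2 hx
    apply hη
    left
    exact ⟨(x1, c1, d1, x2, c2, d2), by simp only [e1]; rw [← h]; field_simp⟩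
  · intro x1 c1 d1 x2 c2 d2 hx h
    have h0 : algebraMap F K (x2 - x1) ≠ 0 := by
      rw [Ne, map_eq_zero]; exact sub_ne_zero.2 hx.symm
    apply hη
    right
    exact ⟨(x1, c1, d1, x2, c2, d2), by simp only [e2]; rw [← h]; field_simp⟩
end
end Ln

namespace Ln
noncomputable section
variable {K : Type*} [Field K] {F : Type*} [Field F] [Algebra F K]

def L1 (θ η : K) (q : F × F × F) : Ln K :=
  ⟨θ * algebraMap F K q.1, algebraMap F K q.2.1, algebraMap F K q.1 * (algebraMap F K q.2.2 + η)⟩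
def L2 (θ η : K) (q : F × F × F) : Ln K :=
  ⟨algebraMap F K q.1, (algebraMap F K q.2.1 + η) / θ, algebraMap F K q.1 * algebraMap F K q.2.2⟩

lemma theta_indep {θ : K} (hθ : ∀ a : F, algebraMap F K a ≠ θ) {a b : F}
    (h : θ * algebraMap F K a = algebraMap F K b) : a = 0 ∧ b = 0 := by
  by_cases ha : a = 0
  · subst ha
    rw [map_zero, mul_zero] at h
    exact ⟨rfl, (map_eq_zero _).1 h.symm⟩
  · exfalso
    have ha' : algebraMap F K a ≠ 0 := by rwa [Ne, map_eq_zero]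
    apply hθ (b / a)
    rw [map_div₀, ← h]; field_simp

lemma meet_L {θ η : K} (h0 : θ ≠ 0) (q q' : F × F × F) :
    meet (L1 θ η q) (L2 θ η q') ↔ q.1 * (q'.2.1 - q.2.2) = q'.1 * (q.2.1 - q'.2.2) := by
  rw [← (algebraMap F K).injective.eq_iff]
  simp only [meet, L1, L2, map_mul, map_sub]
  have : θ * algebraMap F K q.1 * ((algebraMap F K q'.2.1 + η) / θ) =
    algebraMap F K q.1 * (algebraMap F K q'.2.1 + η) := by field_simp
  rw [this]
  constructor <;> intro h <;> linear_combination -h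

open Classical in
theorem main_count {p : ℕ} [Fact p.Prime] (X A : Finset (ZMod p)) (hX0 : (0 : ZMod p) ∉ X)
    (hXA : X.card ≤ A.card) (D : ℕ) (hD : 2000 * (X.card * A.card ^ 2) ≤ D ^ 2) 
    (hp : X.card * A.card ^ 2 < p ^ 2) (hDk : 4 * A.card < D) :
    ∑ q ∈ X ×ˢ A ×ˢ A, ((X ×ˢ A ×ˢ A).filter (fun q' =>
      q.1 * (q'.2.1 - q.2.2) = q'.1 * (q.2.1 - q'.2.2))).card ≤ D * (2 * (X.card * A.card ^ 2)) := by
  by_contra hlt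
  push Not at hlt
  let F := ZMod p
  let K := AlgebraicClosure F
  have : CharP K p := charP_of_injective_algebraMap (algebraMap F K).injective p
  have : Infinite K := IsAlgClosed.instInfinite
  obtain ⟨θ, η, hθ, hη1, hη2⟩ := exists_theta_eta (K := K) F
  have h0 : θ ≠ 0 := fun h => hθ 0 (by rw [h, map_zero])
  have inj := (algebraMap F K).injective
  set Q := X ×ˢ A ×ˢ A with hQ
  have hQx : ∀ q ∈ Q, q.1 ≠ 0 := by
    intro q hq h
    rw [hQ, Finset.mem_product] at hq
    exact hX0 (h ▸ hq.1)
  have hQc : Q.card = X.card * A.card ^ 2 := by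
    rw [hQ, Finset.card_product, Finset.card_product, sq]
  have inj1 : Set.InjOn (L1 (F := F) θ η) Q := by
    rintro ⟨x, c, d⟩ h ⟨x', c', d'⟩ h' e
    have hx := hQx _ h
    simp only [L1, Ln.mk.injEq] at e hx
    obtain ⟨e1, e2, e3⟩ := e
    have e1 := inj (mul_left_cancel₀ h0 e1)
    have e2 := inj e2
    subst e1 e2
    have e3 := inj (add_right_cancel (mul_left_cancel₀ ((map_ne_zero (algebraMap F K)).2 hx) e3))
    subst e3; rfl
  have inj2 : Set.InjOn (L2 (F := F) θ η) Q := by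
    rintro ⟨x, c, d⟩ h ⟨x', c', d'⟩ h' e
    have hx := hQx _ h
    simp only [L2, Ln.mk.injEq] at e hx
    obtain ⟨e1, e2, e3⟩ := e
    have e1 := inj e1
    have e2 := inj (add_right_cancel ((div_left_inj' h0).1 e2))
    subst e1 e2
    have e3 := inj (mul_left_cancel₀ ((map_ne_zero (algebraMap F K)).2 hx) e3)
    subst e3; rfl
  have c1 := Finset.card_image_of_injOn inj1
  have c2 := Finset.card_image_of_injOn inj2
  have hedge : ∑ u ∈ Q.image (L1 (F := F) θ η), ((Q.image (L2 (F := F) θ η)).filter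
      (fun v => meet u v)).card = ∑ q ∈ Q, (Q.filter (fun q' =>
      q.1 * (q'.2.1 - q.2.2) = q'.1 * (q.2.1 - q'.2.2))).card := by
    rw [Finset.sum_image inj1]
    refine Finset.sum_congr rfl ?_
    intro q hq
    rw [Finset.filter_image, Finset.card_image_of_injOn]
    · congr 1
      ext q'
      simp only [Finset.mem_filter, meet_L h0]
    · exact inj2.mono (by intro x hx; exact (Finset.mem_filter.1 hx).1)
  obtain ⟨U, hU, V, hV, hne, dU, dV⟩ := prune (fun u v : Ln K => meet u v) D _
    (Q.image (L1 (F := F) θ η)) (Q.image (L2 (F := F) θ η)) rfl (by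
      rw [hedge, c1, c2, hQc]
      refine lt_of_eq_of_lt ?_ hlt
      ring)
  have hUc : U.card ≤ X.card * A.card ^ 2 := by
    rw [← hQc, ← c1]; exact Finset.card_le_card hU
  refine core (p := p) U V D A.card hne dU ?_ ?_ ?_ ?_ (by omega) (by omega) hDk ?_
  · intro v hv
    refine (dV v hv).trans (le_of_eq ?_)
    congr 1
    ext u
    simp only [Finset.mem_filter]
    exact ⟨fun h => ⟨h.1, h.2.symm⟩, fun h => ⟨h.1, h.2.symm⟩⟩
  · intro u hu u' hu' hne hm
    obtain ⟨⟨x1, a1, d1⟩, hq, rfl⟩ := Finset.mem_image.1 (hU hu)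
    obtain ⟨⟨x2, a2, d2⟩, hq', rfl⟩ := Finset.mem_image.1 (hU hu')
    have hx := hQx _ hq
    simp only [meet, L1] at hm hx
    by_cases hxx : x1 = x2
    · subst hxx
      have := theta_indep (F := F) hθ (a := x1 * (a1 - a2)) (b := x1 * (d2 - d1)) (by
        simp only [map_mul, map_sub]; linear_combination hm)
      simp only [mul_eq_zero, hx, false_or, sub_eq_zero] at this
      exact hne (by rw [this.1, this.2])
    · exact hη1 x1 a1 d1 x2 a2 d2 hxx (by
        simp only [map_mul, map_sub]; linear_combination hm)
  · intro u hu u' hu' hne hm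
    obtain ⟨⟨x1, a1, d1⟩, hq, rfl⟩ := Finset.mem_image.1 (hV hu)
    obtain ⟨⟨x2, a2, d2⟩, hq', rfl⟩ := Finset.mem_image.1 (hV hu')
    have hx := hQx _ hq
    simp only [meet, L2] at hm hx
    have t1 : (algebraMap F K a1 + η) / θ * θ = algebraMap F K a1 + η := div_mul_cancel₀ _ h0
    have t2 : (algebraMap F K a2 + η) / θ * θ = algebraMap F K a2 + η := div_mul_cancel₀ _ h0
    generalize (algebraMap F K a1 + η) / θ = w1 at hm t1
    generalize (algebraMap F K a2 + η) / θ = w2 at hm t2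
    by_cases hxx : x1 = x2
    · subst hxx
      have := theta_indep (F := F) hθ (a := x1 * (d2 - d1)) (b := x1 * (a1 - a2)) (by
        simp only [map_mul, map_sub]; linear_combination (-θ) * hm + algebraMap F K x1 * t1 - algebraMap F K x1 * t2)
      simp only [mul_eq_zero, hx, false_or, sub_eq_zero] at this
      exact hne (by rw [this.1, this.2])
    · exact hη2 x1 a1 d1 x2 a2 d2 hxx (by
        simp only [map_mul, map_sub]; linear_combination θ * hm - algebraMap F K x2 * t1 + algebraMap F K x1 * t2)
  · intro u hu v hv he
    obtain ⟨⟨x1, a1, d1⟩, hq, rfl⟩ := Finset.mem_image.1 (hU hu)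
    obtain ⟨⟨x2, a2, d2⟩, hq', rfl⟩ := Finset.mem_image.1 (hV hv)
    have := theta_indep (F := F) hθ (a := x1) (b := x2) he
    exact hQx _ hq this.1
  · intro u hu γ β
    obtain ⟨⟨x, c, d⟩, hq, rfl⟩ := Finset.mem_image.1 (hU hu)
    let P : F × F × F → Prop := fun q' => x * (q'.2.1 - d) = q'.1 * (c - q'.2.2) ∧
      γ * ((L2 θ η q').c - algebraMap F K c) + β * ((L2 θ η q').s - θ * algebraMap F K x) = 1
    have hle : (V.filter (fun v => meet (L1 θ η (x, c, d)) v ∧ γ * (v.c - (L1 θ η (x, c, d)).c) +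
        β * (v.s - (L1 θ η (x, c, d)).s) = 1)).card ≤ (Q.filter P).card := by
      refine le_trans (Finset.card_le_card ?_) (Finset.card_image_le (f := L2 (F := F) θ η))
      intro v hv
      obtain ⟨hv1, hv2, hv3⟩ := Finset.mem_filter.1 hv
      obtain ⟨q', hq', rfl⟩ := Finset.mem_image.1 (hV hv1)
      exact Finset.mem_image_of_mem _ (Finset.mem_filter.2 ⟨hq', (meet_L h0 _ _).1 hv2, hv3⟩)
    refine hle.trans ?_
    by_cases hγ : γ = 0
    · refine Finset.card_le_card_of_injOn (fun q => q.2.1) ?_ ?_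
      · intro q hq
        have := (Finset.mem_filter.1 hq).1
        rw [hQ, Finset.mem_product, Finset.mem_product] at this
        exact this.2.1
      · rintro ⟨x1, a1, d1⟩ h1 ⟨x2, a2, d2⟩ h2 e
        obtain ⟨h1, h1', h1''⟩ := Finset.mem_filter.1 h1
        obtain ⟨h2, h2', h2''⟩ := Finset.mem_filter.1 h2
        have hx := hQx _ h1
        simp only [L2, hγ, zero_mul, zero_add] at e h1' h1'' h2' h2'' hx
        subst e
        have hβ : β ≠ 0 := by rintro rfl; simp at h1''
        have e1 : x1 = x2 := by
          apply inj
          apply mul_left_cancel₀ hβ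
          linear_combination h1'' - h2''
        subst e1
        have e2 : c - d1 = c - d2 := mul_left_cancel₀ hx (h1'.symm.trans h2')
        have e3 : d1 = d2 := by linear_combination -e2
        subst e3; rfl
    · refine le_trans (Finset.card_le_card_of_injOn (t := X) (fun q => q.1) ?_ ?_) hXA
      · intro q hq
        have := (Finset.mem_filter.1 hq).1
        rw [hQ, Finset.mem_product, Finset.mem_product] at this
        exact this.1
      · rintro ⟨x1, a1, d1⟩ h1 ⟨x2, a2, d2⟩ h2 e
        obtain ⟨h1, h1', h1''⟩ := Finset.mem_filter.1 h1
        obtain ⟨h2, h2', h2''⟩ := Finset.mem_filter.1 h2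
        have hx := hQx _ h1
        simp only [L2] at e h1' h1'' h2' h2'' hx
        subst e
        have e1 : a1 = a2 := by
          have : γ * ((algebraMap F K a1 + η) / θ) = γ * ((algebraMap F K a2 + η) / θ) := by
            linear_combination h1'' - h2''
          exact inj (add_right_cancel ((div_left_inj' h0).1 (mul_left_cancel₀ hγ this)))
        subst e1
        have e2 : c - d1 = c - d2 := mul_left_cancel₀ hx (h1'.symm.trans h2')
        have e3 : d1 = d2 := by linear_combination -e2
        subst e3; rfl

theorem main_nat {p : ℕ} [Fact p.Prime] (A : Finset (ZMod p)) (hA : A.card ^ 3 ≤ p ^ 2) :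
    A.card ^ 3 ≤ 40000 * (((A ×ˢ A) ×ˢ (A ×ˢ A)).image
          (fun q => (q.1.1 - q.1.2) * (q.2.1 - q.2.2))).card ^ 2 := by
  set S := (((A ×ˢ A) ×ˢ (A ×ˢ A)).image
          (fun q => (q.1.1 - q.1.2) * (q.2.1 - q.2.2))) with hS
  rcases A.eq_empty_or_nonempty with rfl | ⟨a0, ha0⟩
  · simp
  have hSpos : 0 < S.card := by
    rw [Finset.card_pos]
    exact ⟨_, Finset.mem_image_of_mem _ (by simp [ha0] : ((a0, a0), (a0, a0)) ∈ (A ×ˢ A) ×ˢ (A ×ˢ A))⟩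
  have hNpos : 0 < A.card := Finset.card_pos.2 ⟨a0, ha0⟩
  let X : Finset (ZMod p) := (A.erase a0).image (fun a => a - a0)
  have hXc : X.card + 1 = A.card := by
    rw [Finset.card_image_of_injective _ (sub_left_injective), Finset.card_erase_add_one ha0]
  have hX0 : (0 : ZMod p) ∉ X := by
    intro h
    obtain ⟨a, ha, h⟩ := Finset.mem_image.1 h
    exact (Finset.mem_erase.1 ha).1 (sub_eq_zero.1 h)
  obtain ⟨M, hM⟩ : ∃ M, M = X.card := ⟨_, rfl⟩
  rw [← hM] at hXc
  rcases Nat.eq_zero_or_pos M with h0 | hMpos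
  · have : A.card = 1 := by omega
    rw [this]; nlinarith
  obtain ⟨n, hn⟩ : ∃ n, n = X.card * A.card ^ 2 := ⟨_, rfl⟩
  have hn' : n = M * (M + 1) ^ 2 := by rw [hn, ← hM, hXc]
  have hcs := cs (X ×ˢ A ×ˢ A) (fun q => q.1 * (q.2.1 - q.2.2))
  have himg : ((X ×ˢ A ×ˢ A).image (fun q => q.1 * (q.2.1 - q.2.2))).card ≤ S.card := by
    refine Finset.card_le_card ?_
    intro y hy
    obtain ⟨⟨x, c, d⟩, hq, rfl⟩ := Finset.mem_image.1 hy
    simp only [Finset.mem_product] at hq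
    obtain ⟨a, ha, rfl⟩ := Finset.mem_image.1 hq.1
    exact Finset.mem_image.2 ⟨((a, a0), (c, d)), by
      simp [Finset.mem_of_mem_erase ha, ha0, hq.2.1, hq.2.2], rfl⟩
  rw [Finset.card_product, Finset.card_product, ← sq A.card, ← hn] at hcs
  obtain ⟨D, hDdef⟩ : ∃ D, D = Nat.sqrt (2000 * n) + 1 := ⟨_, rfl⟩
  have hD1 : 2000 * n < D ^ 2 := by rw [hDdef]; exact Nat.lt_succ_sqrt' _
  have hnbig : 4 ≤ n := by rw [hn']; nlinarith
  have hD2 : D ^ 2 ≤ 4002 * n := by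
    have h1 := Nat.sqrt_le' (2000 * n)
    have : D - 1 = Nat.sqrt (2000 * n) := by omega
    rw [hDdef]
    nlinarith [sq_nonneg ((Nat.sqrt (2000 * n) : ℤ) - 1), Nat.sqrt_le_self (2000 * n), 
      two_mul_le_add_sq (Nat.sqrt (2000 * n)) 1]
  have hDk : 4 * A.card < D := by
    rw [← hXc]
    by_contra hlt
    push Not at hlt
    have h1 := Nat.pow_le_pow_left hlt 2
    rw [hn'] at hD1
    nlinarith
  have hmain := main_count X A hX0 (by omega) D (by rw [← hn]; exact hD1.le) (by
    rw [← hn, hn']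
    rw [← hXc] at hA
    nlinarith) hDk
  rw [← hn] at hmain
  rw [edges X A] at hmain
  have h3 : n ^ 2 ≤ S.card * (D * (2 * n)) :=
    hcs.trans (Nat.mul_le_mul himg hmain)
  have h4 : n ≤ 2 * S.card * D := by
    apply Nat.le_of_mul_le_mul_left _ (show 0 < n by omega)
    nlinarith
  have h5 : n ≤ 16008 * S.card ^ 2 := by
    apply Nat.le_of_mul_le_mul_left _ (show 0 < n by omega)
    calc n * n ≤ (2 * S.card * D) * (2 * S.card * D) := Nat.mul_le_mul h4 h4
      _ = 4 * S.card ^ 2 * D ^ 2 := by ring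
      _ ≤ 4 * S.card ^ 2 * (4002 * n) := Nat.mul_le_mul_left _ hD2
      _ = _ := by ring
  have h6 : A.card ^ 3 ≤ 2 * n := by
    rw [hn', ← hXc]
    nlinarith [sq_nonneg (M + 1)]
  omega
end
end Ln

theorem stmt_18 :
    ∃ c : ℝ, 0 < c ∧ ∀ (p : ℕ), p.Prime → 2 < p →
      ∀ A : Finset (ZMod p), (A.card : ℝ) ≤ (p : ℝ) ^ ((2 : ℝ) / 3) →
      c * (A.card : ℝ) ^ ((3 : ℝ) / 2) ≤
        ((((A ×ˢ A) ×ˢ (A ×ˢ A)).image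
          (fun q => (q.1.1 - q.1.2) * (q.2.1 - q.2.2))).card : ℝ) := by
  refine ⟨1 / 200, by norm_num, ?_⟩
  intro p hp _ A hA
  have := Fact.mk hp
  have h3 : A.card ^ 3 ≤ p ^ 2 := by
    have h1 : (A.card : ℝ) ^ 3 ≤ ((p : ℝ) ^ ((2 : ℝ) / 3)) ^ 3 :=
      pow_le_pow_left₀ (Nat.cast_nonneg _) hA 3
    have h2 : ((p : ℝ) ^ ((2 : ℝ) / 3)) ^ 3 = (p : ℝ) ^ 2 := by
      rw [← Real.rpow_natCast, ← Real.rpow_mul (Nat.cast_nonneg _), ← Real.rpow_natCast]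
      norm_num
    rw [h2] at h1
    exact_mod_cast h1
  have hm := Ln.main_nat A h3
  generalize (((A ×ˢ A) ×ˢ (A ×ˢ A)).image
          (fun q => (q.1.1 - q.1.2) * (q.2.1 - q.2.2))).card = S at hm ⊢
  have hm' : (A.card : ℝ) ^ 3 ≤ 40000 * (S : ℝ) ^ 2 := by exact_mod_cast hm
  have h2 : ((A.card : ℝ) ^ ((3 : ℝ) / 2)) ^ 2 = (A.card : ℝ) ^ 3 := by
    rw [← Real.rpow_natCast, ← Real.rpow_mul (Nat.cast_nonneg _), ← Real.rpow_natCast]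
    norm_num
  have h4 : (A.card : ℝ) ^ ((3 : ℝ) / 2) ≤ 200 * (S : ℝ) := by
    refine (pow_le_pow_iff_left₀ (by positivity) (by positivity) two_ne_zero).1 ?_
    rw [h2]
    nlinarith [hm']
  linarith
end

section
/- There exists a constant c > 0 such that for every prime p > 2 and every finite set A ⊆ F_p with |A| ≤ p^(2/3), the set (A-A)^2 + (A-A)^2 = {(a-b)^2 + (c-d)^2 : a,b,c,d ∈ A} has cardinality at least c·|A|^(3/2). -/
open Finset

namespace S19

open MvPolynomial

/-- Polynomials in three variables `v = X 0`, `x = X 1`, `w = X 2`. -/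
abbrev Pol (K : Type*) [Field K] := MvPolynomial (Fin 3) K

variable {K : Type*} [Field K]

/-- restriction to the line `x = p.1`, `v = p.2.1 * w + p.2.2`, parametrised by `w`. -/
noncomputable def res1 (p : K × K × K) : Pol K →ₐ[K] Polynomial K :=
  aeval ![Polynomial.C p.2.1 * Polynomial.X + Polynomial.C p.2.2, Polynomial.C p.1, Polynomial.X]

/-- restriction to the line `w = q.1`, `v = q.2.1 * x + q.2.2`, parametrised by `x`. -/
noncomputable def res2 (q : K × K × K) : Pol K →ₐ[K] Polynomial K :=
  aeval ![Polynomial.C q.2.1 * Polynomial.X + Polynomial.C q.2.2, Polynomial.X, Polynomial.C q.1]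

/-- Incidence. -/
def inc (p q : K × K × K) : Prop := p.2.1 * q.1 + p.2.2 = q.2.1 * p.1 + q.2.2

lemma natDegree_aeval_le {B : Type*} [CommRing B] [Algebra K B] (b : Fin 3 → Polynomial B)
    (hb : ∀ i, (b i).natDegree ≤ 1) (g : Pol K) :
    (aeval b g).natDegree ≤ g.totalDegree := by
  rw [aeval_def, eval₂_eq]
  apply Polynomial.natDegree_sum_le_of_forall_le
  intro d hd
  refine (Polynomial.natDegree_mul_le).trans ?_
  have h1 : (algebraMap K (Polynomial B) (coeff d g)).natDegree = 0 := by
    rw [Polynomial.algebraMap_apply, Polynomial.natDegree_C]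
  rw [h1, zero_add]
  refine (Polynomial.natDegree_prod_le _ _).trans ?_
  refine le_trans ?_ (le_totalDegree hd)
  rw [Finsupp.sum]
  refine Finset.sum_le_sum fun i _ => ?_
  refine Polynomial.natDegree_pow_le.trans ?_
  simpa using Nat.mul_le_mul_left (d i) (hb i)

lemma natDegree_res1 (p : K × K × K) (g : Pol K) : (res1 p g).natDegree ≤ g.totalDegree := by
  apply natDegree_aeval_le
  intro i
  fin_cases i
  · exact Polynomial.natDegree_linear_le
  · simp
  · simp

lemma natDegree_res2 (p : K × K × K) (g : Pol K) : (res2 p g).natDegree ≤ g.totalDegree := by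
  apply natDegree_aeval_le
  intro i
  fin_cases i
  · exact Polynomial.natDegree_linear_le
  · simp
  · simp

lemma eval_aeval_poly (b : Fin 3 → Polynomial K) (t : K) (g : Pol K) :
    (aeval b g).eval t = eval (fun i => (b i).eval t) g := by
  induction g using MvPolynomial.induction_on with
  | C a => simp
  | add p q hp hq => simp [hp, hq]
  | mul_X p i hp => simp [hp]

lemma eval_res1 (p : K × K × K) (t : K) (g : Pol K) :
    (res1 p g).eval t = eval ![p.2.1 * t + p.2.2, p.1, t] g := by
  rw [res1, eval_aeval_poly]
  congr 2
  funext i; fin_cases i <;> simp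

lemma eval_res2 (p : K × K × K) (t : K) (g : Pol K) :
    (res2 p g).eval t = eval ![p.2.1 * t + p.2.2, t, p.1] g := by
  rw [res2, eval_aeval_poly]
  congr 2
  funext i; fin_cases i <;> simp

lemma eval_inc {p q : K × K × K} (h : inc p q) (g : Pol K) :
    (res1 p g).eval q.1 = (res2 q g).eval p.1 := by
  rw [eval_res1, eval_res2, show p.2.1 * q.1 + p.2.2 = q.2.1 * p.1 + q.2.2 from h]

/-- A finset with injective first coordinate whose first coordinates are all roots. -/
lemma card_le_of_roots {α : Type*} (S : Finset α) (f : α → K) (hf : Set.InjOn f S)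
    (P : Polynomial K) (hP : P ≠ 0) (h : ∀ a ∈ S, P.eval (f a) = 0) : S.card ≤ P.natDegree := by
  classical
  rw [← Finset.card_image_of_injOn hf]
  apply Polynomial.card_le_degree_of_subset_roots
  intro z hz
  obtain ⟨a, ha, rfl⟩ := Finset.mem_image.1 (Finset.mem_def.2 hz)
  rw [Polynomial.mem_roots hP]
  exact h a ha

lemma mvext [Infinite K] {f g : Pol K} (h : ∀ a b c : K, eval ![a, b, c] f = eval ![a, b, c] g) :
    f = g := by
  apply MvPolynomial.funext
  intro x
  have : x = ![x 0, x 1, x 2] := by funext i; fin_cases i <;> rfl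
  rw [this]; exact h _ _ _

/-- vanishing on many planes `x = const` -/
lemma eq_zero_of_planes_x [Infinite K] {α : Type*} (S : Finset α) (f : α → K) (hf : Set.InjOn f S)
    (g : Pol K) (h : ∀ s ∈ S, ∀ a c : K, eval ![a, f s, c] g = 0) (hS : g.totalDegree < S.card) :
    g = 0 := by
  apply mvext
  intro a b c
  have key : aeval ![Polynomial.C a, Polynomial.X, Polynomial.C c] g = (0 : Polynomial K) := by
    by_contra hne
    have h1 := card_le_of_roots S f hf _ hne (by
      intro s hs
      rw [eval_aeval_poly, ← h s hs a c]
      congr 2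
      funext i; fin_cases i <;> simp)
    have h2 := natDegree_aeval_le (K := K) ![Polynomial.C a, Polynomial.X, Polynomial.C c] (by
      intro i; fin_cases i <;> simp) g
    omega
  have := congrArg (Polynomial.eval b) key
  rw [eval_aeval_poly] at this
  rw [map_zero, ← Polynomial.eval_zero (x := b), ← this]
  congr 2
  funext i; fin_cases i <;> simp

/-- vanishing on many planes `w = const` -/
lemma eq_zero_of_planes_w [Infinite K] {α : Type*} (S : Finset α) (f : α → K) (hf : Set.InjOn f S)
    (g : Pol K) (h : ∀ s ∈ S, ∀ a c : K, eval ![a, c, f s] g = 0) (hS : g.totalDegree < S.card) :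
    g = 0 := by
  apply mvext
  intro a b c
  have key : aeval ![Polynomial.C a, Polynomial.C b, Polynomial.X] g = (0 : Polynomial K) := by
    by_contra hne
    have h1 := card_le_of_roots S f hf _ hne (by
      intro s hs
      rw [eval_aeval_poly, ← h s hs a b]
      congr 2
      funext i; fin_cases i <;> simp)
    have h2 := natDegree_aeval_le (K := K) ![Polynomial.C a, Polynomial.C b, Polynomial.X] (by
      intro i; fin_cases i <;> simp) g
    omega
  have := congrArg (Polynomial.eval c) key
  rw [eval_aeval_poly] at this
  rw [map_zero, ← Polynomial.eval_zero (x := c), ← this]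
  congr 2
  funext i; fin_cases i <;> simp

lemma totalDegree_det_le {n : ℕ} (M : Matrix (Fin n) (Fin n) (MvPolynomial (Fin 2) K)) (d : ℕ)
    (h : ∀ i j, (M i j).totalDegree ≤ d) : M.det.totalDegree ≤ n * d := by
  rw [Matrix.det_apply]
  refine MvPolynomial.totalDegree_finsetSum_le fun σ _ => ?_
  refine (MvPolynomial.totalDegree_smul_le _ _).trans ?_
  refine (MvPolynomial.totalDegree_finsetProd _ _).trans ?_
  refine (Finset.sum_le_sum (g := fun _ => d) fun i _ => h _ _).trans ?_
  simp

lemma totalDegree_coeff_fse (g : Pol K) (i : ℕ) :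
    ((finSuccEquiv K 2 g).coeff i).totalDegree ≤ g.totalDegree := by
  by_cases h : (finSuccEquiv K 2 g).coeff i = 0
  · rw [h]; simp
  · have := totalDegree_coeff_finSuccEquiv_add_le g i h
    omega

lemma totalDegree_resultant_le (g h : Pol K) (m n d : ℕ) (hg : g.totalDegree ≤ d)
    (hh : h.totalDegree ≤ d) :
    ((finSuccEquiv K 2 g).resultant (finSuccEquiv K 2 h) m n).totalDegree ≤ (m + n) * d := by
  apply totalDegree_det_le
  intro i j
  rw [Polynomial.sylvester, Matrix.of_apply]
  induction j using Fin.addCases with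
  | left j =>
    rw [Fin.addCases_left]
    split_ifs
    · exact (totalDegree_coeff_fse _ _).trans hh
    · simp
  | right j =>
    rw [Fin.addCases_right]
    split_ifs
    · exact (totalDegree_coeff_fse _ _).trans hg
    · simp

lemma eval_fse (g : Pol K) (a b c : K) :
    eval ![a, b, c] g = Polynomial.eval a (Polynomial.map (eval ![b, c]) (finSuccEquiv K 2 g)) := by
  rw [← eval_eq_eval_mv_eval']
  rfl

lemma natDegree_fse_le (g : Pol K) : (finSuccEquiv K 2 g).natDegree ≤ g.totalDegree := by
  rw [natDegree_finSuccEquiv]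
  exact degreeOf_le_totalDegree _ _

/-- Two-variable polynomial vanishing on lines -/
lemma card_le_of_two [Infinite K] (S : Finset (K × K × K)) (hS : Set.InjOn Prod.fst (S : Set (K × K × K)))
    (r : MvPolynomial (Fin 2) K) (hr : r ≠ 0) (h : ∀ s ∈ S, ∀ t : K, eval ![s.1, t] r = 0) :
    S.card ≤ r.totalDegree := by
  by_contra hlt
  push Not at hlt
  apply hr
  have h0 : rename Fin.succ r = (0 : Pol K) := by
    refine eq_zero_of_planes_x S Prod.fst hS _ ?_ ((totalDegree_rename_le _ _).trans_lt hlt)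
    intro s hs a c
    rw [eval_rename, ← h s hs c]
    congr 2
  exact rename_injective _ (Fin.succ_injective 2) (h0.trans (map_zero _).symm)

lemma bezout [Infinite K] (g h : Pol K) (hg : Irreducible g) (hgh : ¬ g ∣ h) (d : ℕ)
    (hgd : g.totalDegree ≤ d) (hhd : h.totalDegree ≤ d)
    (S : Finset (K × K × K)) (hS : Set.InjOn Prod.fst (S : Set (K × K × K)))
    (h1 : ∀ s ∈ S, res1 s g = 0) (h2 : ∀ s ∈ S, res1 s h = 0) :
    S.card ≤ (g.totalDegree + h.totalDegree + 1) * d := by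
  classical
  set G := finSuccEquiv K 2 g with hG
  set H := finSuccEquiv K 2 h with hH
  have e1 : ∀ s ∈ S, ∀ t : K, Polynomial.eval (s.2.1 * t + s.2.2)
      (Polynomial.map (eval ![s.1, t]) G) = 0 := by
    intro s hs t
    rw [← eval_fse, ← eval_res1, h1 s hs, Polynomial.eval_zero]
  have e2 : ∀ s ∈ S, ∀ t : K, Polynomial.eval (s.2.1 * t + s.2.2)
      (Polynomial.map (eval ![s.1, t]) H) = 0 := by
    intro s hs t
    rw [← eval_fse, ← eval_res1, h2 s hs, Polynomial.eval_zero]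
  have hGirr : Irreducible G := (MulEquiv.irreducible_iff (finSuccEquiv K 2)).2 hg
  by_cases hdeg : G.natDegree = 0
  · obtain ⟨r, hr⟩ := Polynomial.natDegree_eq_zero.1 hdeg
    have hr0 : r ≠ 0 := by
      rintro rfl
      apply hGirr.ne_zero
      rw [← hr, Polynomial.C_0]
    have hc := card_le_of_two S hS r hr0 (by
      intro s hs t
      have := e1 s hs t
      rw [← hr] at this
      simpa using this)
    have : r.totalDegree ≤ g.totalDegree := by
      have := totalDegree_coeff_fse g 0
      rwa [← hG, ← hr, Polynomial.coeff_C_zero] at this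
    nlinarith
  · have hprim : G.IsPrimitive := hGirr.isPrimitive hdeg
    let F := FractionRing (MvPolynomial (Fin 2) K)
    let _ : NormalizedGCDMonoid (MvPolynomial (Fin 2) K) :=
      Classical.choice (inferInstance : Nonempty (NormalizedGCDMonoid (MvPolynomial (Fin 2) K)))
    have hirrF := (hprim.irreducible_iff_irreducible_map_fraction_map (K := F)).1 hGirr
    have hnd : ¬ (G.map (algebraMap _ F)) ∣ (H.map (algebraMap _ F)) := by
      intro hd
      have := hprim.dvd_of_fraction_map_dvd_fraction_map hd
      apply hgh
      obtain ⟨q, hq⟩ := this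
      refine ⟨(finSuccEquiv K 2).symm q, ?_⟩
      apply (finSuccEquiv K 2).injective
      rw [map_mul, AlgEquiv.apply_symm_apply, ← hG, ← hH, hq]
    have hcop : IsCoprime (G.map (algebraMap _ F)) (H.map (algebraMap _ F)) :=
      (hirrF.coprime_iff_not_dvd).2 hnd
    have hinj : Function.Injective (algebraMap (MvPolynomial (Fin 2) K) F) :=
      IsFractionRing.injective _ _
    have hres : G.resultant H ≠ 0 := by
      intro h0
      have := Polynomial.resultant_ne_zero _ _ hcop
      apply this
      rw [Polynomial.resultant_map_map, Polynomial.natDegree_map_eq_of_injective hinj,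
        Polynomial.natDegree_map_eq_of_injective hinj, h0, map_zero]
    obtain ⟨a, b, -, -, hab⟩ := Polynomial.exists_mul_add_mul_eq_C_resultant G H le_rfl le_rfl
      (Or.inl hdeg)
    have hc := card_le_of_two S hS _ hres (by
      intro s hs t
      have := congrArg (fun P => Polynomial.eval (s.2.1 * t + s.2.2)
        (Polynomial.map (eval ![s.1, t]) P)) hab
      simp only [Polynomial.map_add, Polynomial.map_mul, Polynomial.eval_add, Polynomial.eval_mul,
        e1 s hs t, e2 s hs t, zero_mul, add_zero, Polynomial.map_C, Polynomial.eval_C] at this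
      exact this.symm)
    have hd := totalDegree_resultant_le g h G.natDegree H.natDegree d hgd hhd
    have h3 := natDegree_fse_le g
    have h4 := natDegree_fse_le h
    refine hc.trans (hd.trans (Nat.mul_le_mul_right _ ?_))
    rw [← hG] at h3; rw [← hH] at h4
    omega

lemma chain_rule {B : Type*} [CommRing B] [Algebra K B] (D : Derivation K B B) (b : Fin 3 → B)
    (g : Pol K) : D (aeval b g) = ∑ i, aeval b (pderiv i g) * D (b i) := by
  induction g using MvPolynomial.induction_on with
  | C a => simp
  | add p q hp hq => simp [hp, hq, add_mul, Finset.sum_add_distrib]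
  | mul_X p i hp =>
    rw [map_mul, aeval_X, Derivation.leibniz, hp]
    simp only [Derivation.leibniz, pderiv_X, smul_eq_mul, map_add, map_mul, add_mul,
      Finset.sum_add_distrib, aeval_X, Finset.mul_sum]
    congr 1
    · rw [Finset.sum_eq_single i]
      · simp
      · intro j _ hj
        simp [hj.symm]
      · simp
    · refine Finset.sum_congr rfl fun j _ => ?_
      ring

lemma totalDegree_pderiv_le (i : Fin 3) (g : Pol K) :
    (pderiv i g).totalDegree ≤ g.totalDegree - 1 := by
  conv_lhs => rw [g.as_sum, map_sum]
  refine MvPolynomial.totalDegree_finsetSum_le fun s hs => ?_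
  rw [pderiv_monomial]
  by_cases h0 : coeff s g * (s i : K) = 0
  · rw [h0]; simp
  rw [totalDegree_monomial _ h0]
  have h1 : s i ≠ 0 := by rintro h; apply h0; simp [h]
  have h2 := le_totalDegree hs
  have h3 : (s - Finsupp.single i 1).degree + 1 = s.degree := by
    have : s - Finsupp.single i 1 + Finsupp.single i 1 = s := by
      ext j
      by_cases hj : i = j
      · subst hj; simp; omega
      · simp [hj]
    conv_rhs => rw [← this]
    simp
  have h4 : ((s - Finsupp.single i 1).sum fun _ e => e) + 1 = s.sum fun _ e => e := h3
  omega

/-- The (planar) flecnode type polynomial. -/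
noncomputable def G2 (g : Pol K) : Pol K :=
  pderiv 1 g ^ 2 * pderiv 0 (pderiv 0 g) - 2 * pderiv 1 g * pderiv 0 g * pderiv 0 (pderiv 1 g)
    + pderiv 0 g ^ 2 * pderiv 1 (pderiv 1 g)

lemma totalDegree_G2 (g : Pol K) : (G2 g).totalDegree ≤ 3 * g.totalDegree := by
  have h : ∀ i, (pderiv i g).totalDegree ≤ g.totalDegree := fun i =>
    (totalDegree_pderiv_le i g).trans (Nat.sub_le _ _)
  have hh : ∀ i j, (pderiv i (pderiv j g)).totalDegree ≤ g.totalDegree := fun i j =>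
    ((totalDegree_pderiv_le i _).trans (Nat.sub_le _ _)).trans (h j)
  rw [G2]
  have h2 : (2 : Pol K).totalDegree = 0 := by
    have : (2 : Pol K) = C 2 := (map_ofNat C 2).symm
    rw [this, totalDegree_C]
  have a0 := h 0
  have a1 := h 1
  have a2 := hh 0 0
  have a3 := hh 0 1
  have a4 := hh 1 1
  refine (totalDegree_add _ _).trans (max_le ((totalDegree_sub _ _).trans (max_le ?_ ?_)) ?_)
  · refine (totalDegree_mul _ _).trans ?_
    have := totalDegree_pow (pderiv 1 g) 2
    omega
  · refine (totalDegree_mul _ _).trans ?_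
    have e1 := totalDegree_mul (2 * pderiv 1 g) (pderiv 0 g)
    have e2 := totalDegree_mul 2 (pderiv 1 g)
    omega
  · refine (totalDegree_mul _ _).trans ?_
    have := totalDegree_pow (pderiv 0 g) 2
    omega

lemma pderiv_comm' (i j : Fin 3) (g : Pol K) : pderiv i (pderiv j g) = pderiv j (pderiv i g) := by
  have h : ⁅(pderiv i : Derivation K (Pol K) (Pol K)), (pderiv j : Derivation K (Pol K) (Pol K))⁆ = 0 := by
    apply MvPolynomial.derivation_ext
    intro k
    rw [Derivation.commutator_apply]
    simp [pderiv_X, Pi.single_apply, apply_ite]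
  have := congrArg (fun D : Derivation K (Pol K) (Pol K) => D g) h
  simp only [Derivation.commutator_apply, Derivation.zero_apply] at this
  exact sub_eq_zero.1 this

lemma deriv_res2 (q : K × K × K) (g : Pol K) :
    Polynomial.derivative (res2 q g) =
      Polynomial.C q.2.1 * res2 q (pderiv 0 g) + res2 q (pderiv 1 g) := by
  have := chain_rule (K := K) (Polynomial.derivative' (R := K))
    ![Polynomial.C q.2.1 * Polynomial.X + Polynomial.C q.2.2, Polynomial.X, Polynomial.C q.1] g
  rw [Fin.sum_univ_three] at this
  simp [Polynomial.derivative'] at this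
  rw [res2, this]
  ring

lemma res2_G2 (q : K × K × K) (g : Pol K) (h : res2 q g = 0) : res2 q (G2 g) = 0 := by
  have h1 := deriv_res2 q g
  rw [h, Polynomial.derivative_zero] at h1
  have h2 := congrArg Polynomial.derivative h1
  simp only [Polynomial.derivative_zero, map_add, Polynomial.derivative_mul,
    Polynomial.derivative_C, zero_mul, zero_add, deriv_res2] at h2
  rw [pderiv_comm' 1 0 g] at h2
  rw [G2]
  simp only [map_add, map_sub, map_mul, map_pow, map_ofNat]
  have e : res2 q (pderiv 1 g) = - (Polynomial.C q.2.1 * res2 q (pderiv 0 g)) := by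
    linear_combination -h1
  rw [e]
  linear_combination -(res2 q (pderiv 0 g)) ^ 2 * h2

/-- Coefficientwise extension of a derivation. -/
noncomputable def ext' (D : Derivation K (Pol K) (Pol K)) :
    Derivation K (Polynomial (Pol K)) (Polynomial (Pol K)) :=
  (PolynomialModule.equivPolynomialSelf (R := Pol K)).toLinearMap.compDer D.mapCoeffs

lemma ext'_coeff (D : Derivation K (Pol K) (Pol K)) (P : Polynomial (Pol K)) (i : ℕ) :
    (ext' D P).coeff i = D (P.coeff i) := rfl

lemma ext'_C (D : Derivation K (Pol K) (Pol K)) (a : Pol K) :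
    ext' D (Polynomial.C a) = Polynomial.C (D a) := by
  ext1 n
  rw [ext'_coeff, Polynomial.coeff_C, Polynomial.coeff_C]
  split_ifs <;> simp

lemma ext'_X (D : Derivation K (Pol K) (Pol K)) :
    ext' D Polynomial.X = 0 := by
  ext1 n
  rw [ext'_coeff, Polynomial.coeff_X]
  split_ifs <;> simp

/-- the polynomial derivative on `Pol K [τ]` as a `K`-derivation -/
noncomputable def dtau : Derivation K (Polynomial (Pol K)) (Polynomial (Pol K)) :=
  (Polynomial.derivative' (R := Pol K)).restrictScalars K

lemma dtau_apply (P : Polynomial (Pol K)) : dtau P = Polynomial.derivative P := rfl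

/-- substituting `v + τ s, x + τ u, w`. -/
noncomputable def shift (u s : Pol K) : Pol K →ₐ[K] Polynomial (Pol K) :=
  aeval ![Polynomial.C (X 0) + Polynomial.X * Polynomial.C s,
    Polynomial.C (X 1) + Polynomial.X * Polynomial.C u, Polynomial.C (X 2)]

lemma shift_identity (g : Pol K) :
    Polynomial.C (pderiv 0 g) * ext' (pderiv 0 g • pderiv 1 - pderiv 1 g • pderiv 0)
        (shift (pderiv 0 g) (- pderiv 1 g) g) =
      (Polynomial.C (pderiv 0 g) + Polynomial.X * Polynomial.C
        ((pderiv 0 g • pderiv 1 - pderiv 1 g • pderiv 0 : Derivation K (Pol K) (Pol K)) (pderiv 0 g)))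
        * Polynomial.derivative (shift (pderiv 0 g) (- pderiv 1 g) g)
      - Polynomial.X * shift (pderiv 0 g) (- pderiv 1 g) (pderiv 0 g) * Polynomial.C (G2 g) := by
  set u := pderiv 0 g with hu
  set s := - pderiv 1 g with hs
  set D : Derivation K (Pol K) (Pol K) := u • pderiv 1 - pderiv 1 g • pderiv 0 with hD
  have c1 := chain_rule (ext' D) ![Polynomial.C (X 0) + Polynomial.X * Polynomial.C s,
    Polynomial.C (X 1) + Polynomial.X * Polynomial.C u, Polynomial.C (X 2)] g
  have c2 := chain_rule (dtau (K := K)) ![Polynomial.C (X 0) + Polynomial.X * Polynomial.C s,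
    Polynomial.C (X 1) + Polynomial.X * Polynomial.C u, Polynomial.C (X 2)] g
  change ext' D (shift u s g) = _ at c1
  change dtau (shift u s g) = ∑ i, shift u s (pderiv i g) * _ at c2
  change _ = ∑ i, shift u s (pderiv i g) * _ at c1
  rw [Fin.sum_univ_three] at c1 c2
  have d0 : D (X 0) = s := by
    simp [hD, hs, pderiv_X]
  have d1 : D (X 1) = u := by
    simp [hD, pderiv_X]
  have d2 : D (X 2) = 0 := by
    simp [hD, pderiv_X]
  have ds : u * D s - s * D u = - G2 g := by
    simp only [hD, hs, hu, G2, Derivation.sub_apply, Derivation.smul_apply, smul_eq_mul, map_neg]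
    rw [pderiv_comm' 1 0 g]
    ring
  simp only [Matrix.cons_val_zero, Matrix.cons_val_one, Matrix.cons_val, map_add,
    Derivation.leibniz, ext'_C, ext'_X, smul_eq_mul, d0, d1, d2, mul_zero, add_zero] at c1
  simp only [Matrix.cons_val_zero, Matrix.cons_val_one, Matrix.cons_val, dtau_apply,
    Polynomial.derivative_add, Polynomial.derivative_mul, Polynomial.derivative_C,
    Polynomial.derivative_X, mul_zero, add_zero, zero_add, one_mul] at c2
  rw [c1, c2]
  have ds' := congrArg Polynomial.C ds
  simp only [Polynomial.C_sub, Polynomial.C_mul, Polynomial.C_neg] at ds'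
  rw [map_zero]
  linear_combination Polynomial.X * shift u s u * ds'

lemma natDegree_shift (u s g : Pol K) : (shift u s g).natDegree ≤ g.totalDegree := by
  apply natDegree_aeval_le
  have : ∀ a b : Pol K, (Polynomial.C a + Polynomial.X * Polynomial.C b).natDegree ≤ 1 := by
    intro a b
    rw [add_comm, Polynomial.X_mul_C]
    exact Polynomial.natDegree_linear_le
  intro i; fin_cases i
  · exact this _ _
  · exact this _ _
  · simp

lemma eval_shift (u s g : Pol K) (z : Fin 3 → K) (t : K) :
    Polynomial.eval t (Polynomial.map (eval z) (shift u s g)) =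
      eval ![z 0 + t * eval z s, z 1 + t * eval z u, z 2] g := by
  induction g using MvPolynomial.induction_on with
  | C a =>
    rw [shift, aeval_C]
    rw [Polynomial.algebraMap_apply]
    simp
  | add p q hp hq => simp [hp, hq]
  | mul_X p i hp =>
    rw [map_mul, Polynomial.map_mul, Polynomial.eval_mul, hp, map_mul]
    congr 1
    fin_cases i <;> simp [shift] <;> ring

lemma shift_coeff_zero (u s g : Pol K) : (shift u s g).coeff 0 = g := by
  rw [Polynomial.coeff_zero_eq_eval_zero]
  induction g using MvPolynomial.induction_on with
  | C a =>
    rw [shift, aeval_C]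
    rw [Polynomial.algebraMap_apply]
    simp
  | add p q hp hq => simp [hp, hq]
  | mul_X p i hp =>
    rw [map_mul, Polynomial.eval_mul, hp]
    congr 1
    fin_cases i <;> simp [shift]

lemma ruled (g : Pol K) (hg : Irreducible g) (hchar : ∀ n : ℕ, 0 < n → n ≤ g.totalDegree → (n : K) ≠ 0)
    (hv : ¬ g ∣ pderiv 0 g) (hG : g ∣ G2 g) (k : ℕ) :
    g ∣ (shift (pderiv 0 g) (- pderiv 1 g) g).coeff k := by
  induction k with
  | zero => rw [shift_coeff_zero]
  | succ k ih =>
    by_cases hk : k + 1 ≤ g.totalDegree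
    · have hid := congrArg (fun P => Polynomial.coeff P k) (shift_identity g)
      simp only [Polynomial.coeff_C_mul, ext'_coeff, Polynomial.coeff_sub,
        Polynomial.coeff_mul_C, add_mul, Polynomial.coeff_add] at hid
      set Φ := shift (pderiv 0 g) (- pderiv 1 g) g with hΦ
      set D : Derivation K (Pol K) (Pol K) := pderiv 0 g • pderiv 1 - pderiv 1 g • pderiv 0 with hD
      have hDg : D g = 0 := by
        simp [hD, mul_comm]
      have h1 : g ∣ D (Φ.coeff k) := by
        obtain ⟨c, hc⟩ := ih
        rw [hc, Derivation.leibniz, hDg, smul_zero, add_zero]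
        exact dvd_mul_right _ _
      have h2 : (Polynomial.X * Polynomial.C (D (pderiv 0 g)) * Polynomial.derivative Φ).coeff k
          = (k : Pol K) * D (pderiv 0 g) * Φ.coeff k := by
        rw [mul_assoc]
        cases k with
        | zero => simp
        | succ j =>
          rw [Polynomial.coeff_X_mul, Polynomial.coeff_C_mul, Polynomial.coeff_derivative]
          push_cast; ring
      rw [h2, Polynomial.coeff_derivative] at hid
      have h3 : g ∣ pderiv 0 g * (Φ.coeff (k + 1) * ((k : Pol K) + 1)) := by
        have : pderiv 0 g * (Φ.coeff (k + 1) * ((k : Pol K) + 1)) = pderiv 0 g * D (Φ.coeff k)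
          - (k : Pol K) * D (pderiv 0 g) * Φ.coeff k +
          (Polynomial.X * shift (pderiv 0 g) (- pderiv 1 g) (pderiv 0 g)).coeff k * G2 g := by
          linear_combination -hid
        rw [this]
        exact dvd_add (dvd_sub (h1.mul_left _) (ih.mul_left _)) (hG.mul_left _)
      rcases hg.prime.dvd_or_dvd h3 with h | h
      · exact absurd h hv
      · have hu : IsUnit ((k : Pol K) + 1) := by
          have : ((k : Pol K) + 1) = C ((k + 1 : ℕ) : K) := by simp
          rw [this]
          exact (isUnit_iff_ne_zero.2 (hchar _ (Nat.succ_pos k) hk)).map C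
        exact (hu.dvd_mul_right).1 h
    · rw [Polynomial.coeff_eq_zero_of_natDegree_lt]
      · exact dvd_zero _
      · exact (natDegree_shift _ _ _).trans_lt (by omega)

lemma ruled_eval (g : Pol K) (hg : Irreducible g)
    (hchar : ∀ n : ℕ, 0 < n → n ≤ g.totalDegree → (n : K) ≠ 0)
    (hv : ¬ g ∣ pderiv 0 g) (hG : g ∣ G2 g) (z : Fin 3 → K) (hz : eval z g = 0) (t : K) :
    eval ![z 0 + t * eval z (- pderiv 1 g), z 1 + t * eval z (pderiv 0 g), z 2] g = 0 := by
  rw [← eval_shift]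
  have : Polynomial.map (eval z) (shift (pderiv 0 g) (- pderiv 1 g) g) = 0 := by
    ext1 k
    rw [Polynomial.coeff_map, Polynomial.coeff_zero]
    obtain ⟨c, hc⟩ := ruled g hg hchar hv hG k
    rw [hc, map_mul, hz, zero_mul]
  rw [this, Polynomial.eval_zero]

lemma pseudo_div (U h e r : Pol K) (hh : h + e = U * X 0)
    (he : ∀ a a' b c, eval ![a, b, c] e = eval ![a', b, c] e)
    (hU : ∀ a a' b c, eval ![a, b, c] U = eval ![a', b, c] U) :
    ∃ (n : ℕ) (q r0 : Pol K), U ^ n * r = h * q + r0 ∧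
      ∀ a a' b c, eval ![a, b, c] r0 = eval ![a', b, c] r0 := by
  induction r using MvPolynomial.induction_on with
  | C z => exact ⟨0, 0, C z, by simp, by simp⟩
  | add p q hp hq =>
    obtain ⟨n1, q1, r1, e1, f1⟩ := hp
    obtain ⟨n2, q2, r2, e2, f2⟩ := hq
    refine ⟨n1 + n2, U ^ n2 * q1 + U ^ n1 * q2, U ^ n2 * r1 + U ^ n1 * r2, ?_, ?_⟩
    · rw [pow_add]
      linear_combination U ^ n2 * e1 + U ^ n1 * e2
    · intro a a' b c
      simp only [map_add, map_mul, map_pow]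
      rw [f1 a a' b c, f2 a a' b c, hU a a' b c]
  | mul_X p i hp =>
    obtain ⟨n, q, r0, e1, f1⟩ := hp
    by_cases hi : i = 0
    · subst hi
      refine ⟨n + 1, U ^ n * p + e * q, e * r0, ?_, ?_⟩
      · rw [pow_succ]
        linear_combination e * e1 - U ^ n * p * hh
      · intro a a' b c
        simp only [map_mul]
        rw [f1 a a' b c, he a a' b c]
    · refine ⟨n, q * X i, r0 * X i, ?_, ?_⟩
      · linear_combination X i * e1
      · intro a a' b c
        simp only [map_mul, eval_X]
        rw [f1 a a' b c]
        congr 1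
        fin_cases i
        · exact absurd rfl hi
        · rfl
        · rfl

/-- substituting `w` into a univariate polynomial -/
noncomputable def inW (P : Polynomial K) : Pol K := Polynomial.aeval (X 2) P

lemma eval_inW (P : Polynomial K) (a b c : K) : eval ![a, b, c] (inW P) = P.eval c := by
  rw [inW, Polynomial.aeval_def, Polynomial.eval₂_eq_sum_range, map_sum, Polynomial.eval_eq_sum_range]
  simp [MvPolynomial.algebraMap_eq]

/-- The bilinear-type surface equation. -/
lemma dvd_surface [Infinite K] (g : Pol K) (hg : Irreducible g)
    (hchar : ∀ n : ℕ, 0 < n → n ≤ g.totalDegree → (n : K) ≠ 0)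
    (hv : ¬ g ∣ pderiv 0 g) (hG : g ∣ G2 g) (p : K × K × K) (hp : res1 p g = 0)
    (hpv : res1 p (pderiv 0 g) ≠ 0) :
    g ∣ inW (res1 p (pderiv 0 g)) * (X 0 - C p.2.1 * X 2 - C p.2.2)
      + inW (res1 p (pderiv 1 g)) * (X 1 - C p.1) := by
  set u := res1 p (pderiv 0 g) with hu
  set s := res1 p (pderiv 1 g) with hs
  set h := inW u * (X 0 - C p.2.1 * X 2 - C p.2.2) + inW s * (X 1 - C p.1) with hh
  obtain ⟨n, q, r0, e1, f1⟩ := pseudo_div (inW u) h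
    (inW u * (C p.2.1 * X 2 + C p.2.2) - inW s * (X 1 - C p.1)) g (by rw [hh]; ring)
    (by intro a a' b c; simp [eval_inW]) (by intro a a' b c; simp [eval_inW])
  have hr0 : r0 = 0 := by
    have : inW u * r0 = 0 := by
      apply mvext
      intro a b c
      rw [map_mul, eval_inW, map_zero]
      by_cases hc : u.eval c = 0
      · rw [hc, zero_mul]
      · have hz : eval ![p.2.1 * c + p.2.2, p.1, c] g = 0 := by
          rw [← eval_res1, hp, Polynomial.eval_zero]
        have hr := ruled_eval g hg hchar hv hG _ hz ((b - p.1) / u.eval c)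
        simp only [map_neg, ← eval_res1, Matrix.cons_val_zero, Matrix.cons_val_one,
          Matrix.cons_val, ← hu, ← hs] at hr
        rw [div_mul_cancel₀ _ hc, add_sub_cancel] at hr
        have e2 := congrArg (eval ![p.2.1 * c + p.2.2 + (b - p.1) / u.eval c * -s.eval c, b, c]) e1
        rw [map_mul, map_add, hr, mul_zero, map_mul] at e2
        have e3 : eval ![p.2.1 * c + p.2.2 + (b - p.1) / u.eval c * -s.eval c, b, c] h = 0 := by
          simp only [hh, map_add, map_mul, map_sub, eval_inW, eval_X, eval_C,
            Matrix.cons_val_zero, Matrix.cons_val_one, Matrix.cons_val]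
          field_simp
          ring
        rw [e3, zero_mul, zero_add] at e2
        rw [f1 a _ b c, ← e2, mul_zero]
    rcases mul_eq_zero.1 this with h0 | h0
    · exfalso
      apply hpv
      apply Polynomial.funext
      intro c
      rw [← eval_inW u 0 0 c, h0]; simp
    · exact h0
  rw [hr0, add_zero] at e1
  have hd : g ∣ h * q := ⟨inW u ^ n, by rw [← e1]; ring⟩
  rcases hg.prime.dvd_or_dvd hd with h1 | ⟨q', h1⟩
  · exact h1
  · exfalso
    have e2 : inW u ^ n = h * q' := by
      apply mul_right_cancel₀ hg.ne_zero
      rw [e1, h1]; ring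
    apply pow_ne_zero n hpv
    apply Polynomial.funext
    intro c
    have e3 := congrArg (eval ![p.2.1 * c + p.2.2, p.1, c]) e2
    rw [map_pow, eval_inW, map_mul] at e3
    rw [Polynomial.eval_pow, e3, Polynomial.eval_zero]
    convert zero_mul _
    simp [hh, eval_inW]

lemma inc_of_surface [Infinite K] (g : Pol K) (hg : Irreducible g)
    (hchar : ∀ n : ℕ, 0 < n → n ≤ g.totalDegree → (n : K) ≠ 0)
    (hv : ¬ g ∣ pderiv 0 g) (hG : g ∣ G2 g) (p : K × K × K) (hp : res1 p g = 0)
    (hpv : res1 p (pderiv 0 g) ≠ 0) (q : K × K × K) (hq : res2 q g = 0)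
    (hne : (res1 p (pderiv 0 g)).eval q.1 ≠ 0) : inc p q := by
  obtain ⟨c, hc⟩ := dvd_surface g hg hchar hv hG p hp hpv
  have := congrArg (eval ![q.2.1 * p.1 + q.2.2, p.1, q.1]) hc
  have hgz : eval ![q.2.1 * p.1 + q.2.2, p.1, q.1] g = 0 := by
    rw [← eval_res2, hq, Polynomial.eval_zero]
  rw [map_mul (f := eval _) g, hgz, zero_mul] at this
  simp only [map_add, map_mul, map_sub, eval_inW, eval_X, eval_C,
            Matrix.cons_val_zero, Matrix.cons_val_one, Matrix.cons_val, sub_self, mul_zero,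
            add_zero] at this
  rcases mul_eq_zero.1 this with h | h
  · exact absurd h hne
  · rw [inc]; linear_combination -h

/-- The degeneracy hypothesis. -/
def Deg (L : Finset (K × K × K)) (k : ℕ) : Prop :=
  ∀ a b c d : K, ∀ S ⊆ L, (∀ q ∈ S, q.2.1 = b + d * q.1 ∧ q.2.2 = a + c * q.1) → S.card ≤ k

lemma two_lines [Infinite K] (g : Pol K) (hg : Irreducible g)
    (hchar : ∀ n : ℕ, 0 < n → n ≤ g.totalDegree → (n : K) ≠ 0)
    (hv : ¬ g ∣ pderiv 0 g) (hG : g ∣ G2 g) (p p' : K × K × K) (hp : res1 p g = 0)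
    (hpv : res1 p (pderiv 0 g) ≠ 0) (hp' : res1 p' g = 0) (hpv' : res1 p' (pderiv 0 g) ≠ 0)
    (hne : p.1 ≠ p'.1) (M : Finset (K × K × K)) (hM : Set.InjOn Prod.fst (M : Set (K × K × K)))
    (k : ℕ) (hk : Deg M k) (hon : ∀ q ∈ M, res2 q g = 0) :
    M.card ≤ k + 2 * g.totalDegree := by
  classical
  set P := res1 p (pderiv 0 g) * res1 p' (pderiv 0 g) with hP
  have hP0 : P ≠ 0 := mul_ne_zero hpv hpv'
  have h1 : (M.filter fun q => P.eval q.1 = 0).card ≤ P.natDegree := by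
    apply card_le_of_roots _ Prod.fst _ P hP0
    · intro q hq; exact (Finset.mem_filter.1 hq).2
    · exact hM.mono (fun q hq => (Finset.mem_filter.1 (Finset.mem_coe.1 hq)).1)
  have h2 : P.natDegree ≤ 2 * g.totalDegree := by
    have := Polynomial.natDegree_mul_le (p := res1 p (pderiv 0 g)) (q := res1 p' (pderiv 0 g))
    have a1 := natDegree_res1 p (pderiv 0 g)
    have a2 := natDegree_res1 p' (pderiv 0 g)
    have a3 := totalDegree_pderiv_le 0 g
    rw [← hP] at this
    omega
  have h3 : (M.filter fun q => ¬ P.eval q.1 = 0).card ≤ k := by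
    have hx : p.1 - p'.1 ≠ 0 := sub_ne_zero.2 hne
    apply hk (p.2.2 - (p.2.2 - p'.2.2) / (p.1 - p'.1) * p.1) ((p.2.2 - p'.2.2) / (p.1 - p'.1))
      (p.2.1 - (p.2.1 - p'.2.1) / (p.1 - p'.1) * p.1) ((p.2.1 - p'.2.1) / (p.1 - p'.1)) _
      (Finset.filter_subset _ _)
    intro q hq
    obtain ⟨hqM, hq0⟩ := Finset.mem_filter.1 hq
    rw [hP, Polynomial.eval_mul, mul_eq_zero, not_or] at hq0
    have i1 := inc_of_surface g hg hchar hv hG p hp hpv q (hon q hqM) hq0.1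
    have i2 := inc_of_surface g hg hchar hv hG p' hp' hpv' q (hon q hqM) hq0.2
    rw [inc] at i1 i2
    have i3 : q.2.1 = (p.2.2 - p'.2.2) / (p.1 - p'.1) + (p.2.1 - p'.2.1) / (p.1 - p'.1) * q.1 := by
      field_simp
      linear_combination i2 - i1
    refine ⟨i3, ?_⟩
    have i4 : q.2.2 = p.2.1 * q.1 + p.2.2 - q.2.1 * p.1 := by linear_combination -i1
    rw [i4, i3]; ring
  have := Finset.card_filter_add_card_filter_not (s := M) (fun q => P.eval q.1 = 0)
  omega

lemma not_dvd_pderiv [Infinite K] (g : Pol K) (hg : Irreducible g)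
    (hchar : ∀ n : ℕ, 0 < n → n ≤ g.totalDegree → (n : K) ≠ 0)
    (M : Finset (K × K × K)) (hM : Set.InjOn Prod.fst (M : Set (K × K × K)))
    (hon : ∀ q ∈ M, res2 q g = 0) (hcard : g.totalDegree < M.card) : ¬ g ∣ pderiv 0 g := by
  intro hd
  have hdeg : 0 < g.totalDegree := by
    by_contra h0
    have h0 : g.totalDegree = 0 := by omega
    rw [totalDegree_eq_zero_iff_eq_C] at h0
    apply hg.not_isUnit
    rw [h0]
    refine (isUnit_iff_ne_zero.2 ?_).map C
    intro h1
    rw [h1, C_0] at h0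
    exact hg.ne_zero h0
  have hz : pderiv 0 g = 0 := by
    by_contra hne
    have h1 := totalDegree_le_of_dvd_of_isDomain hd hne
    have h2 := totalDegree_pderiv_le 0 g
    omega
  apply hg.ne_zero
  apply eq_zero_of_planes_w M Prod.fst hM g _ hcard
  intro q hq a c
  -- the polynomial in `v`
  set P : Polynomial K := aeval ![Polynomial.X, Polynomial.C c, Polynomial.C q.1] g with hP
  have hPe : ∀ t, P.eval t = eval ![t, c, q.1] g := by
    intro t
    rw [hP, eval_aeval_poly]
    congr 2
    funext i; fin_cases i <;> simp
  have hPd : P.natDegree ≤ g.totalDegree := by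
    apply natDegree_aeval_le
    intro i; fin_cases i <;> simp
  have hder : Polynomial.derivative P = 0 := by
    have := chain_rule (K := K) (Polynomial.derivative' (R := K))
      ![Polynomial.X, Polynomial.C c, Polynomial.C q.1] g
    rw [Fin.sum_univ_three] at this
    simpa [Polynomial.derivative', hz] using this
  have hconst : P = Polynomial.C (P.coeff 0) := by
    ext1 n
    rw [Polynomial.coeff_C]
    split_ifs with hn
    · rw [hn]
    · obtain ⟨m, rfl⟩ := Nat.exists_eq_succ_of_ne_zero hn
      by_cases hm : m + 1 ≤ g.totalDegree
      · have := congrArg (fun Q => Polynomial.coeff Q m) hder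
        simp only [Polynomial.coeff_derivative, Polynomial.coeff_zero] at this
        rcases mul_eq_zero.1 this with h | h
        · exact h
        · exact absurd (by exact_mod_cast h) (hchar _ (Nat.succ_pos m) hm)
      · exact Polynomial.coeff_eq_zero_of_natDegree_lt (by omega)
  have h1 : P.eval a = P.eval (q.2.1 * c + q.2.2) := by
    rw [hconst]; simp
  rw [← hPe, h1, hPe, ← eval_res2, hon q hq, Polynomial.eval_zero]

lemma pos_totalDegree (g : Pol K) (hg : Irreducible g) : 0 < g.totalDegree := by
  by_contra h0
  have h0 : g.totalDegree = 0 := by omega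
  rw [totalDegree_eq_zero_iff_eq_C] at h0
  apply hg.not_isUnit
  rw [h0]
  refine (isUnit_iff_ne_zero.2 ?_).map C
  intro h1
  rw [h1, C_0] at h0
  exact hg.ne_zero h0

lemma heavy_bound [Infinite K] (g : Pol K) (hg : Irreducible g)
    (hchar : ∀ n : ℕ, 0 < n → n ≤ g.totalDegree → (n : K) ≠ 0)
    (M : Finset (K × K × K)) (hM : Set.InjOn Prod.fst (M : Set (K × K × K)))
    (k : ℕ) (hk : Deg M k) (hon : ∀ q ∈ M, res2 q g = 0) (hcard : k + 2 * g.totalDegree < M.card)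
    (H : Finset (K × K × K)) (hH : Set.InjOn Prod.fst (H : Set (K × K × K)))
    (h1 : ∀ p ∈ H, res1 p g = 0) (h2 : ∀ p ∈ H, res1 p (G2 g) = 0) :
    H.card ≤ 15 * g.totalDegree ^ 2 := by
  classical
  have hpos := pos_totalDegree g hg
  have hv := not_dvd_pderiv g hg hchar M hM hon (by omega)
  have hG2 := totalDegree_G2 g
  by_cases hG : g ∣ G2 g
  · have hd := totalDegree_pderiv_le 0 g
    have hb := bezout g (pderiv 0 g) hg hv g.totalDegree le_rfl (by omega)
      (H.filter fun p => res1 p (pderiv 0 g) = 0)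
      (hH.mono (fun q hq => (Finset.mem_filter.1 (Finset.mem_coe.1 hq)).1))
      (fun s hs => h1 s (Finset.mem_filter.1 hs).1) (fun s hs => (Finset.mem_filter.1 hs).2)
    have hb2 : (H.filter fun p => ¬ res1 p (pderiv 0 g) = 0).card ≤ 1 := by
      rw [Finset.card_le_one]
      intro a ha b hb
      by_contra hab
      rw [Finset.mem_filter] at ha hb
      have hx : a.1 ≠ b.1 := fun h => hab (hH ha.1 hb.1 h)
      have := two_lines g hg hchar hv hG a b (h1 a ha.1) ha.2 (h1 b hb.1) hb.2 hx M hM k hk hon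
      omega
    have := Finset.card_filter_add_card_filter_not (s := H) (fun p => res1 p (pderiv 0 g) = 0)
    have hb3 : (g.totalDegree + (pderiv 0 g).totalDegree + 1) * g.totalDegree ≤
        (3 * g.totalDegree) * g.totalDegree := Nat.mul_le_mul_right _ (by omega)
    nlinarith
  · have hb := bezout g (G2 g) hg hG (3 * g.totalDegree) (by omega) hG2 H hH h1 h2
    nlinarith

/-- polynomial with prescribed coefficients -/
noncomputable def mkPol (D : ℕ) : ((Fin 3 → Fin D) → K) →ₗ[K] Pol K :=
  ∑ e : Fin 3 → Fin D, (MvPolynomial.monomial (Finsupp.equivFunOnFinite.symm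
    (fun i => (e i : ℕ)))).comp (LinearMap.proj e)

lemma mkPol_apply (D : ℕ) (c : (Fin 3 → Fin D) → K) :
    mkPol D c = ∑ e : Fin 3 → Fin D, MvPolynomial.monomial (Finsupp.equivFunOnFinite.symm
    (fun i => (e i : ℕ))) (c e) := by
  simp [mkPol]

lemma mkPol_coeff (D : ℕ) (c : (Fin 3 → Fin D) → K) (e : Fin 3 → Fin D) :
    coeff (Finsupp.equivFunOnFinite.symm (fun i => (e i : ℕ))) (mkPol D c) = c e := by
  classical
  rw [mkPol_apply, coeff_sum, Finset.sum_eq_single e]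
  · simp
  · intro e' _ hne
    rw [coeff_monomial, if_neg]
    intro h
    apply hne
    have := Finsupp.equivFunOnFinite.symm.injective h
    funext i
    exact Fin.ext (congrFun this i)
  · simp

lemma mkPol_degree (D : ℕ) (hD : 0 < D) (c : (Fin 3 → Fin D) → K) :
    (mkPol D c).totalDegree < 3 * D := by
  rw [mkPol_apply]
  have : (∑ e : Fin 3 → Fin D, MvPolynomial.monomial (Finsupp.equivFunOnFinite.symm
    (fun i => (e i : ℕ))) (c e)).totalDegree ≤ 3 * D - 3 := by
    refine MvPolynomial.totalDegree_finsetSum_le fun e _ => ?_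
    by_cases h0 : c e = 0
    · rw [h0]; simp
    rw [totalDegree_monomial _ h0, Finsupp.sum_fintype _ _ (fun _ => rfl), Fin.sum_univ_three]
    simp only [Finsupp.equivFunOnFinite_symm_apply_apply]
    have := (e 0).2
    have := (e 1).2
    have := (e 2).2
    omega
  omega

lemma exists_poly (D : ℕ) (hD : 0 < D) (L : Finset (K × K × K)) (hL : 3 * L.card < D * D) :
    ∃ f : Pol K, f ≠ 0 ∧ f.totalDegree ≤ 3 * D ∧ ∀ q ∈ L, res2 q f = 0 := by
  classical
  let Ψ : ((Fin 3 → Fin D) → K) →ₗ[K] (L × Fin (3 * D) → K) :=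
    LinearMap.pi fun i => (Polynomial.lcoeff K (i.2 : ℕ)).comp
      ((res2 i.1.1).toLinearMap.comp (mkPol D))
  have hlt : Module.finrank K (L × Fin (3 * D) → K) < Module.finrank K ((Fin 3 → Fin D) → K) := by
    simp only [Module.finrank_fintype_fun_eq_card, Fintype.card_prod, Fintype.card_coe,
      Fintype.card_fin, Fintype.card_pi, Finset.prod_const, Finset.card_univ]
    nlinarith
  have hk := LinearMap.ker_ne_bot_of_finrank_lt (f := Ψ) hlt
  obtain ⟨c, hc, hc0⟩ := (Submodule.ne_bot_iff _).1 hk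
  refine ⟨mkPol D c, ?_, (mkPol_degree D hD c).le, ?_⟩
  · intro h0
    apply hc0
    funext e
    rw [← mkPol_coeff D c e, h0]; simp
  · intro q hq
    ext1 n
    rw [Polynomial.coeff_zero]
    by_cases hn : n < 3 * D
    · have := congrFun (LinearMap.mem_ker.1 hc) (⟨q, hq⟩, ⟨n, hn⟩)
      exact this
    · apply Polynomial.coeff_eq_zero_of_natDegree_lt
      have h1 := natDegree_res2 q (mkPol D c)
      have h2 := mkPol_degree D hD c
      omega

lemma totalDegree_multiset_prod' (s : Multiset (Pol K)) (hs : ∀ g ∈ s, g ≠ 0) :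
    s.prod.totalDegree = (s.map totalDegree).sum := by
  induction s using Multiset.induction_on with
  | empty => simp
  | cons a s ih =>
    have h1 : ∀ g ∈ s, g ≠ 0 := fun g hg => hs g (Multiset.mem_cons_of_mem hg)
    rw [Multiset.prod_cons, Multiset.map_cons, Multiset.sum_cons,
      totalDegree_mul_of_isDomain (hs a (Multiset.mem_cons_self _ _)), ih h1]
    intro h0
    exact h1 0 (Multiset.prod_eq_zero_iff.1 h0) rfl

lemma exists_factors (f : Pol K) (hf : f ≠ 0) : ∃ F : Finset (Pol K),
    (∀ g ∈ F, Irreducible g) ∧ (∑ g ∈ F, g.totalDegree ≤ f.totalDegree) ∧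
    ∀ p : K × K × K, res1 p f = 0 → ∃ g ∈ F, res1 p g = 0 := by
  classical
  obtain ⟨s, hs1, hs2⟩ := WfDvdMonoid.exists_factors f hf
  refine ⟨s.toFinset, fun g hg => hs1 g (Multiset.mem_toFinset.1 hg), ?_, ?_⟩
  · have h1 := totalDegree_le_of_dvd_of_isDomain hs2.dvd hf
    rw [totalDegree_multiset_prod' s (fun g hg => (hs1 g hg).ne_zero)] at h1
    refine le_trans ?_ h1
    rw [Finset.sum_eq_multiset_sum, Multiset.toFinset_val]
    obtain ⟨t, ht⟩ := Multiset.le_iff_exists_add.1 (Multiset.dedup_le s)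
    conv_rhs => rw [ht, Multiset.map_add, Multiset.sum_add]
    exact Nat.le_add_right _ _
  · intro p hp
    obtain ⟨c, hc⟩ := hs2.symm.dvd
    have : res1 p s.prod = 0 := by rw [hc, map_mul, hp, zero_mul]
    rw [map_multiset_prod, Multiset.prod_eq_zero_iff, Multiset.mem_map] at this
    obtain ⟨g, hg, hg0⟩ := this
    exact ⟨g, Multiset.mem_toFinset.2 hg, hg0⟩

open Classical in
/-- number of incidences -/
noncomputable def E (L1 L2 : Finset (K × K × K)) : ℕ :=
  ∑ p ∈ L1, (L2.filter (inc p)).card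

lemma step [Infinite K] (D : ℕ) (hD : 0 < D)
    (hchar : ∀ n : ℕ, 0 < n → n ≤ 3 * D → (n : K) ≠ 0)
    (L1 L2 : Finset (K × K × K)) (i1 : Set.InjOn Prod.fst (L1 : Set (K × K × K)))
    (i2 : Set.InjOn Prod.fst (L2 : Set (K × K × K))) (k : ℕ) (hk : Deg L2 k)
    (hL : 3 * L2.card < D * D) :
    ∃ H ⊆ L1, H.card ≤ 15 * (3 * D) ^ 2 ∧
      E L1 L2 ≤ E H L2 + (k + 9 * D) * L1.card + 3 * D * L2.card := by
  classical
  obtain ⟨f, hf0, hfd, hf⟩ := exists_poly D hD L2 hL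
  obtain ⟨F, hF1, hF2, hF3⟩ := exists_factors f hf0
  have hFd : ∑ g ∈ F, g.totalDegree ≤ 3 * D := hF2.trans hfd
  have hFg : ∀ g ∈ F, g.totalDegree ≤ 3 * D := fun g hg =>
    (Finset.single_le_sum (f := fun g : Pol K => g.totalDegree) (fun _ _ => Nat.zero_le _) hg).trans hFd
  have hch : ∀ p : K × K × K, ∃ g : Pol K, res1 p f = 0 → g ∈ F ∧ res1 p g = 0 := by
    intro p
    by_cases h : res1 p f = 0
    · obtain ⟨g, h1, h2⟩ := hF3 p h
      exact ⟨g, fun _ => ⟨h1, h2⟩⟩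
    · exact ⟨0, fun h' => absurd h' h⟩
  choose γ hγ using hch
  set H := L1.filter (fun p => res1 p f = 0 ∧
    k + 2 * (γ p).totalDegree < (L2.filter fun q => res2 q (γ p) = 0).card ∧
    3 * (γ p).totalDegree < (L2.filter fun q => inc p q ∧ res2 q (γ p) = 0).card) with hH
  refine ⟨H, Finset.filter_subset _ _, ?_, ?_⟩
  · have hmap : ∀ p ∈ H, γ p ∈ F := by
      intro p hp
      exact (hγ p (Finset.mem_filter.1 hp).2.1).1
    rw [Finset.card_eq_sum_card_fiberwise (f := γ) (t := F) hmap]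
    have hb : ∀ g ∈ F, (H.filter fun p => γ p = g).card ≤ 15 * g.totalDegree ^ 2 := by
      intro g hg
      by_cases hemp : (H.filter fun p => γ p = g) = ∅
      · rw [hemp]; simp
      · obtain ⟨p0, hp0⟩ := Finset.nonempty_iff_ne_empty.2 hemp
        rw [Finset.mem_filter] at hp0
        obtain ⟨hp0, rfl⟩ := hp0
        have hp0' := (Finset.mem_filter.1 hp0).2
        apply heavy_bound (γ p0) (hF1 _ hg) (fun n h1 h2 => hchar n h1 (h2.trans (hFg _ hg)))
          (L2.filter fun q => res2 q (γ p0) = 0) _ k _ _ hp0'.2.1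
        · intro a ha b hb hab
          exact i1 (Finset.mem_filter.1 (Finset.mem_filter.1 ha).1).1
            (Finset.mem_filter.1 (Finset.mem_filter.1 hb).1).1 hab
        · intro p hp
          obtain ⟨hp, hpe⟩ := Finset.mem_filter.1 hp
          rw [← hpe]
          exact (hγ p (Finset.mem_filter.1 hp).2.1).2
        · intro p hp
          obtain ⟨hp, hpe⟩ := Finset.mem_filter.1 hp
          rw [← hpe]
          obtain ⟨hp1, hp2, hp3, hp4⟩ := Finset.mem_filter.1 hp
          by_contra hne
          have c1 := card_le_of_roots (L2.filter fun q => inc p q ∧ res2 q (γ p) = 0) Prod.fst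
            (i2.mono (fun q hq => (Finset.mem_filter.1 (Finset.mem_coe.1 hq)).1)) _ hne (by
              intro q hq
              obtain ⟨hq1, hq2, hq3⟩ := Finset.mem_filter.1 hq
              rw [eval_inc hq2, res2_G2 q _ hq3, Polynomial.eval_zero])
          have c2 := natDegree_res1 p (G2 (γ p))
          have c3 := totalDegree_G2 (γ p)
          omega
        · exact i2.mono (fun q hq => (Finset.mem_filter.1 (Finset.mem_coe.1 hq)).1)
        · intro a b c d S hS
          exact hk a b c d S (hS.trans (Finset.filter_subset _ _))
        · intro q hq; exact (Finset.mem_filter.1 hq).2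
    refine (Finset.sum_le_sum hb).trans ?_
    rw [← Finset.mul_sum]
    apply Nat.mul_le_mul_left
    calc ∑ g ∈ F, g.totalDegree ^ 2 ≤ ∑ g ∈ F, 3 * D * g.totalDegree := by
          apply Finset.sum_le_sum
          intro g hg
          rw [sq]
          exact Nat.mul_le_mul_right _ (hFg g hg)
      _ = 3 * D * ∑ g ∈ F, g.totalDegree := by rw [Finset.mul_sum]
      _ ≤ (3 * D) ^ 2 := by rw [sq]; exact Nat.mul_le_mul_left _ hFd
  · -- counting
    set B : (K × K × K) → (K × K × K) → Prop :=
      fun p q => inc p q ∧ res1 p f = 0 ∧ res2 q (γ p) ≠ 0 with hB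
    have key : ∀ p ∈ L1, (L2.filter (inc p)).card ≤
        (if p ∈ H then (L2.filter (inc p)).card else 0) + (k + 9 * D) + (L2.filter (B p)).card := by
      intro p hp
      by_cases hpH : p ∈ H
      · rw [if_pos hpH]; omega
      rw [if_neg hpH, zero_add]
      by_cases hpf : res1 p f = 0
      · obtain ⟨hg1, hg2⟩ := hγ p hpf
        have hgd := hFg _ hg1
        have hsplit : (L2.filter (inc p)).card ≤
            (L2.filter fun q => inc p q ∧ res2 q (γ p) = 0).card + (L2.filter (B p)).card := by
          rw [← Finset.card_filter_add_card_filter_not (s := L2.filter (inc p))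
            (fun q => res2 q (γ p) = 0), Finset.filter_filter, Finset.filter_filter]
          apply Nat.add_le_add_left
          apply Finset.card_le_card
          intro q hq
          rw [Finset.mem_filter] at hq ⊢
          exact ⟨hq.1, hq.2.1, hpf, hq.2.2⟩
        have hle : (L2.filter fun q => inc p q ∧ res2 q (γ p) = 0).card ≤
            (L2.filter fun q => res2 q (γ p) = 0).card := by
          apply Finset.card_le_card
          intro q hq
          rw [Finset.mem_filter] at hq ⊢
          exact ⟨hq.1, hq.2.2⟩
        have hnot : ¬ (k + 2 * (γ p).totalDegree < (L2.filter fun q => res2 q (γ p) = 0).card ∧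
            3 * (γ p).totalDegree < (L2.filter fun q => inc p q ∧ res2 q (γ p) = 0).card) := by
          intro h
          exact hpH (Finset.mem_filter.2 ⟨hp, hpf, h⟩)
        omega
      · have c1 := card_le_of_roots (L2.filter (inc p)) Prod.fst
          (i2.mono (fun q hq => (Finset.mem_filter.1 (Finset.mem_coe.1 hq)).1)) _ hpf (by
            intro q hq
            obtain ⟨hq1, hq2⟩ := Finset.mem_filter.1 hq
            rw [eval_inc hq2, hf q hq1, Polynomial.eval_zero])
        have c2 := natDegree_res1 p f
        omega
    have hsum := Finset.sum_le_sum key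
    rw [Finset.sum_add_distrib, Finset.sum_add_distrib, Finset.sum_const, smul_eq_mul,
      ← Finset.sum_filter] at hsum
    have hHf : L1.filter (fun p => p ∈ H) = H := by
      ext p
      rw [Finset.mem_filter]
      exact ⟨fun h => h.2, fun h => ⟨(Finset.mem_filter.1 h).1, h⟩⟩
    rw [hHf] at hsum
    have hswap : ∑ p ∈ L1, (L2.filter (B p)).card ≤ 3 * D * L2.card := by
      have : ∑ p ∈ L1, (L2.filter (B p)).card = ∑ q ∈ L2, (L1.filter fun p => B p q).card := by
        simp only [Finset.card_filter]
        exact Finset.sum_comm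
      rw [this, mul_comm, ← smul_eq_mul]
      apply Finset.sum_le_card_nsmul
      intro q hq
      have hmap : ∀ p ∈ L1.filter (fun p => B p q), γ p ∈ F := by
        intro p hp
        exact (hγ p (Finset.mem_filter.1 hp).2.2.1).1
      rw [Finset.card_eq_sum_card_fiberwise (f := γ) (t := F) hmap]
      refine (Finset.sum_le_sum (g := fun g => g.totalDegree) ?_).trans hFd
      intro g hg
      by_cases hqg : res2 q g = 0
      · have : (L1.filter (fun p => B p q)).filter (fun p => γ p = g) = ∅ := by
          rw [Finset.filter_eq_empty_iff]
          rintro p hp rfl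
          exact (Finset.mem_filter.1 hp).2.2.2 hqg
        rw [this]; simp
      · refine le_trans ?_ (natDegree_res2 q g)
        apply card_le_of_roots _ Prod.fst _ _ hqg
        · intro p hp
          have hpg := (Finset.mem_filter.1 hp).2
          have hpB : B p q := (Finset.mem_filter.1 (Finset.mem_filter.1 hp).1).2
          rw [← eval_inc hpB.1, ← hpg, (hγ p hpB.2.1).2, Polynomial.eval_zero]
        · exact i1.mono (fun q hq => (Finset.mem_filter.1 (Finset.mem_filter.1
            (Finset.mem_coe.1 hq)).1).1)
    have e1 : E L1 L2 = ∑ p ∈ L1, (L2.filter (inc p)).card := by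
      rw [E]
    have e2 : E H L2 = ∑ p ∈ H, (L2.filter (inc p)).card := by
      rw [E]
    rw [e1, e2]
    rw [mul_comm (k + 9 * D)]
    omega

lemma E_parts (L1 : Finset (K × K × K)) (s M N : ℕ) : ∀ L2 : Finset (K × K × K),
    (∀ L ⊆ L2, L.card ≤ s → E L1 L ≤ M) → L2.card ≤ N * s → E L1 L2 ≤ N * M := by
  classical
  induction N with
  | zero =>
    intro L2 _ h
    have : L2 = ∅ := by
      rw [← Finset.card_eq_zero]; omega
    subst this
    simp [E]
  | succ N ih =>
    intro L2 h hc
    obtain ⟨L, hL, hLc⟩ := Finset.exists_subset_card_eq (s := L2) (n := min s L2.card) (min_le_right _ _)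
    have h1 := h L hL (by omega)
    have h2 := ih (L2 \ L) (fun L' hL' hc' => h L' (hL'.trans Finset.sdiff_subset) hc') (by
      rw [Finset.card_sdiff_of_subset hL, hLc]
      rw [Nat.succ_mul] at hc
      omega)
    have h3 : E L1 L2 ≤ E L1 L + E L1 (L2 \ L) := by
      rw [E, E, E, ← Finset.sum_add_distrib]
      apply Finset.sum_le_sum
      intro p _
      refine le_trans (Finset.card_le_card ?_) (Finset.card_union_le _ _)
      intro q hq
      rw [Finset.mem_filter] at hq
      rw [Finset.mem_union, Finset.mem_filter, Finset.mem_filter, Finset.mem_sdiff]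
      tauto
    rw [Nat.succ_mul]
    omega

lemma E_le_mul (L1 L2 : Finset (K × K × K)) : E L1 L2 ≤ L1.card * L2.card := by
  classical
  rw [E, ← smul_eq_mul]
  apply Finset.sum_le_card_nsmul
  intro p _
  exact Finset.card_filter_le _ _

lemma arith (r t T k C N : ℕ) (hr1 : 2 ^ 7 * 3 ^ 9 ≤ r ^ 3) (hr2 : 2 ^ 7 * 3 ^ 7 ≤ r)
    (hN : N = (2 * r) ^ 6) (hC : C = 48 * N) (ht : 1 ≤ t) (htT : r * t ≤ T) :
    N * (C * ((3 * t) ^ 9 + k * (3 * t) ^ 7) + (k + 9 * (2 * t ^ 3)) * T ^ 6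
      + 3 * (2 * t ^ 3) * t ^ 6) ≤ C * (T ^ 9 + k * T ^ 7) := by
  have htT' : t ≤ T := le_trans (by nlinarith) htT
  have hT1 : 1 ≤ T := ht.trans htT'
  have a1 : 2 * N * 3 ^ 9 * t ^ 9 ≤ T ^ 9 := by
    calc 2 * N * 3 ^ 9 * t ^ 9 = (2 ^ 7 * 3 ^ 9) * (r ^ 6 * t ^ 9) := by rw [hN]; ring
      _ ≤ r ^ 3 * (r ^ 6 * t ^ 9) := Nat.mul_le_mul_right _ hr1
      _ = (r * t) ^ 9 := by ring
      _ ≤ T ^ 9 := Nat.pow_le_pow_left htT 9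
  have a2 : 2 * N * 3 ^ 7 * t ^ 7 ≤ T ^ 7 := by
    calc 2 * N * 3 ^ 7 * t ^ 7 = (2 ^ 7 * 3 ^ 7) * (r ^ 6 * t ^ 7) := by rw [hN]; ring
      _ ≤ r * (r ^ 6 * t ^ 7) := Nat.mul_le_mul_right _ hr2
      _ = (r * t) ^ 7 := by ring
      _ ≤ T ^ 7 := Nat.pow_le_pow_left htT 7
  have a3 : t ^ 3 ≤ T ^ 3 := Nat.pow_le_pow_left htT' 3
  have a4 : t ^ 9 ≤ T ^ 9 := Nat.pow_le_pow_left htT' 9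
  have a5 : T ^ 6 ≤ T ^ 7 := Nat.pow_le_pow_right hT1 (by norm_num)
  have b1 : t ^ 3 * T ^ 6 ≤ T ^ 9 := by
    calc t ^ 3 * T ^ 6 ≤ T ^ 3 * T ^ 6 := Nat.mul_le_mul_right _ a3
      _ = T ^ 9 := by ring
  have c1 := Nat.mul_le_mul_left C a1
  have c2 := Nat.mul_le_mul_left (C * k) a2
  have c3 := Nat.mul_le_mul_left N b1
  have c4 := Nat.mul_le_mul_left N a4
  have c5 := Nat.mul_le_mul_left (N * k) a5
  have c6 : C * T ^ 9 = 48 * (N * T ^ 9) := by rw [hC]; ring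
  have c7 : C * k * T ^ 7 = 48 * (N * k * T ^ 7) := by rw [hC]; ring
  have lhs : N * (C * ((3 * t) ^ 9 + k * (3 * t) ^ 7) + (k + 9 * (2 * t ^ 3)) * T ^ 6
      + 3 * (2 * t ^ 3) * t ^ 6) = N * C * 3 ^ 9 * t ^ 9 + N * C * k * 3 ^ 7 * t ^ 7
      + N * k * T ^ 6 + 18 * (N * (t ^ 3 * T ^ 6)) + 6 * (N * t ^ 9) := by ring
  rw [lhs]
  have e1 : C * (2 * N * 3 ^ 9 * t ^ 9) = 2 * (N * C * 3 ^ 9 * t ^ 9) := by ring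
  have e2 : C * k * (2 * N * 3 ^ 7 * t ^ 7) = 2 * (N * C * k * 3 ^ 7 * t ^ 7) := by ring
  rw [e1] at c1
  rw [e2] at c2
  have e3 : C * (T ^ 9 + k * T ^ 7) = C * T ^ 9 + C * k * T ^ 7 := by ring
  rw [e3]
  omega

theorem incidence [Infinite K] (r : ℕ) (hr1 : 2 ^ 7 * 3 ^ 9 ≤ r ^ 3) (hr2 : 2 ^ 7 * 3 ^ 7 ≤ r)
    (p : ℕ) (hchar : ∀ n : ℕ, 0 < n → n < p → (n : K) ≠ 0) (k : ℕ) (T : ℕ) (hT : T ^ 3 ≤ 8 * p) :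
    ∀ L1 L2 : Finset (K × K × K), Set.InjOn Prod.fst (L1 : Set (K × K × K)) →
    Set.InjOn Prod.fst (L2 : Set (K × K × K)) → Deg L2 k → L1.card ≤ T ^ 6 → L2.card ≤ T ^ 6 →
    E L1 L2 ≤ 48 * (2 * r) ^ 6 * (T ^ 9 + k * T ^ 7) := by
  classical
  induction T using Nat.strong_induction_on with
  | _ T ih =>
  intro L1 L2 i1 i2 hk hc1 hc2
  by_cases hTr : T < r
  · have h1 := E_le_mul L1 L2
    have h2 : L1.card * L2.card ≤ T ^ 6 * T ^ 6 := Nat.mul_le_mul hc1 hc2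
    have h3 : T ^ 6 * T ^ 6 = T ^ 3 * T ^ 9 := by ring
    have h4 : T ^ 3 ≤ 48 * (2 * r) ^ 6 := by
      have h5 : T ^ 3 ≤ (2 * r) ^ 3 := Nat.pow_le_pow_left (by omega) 3
      have h6 : (2 * r) ^ 3 ≤ (2 * r) ^ 6 := Nat.pow_le_pow_right (by omega) (by norm_num)
      omega
    have h5 : T ^ 3 * T ^ 9 ≤ 48 * (2 * r) ^ 6 * T ^ 9 := Nat.mul_le_mul_right _ h4
    have h6 : 48 * (2 * r) ^ 6 * T ^ 9 ≤ 48 * (2 * r) ^ 6 * (T ^ 9 + k * T ^ 7) :=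
      Nat.mul_le_mul_left _ (Nat.le_add_right _ _)
    omega
  · push Not at hTr
    set t := T / r with ht
    have hr0 : 0 < r := by omega
    have ht1 : 1 ≤ t := (Nat.one_le_div_iff hr0).2 hTr
    have htT : r * t ≤ T := Nat.mul_div_le T r
    have hT2 : T ≤ 2 * r * t := by
      have := Nat.lt_mul_div_succ T hr0
      rw [← ht] at this
      nlinarith
    have h3t : 3 * t < T := by nlinarith
    have hp6 : 6 * t ^ 3 < p := by
      have h1 : r ^ 3 * t ^ 3 ≤ T ^ 3 := by rw [← mul_pow]; exact Nat.pow_le_pow_left htT 3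
      have h2 : 2 ^ 7 * 3 ^ 9 * t ^ 3 ≤ r ^ 3 * t ^ 3 := Nat.mul_le_mul_right _ hr1
      have h3 : 1 ≤ t ^ 3 := Nat.one_le_pow _ _ ht1
      omega
    have hpart : ∀ L ⊆ L2, L.card ≤ t ^ 6 → E L1 L ≤
        48 * (2 * r) ^ 6 * ((3 * t) ^ 9 + k * (3 * t) ^ 7) + (k + 9 * (2 * t ^ 3)) * T ^ 6
      + 3 * (2 * t ^ 3) * t ^ 6 := by
      intro L hL hLc
      have hkL : Deg L k := fun a b c d S hS => hk a b c d S (hS.trans hL)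
      have i2L : Set.InjOn Prod.fst (L : Set (K × K × K)) := i2.mono (by exact_mod_cast hL)
      have ht3 : 1 ≤ t ^ 3 := Nat.one_le_pow _ _ ht1
      have ht6 : 1 ≤ t ^ 6 := Nat.one_le_pow _ _ ht1
      obtain ⟨H, hH, hHc, hE⟩ := step (2 * t ^ 3) (by omega)
        (fun n h1 h2 => hchar n h1 (by omega)) L1 L i1 i2L k hkL (by
          have : 2 * t ^ 3 * (2 * t ^ 3) = 4 * t ^ 6 := by ring
          omega)
      have hrec := ih (3 * t) h3t ((Nat.pow_le_pow_left h3t.le 3).trans hT) H L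
        (i1.mono (by exact_mod_cast hH)) i2L hkL (by
          have e1 : 15 * (3 * (2 * t ^ 3)) ^ 2 = 540 * t ^ 6 := by ring
          have e2 : (3 * t) ^ 6 = 729 * t ^ 6 := by ring
          omega) (by
          have e2 : (3 * t) ^ 6 = 729 * t ^ 6 := by ring
          omega)
      have f1 := Nat.mul_le_mul_left (k + 9 * (2 * t ^ 3)) hc1
      have f2 := Nat.mul_le_mul_left (3 * (2 * t ^ 3)) hLc
      omega
    have hN := E_parts L1 (t ^ 6) _ ((2 * r) ^ 6) L2 hpart (by
      rw [← mul_pow]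
      exact hc2.trans (Nat.pow_le_pow_left hT2 6))
    exact hN.trans (arith r t T k _ _ hr1 hr2 rfl rfl ht1 htT)

section application
variable {F : Type*} [Field F]

/-- the big field -/
abbrev BF (F : Type*) [Field F] := FractionRing (Polynomial F)

/-- inclusion of the polynomial ring -/
noncomputable abbrev io : Polynomial F →+* BF F := algebraMap (Polynomial F) (BF F)

lemma io_inj : Function.Injective (io (F := F)) := IsFractionRing.injective _ _

/-- constants -/
noncomputable def cc (a : F) : BF F := io (Polynomial.C a)

/-- the transcendental -/
noncomputable def th : BF F := io Polynomial.X

/-- denominators -/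
noncomputable def xi (p : F × F × F) : BF F := 1 + th ^ 4 * cc p.2.1

/-- denominators -/
noncomputable def Q3 (q : F × F × F) : BF F := -(1 + th ^ 2 * cc q.1)

/-- numerators -/
noncomputable def Q2 (q : F × F × F) : BF F := cc q.2.1 - th * cc q.1 + th ^ 4 * cc q.2.2

/-- map on points -/
noncomputable def phi (p : F × F × F) : BF F × BF F × BF F :=
  ((cc p.1 + th * cc p.2.1 + th ^ 2 * cc p.2.2) / xi p, cc p.2.1 / xi p, cc p.2.2 / xi p)

/-- map on planes -/
noncomputable def psi (q : F × F × F) : BF F × BF F × BF F :=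
  (Q2 q / Q3 q, - cc q.1 / Q3 q, cc q.2.2 / Q3 q)

lemma xi_ne (p : F × F × F) : xi p ≠ 0 := by
  intro h
  have h1 : io (1 + Polynomial.X ^ 4 * Polynomial.C p.2.1) = io 0 := by
    simp only [xi, th, cc] at h
    simp only [map_add, map_mul, map_sub, map_neg, map_pow, map_one, map_zero]
    exact h
  have h2 := congrArg (fun P => Polynomial.coeff P 0) (io_inj h1)
  simp [Polynomial.coeff_X_pow_mul'] at h2

lemma Q3_ne (p : F × F × F) : Q3 p ≠ 0 := by
  intro h
  have h1 : io (-(1 + Polynomial.X ^ 2 * Polynomial.C p.1)) = io 0 := by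
    simp only [Q3, th, cc] at h
    simp only [map_add, map_mul, map_sub, map_neg, map_pow, map_one, map_zero]
    exact h
  have h2 := congrArg (fun P => Polynomial.coeff P 0) (io_inj h1)
  simp [Polynomial.coeff_X_pow_mul'] at h2

lemma th_ne : (th : BF F) ≠ 0 := by
  intro h
  have h1 : io (Polynomial.X : Polynomial F) = io 0 := by
    simpa [th] using h
  exact Polynomial.X_ne_zero (io_inj h1)

lemma cc_inj : Function.Injective (cc (F := F)) := io_inj.comp Polynomial.C_injective

lemma inc_iff (p q : F × F × F) :
    inc (phi p) (psi q) ↔ p.1 * q.1 + p.2.1 * q.2.1 = p.2.2 + q.2.2 := by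
  have h1 := xi_ne p
  have h2 := Q3_ne q
  have h3 : p.1 * q.1 + p.2.1 * q.2.1 = p.2.2 + q.2.2 ↔
      cc p.1 * cc q.1 + cc p.2.1 * cc q.2.1 = cc p.2.2 + cc q.2.2 := by
    rw [← cc_inj.eq_iff]
    simp [cc]
  rw [h3, inc, phi, psi]
  simp only
  have key : cc p.2.1 / xi p * (Q2 q / Q3 q) + cc p.2.2 / xi p -
      (-cc q.1 / Q3 q * ((cc p.1 + th * cc p.2.1 + th ^ 2 * cc p.2.2) / xi p) + cc q.2.2 / Q3 q) =
      (cc p.1 * cc q.1 + cc p.2.1 * cc q.2.1 - (cc p.2.2 + cc q.2.2)) / (xi p * Q3 q) := by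
    have e : cc p.1 * cc q.1 + cc p.2.1 * cc q.2.1 - (cc p.2.2 + cc q.2.2) =
        cc p.2.1 * Q2 q + cc p.2.2 * Q3 q +
        cc q.1 * (cc p.1 + th * cc p.2.1 + th ^ 2 * cc p.2.2) - cc q.2.2 * xi p := by
      simp only [Q2, Q3, xi]; ring
    rw [e]
    field_simp
    ring
  rw [← sub_eq_zero, key, div_eq_zero_iff, or_iff_left (mul_ne_zero h1 h2), sub_eq_zero]

lemma phi_inj : Function.Injective (fun p : F × F × F => (phi p).1) := by
  rintro ⟨a, b, c⟩ ⟨a', b', c'⟩ h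
  simp only [phi] at h
  rw [div_eq_div_iff (xi_ne _) (xi_ne _)] at h
  have h1 : (Polynomial.C a + Polynomial.X * Polynomial.C b + Polynomial.X ^ 2 * Polynomial.C c)
      * (1 + Polynomial.X ^ 4 * Polynomial.C b') = (Polynomial.C a' + Polynomial.X * Polynomial.C b'
      + Polynomial.X ^ 2 * Polynomial.C c') * (1 + Polynomial.X ^ 4 * Polynomial.C b) := by
    apply io_inj
    simp only [xi, th, cc] at h
    simp only [map_add, map_mul, map_sub, map_neg, map_pow, map_one, map_zero]
    exact h
  have h2 : Polynomial.C a + Polynomial.X ^ 1 * Polynomial.C b + Polynomial.X ^ 2 * Polynomial.C c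
     - (Polynomial.C a' + Polynomial.X ^ 1 * Polynomial.C b' + Polynomial.X ^ 2 * Polynomial.C c')
     = Polynomial.X ^ 4 * ((Polynomial.C a' + Polynomial.X * Polynomial.C b'
      + Polynomial.X ^ 2 * Polynomial.C c') * Polynomial.C b -
      (Polynomial.C a + Polynomial.X * Polynomial.C b + Polynomial.X ^ 2 * Polynomial.C c) *
      Polynomial.C b') := by
    linear_combination h1
  have e0 := congrArg (fun P => Polynomial.coeff P 0) h2
  have e1 := congrArg (fun P => Polynomial.coeff P 1) h2
  have e2 := congrArg (fun P => Polynomial.coeff P 2) h2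
  simp only [Polynomial.coeff_add, Polynomial.coeff_sub, Polynomial.coeff_X_pow_mul',
    Polynomial.coeff_C] at e0 e1 e2
  norm_num at e0 e1 e2
  rw [sub_eq_zero] at e0 e1 e2
  rw [e0, e1, e2]

lemma psi_inj : Function.Injective (fun p : F × F × F => (psi p).1) := by
  rintro ⟨a, b, c⟩ ⟨a', b', c'⟩ h
  simp only [psi] at h
  rw [div_eq_div_iff (Q3_ne _) (Q3_ne _)] at h
  have h1 : (Polynomial.C b - Polynomial.X * Polynomial.C a + Polynomial.X ^ 4 * Polynomial.C c)
      * (-(1 + Polynomial.X ^ 2 * Polynomial.C a')) = (Polynomial.C b' - Polynomial.X * Polynomial.C a'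
      + Polynomial.X ^ 4 * Polynomial.C c') * (-(1 + Polynomial.X ^ 2 * Polynomial.C a)) := by
    apply io_inj
    simp only [Q2, Q3, th, cc] at h
    simp only [map_add, map_mul, map_sub, map_neg, map_pow, map_one, map_zero]
    exact h
  have h2 : Polynomial.C b - Polynomial.X ^ 1 * Polynomial.C a + Polynomial.X ^ 4 * Polynomial.C c
     - (Polynomial.C b' - Polynomial.X ^ 1 * Polynomial.C a' + Polynomial.X ^ 4 * Polynomial.C c')
     = Polynomial.X ^ 2 * (Polynomial.C (b' * a - b * a'))
       + Polynomial.X ^ 6 * (Polynomial.C (c' * a - c * a')) := by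
    simp only [map_sub, map_mul]
    linear_combination -h1
  have e0 := congrArg (fun P => Polynomial.coeff P 0) h2
  have e1 := congrArg (fun P => Polynomial.coeff P 1) h2
  have e2 := congrArg (fun P => Polynomial.coeff P 4) h2
  simp only [Polynomial.coeff_add, Polynomial.coeff_sub, Polynomial.coeff_X_pow_mul',
    Polynomial.coeff_C] at e0 e1 e2
  norm_num at e0 e1 e2
  rw [sub_eq_zero] at e0 e2
  have e1 : a = a' := by linear_combination -e1
  rw [e0, e1, e2]

lemma deg_psi [DecidableEq (BF F × BF F × BF F)] (Q : Finset (F × F × F)) (n : ℕ) (A1 A2 : Finset F) (hA1 : A1.card ≤ n)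
    (hA2 : A2.card ≤ n) (h1 : ∀ q ∈ Q, q.1 ∈ A1) (h2 : ∀ q ∈ Q, q.2.1 ∈ A2)
    (h3 : ∀ S ⊆ Q, (∀ q ∈ S, ∀ q' ∈ S, q.1 = q'.1 ∧ q.2.1 = q'.2.1) → S.card ≤ n) :
    Deg (Q.image psi) n := by
  classical
  intro a b c d S hS hon
  set S' := Q.filter (fun q => psi q ∈ S) with hS'
  have hle : S.card ≤ S'.card := by
    refine (Finset.card_le_card ?_).trans (Finset.card_image_le (s := S') (f := psi))
    intro z hz
    obtain ⟨q, hq, rfl⟩ := Finset.mem_image.1 (hS hz)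
    exact Finset.mem_image_of_mem _ (Finset.mem_filter.2 ⟨hq, hz⟩)
  refine hle.trans ?_
  have hsub : ∀ q ∈ S', q ∈ Q := fun q hq => (Finset.mem_filter.1 hq).1
  have heq : ∀ q ∈ S', - cc q.1 = b * Q3 q + d * Q2 q ∧ cc q.2.2 = a * Q3 q + c * Q2 q := by
    intro q hq
    obtain ⟨u1, u2⟩ := hon _ (Finset.mem_filter.1 hq).2
    have hne := Q3_ne q
    simp only [psi] at u1 u2
    constructor
    · field_simp at u1
      linear_combination u1
    · field_simp at u2
      linear_combination u2
  have hth := th_ne (F := F)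
  by_cases hd : d = 0
  · subst hd
    by_cases hb : b * th ^ 2 = 1
    · have : S' = ∅ := by
        rw [Finset.eq_empty_iff_forall_notMem]
        intro q hq
        obtain ⟨u1, u2⟩ := heq q hq
        simp only [Q3] at u1
        have : b = 0 := by linear_combination u1 - cc q.1 * hb
        rw [this, zero_mul] at hb
        exact zero_ne_one hb
      rw [this]; simp
    · have hz1 : ∀ q ∈ S', ∀ q' ∈ S', q.1 = q'.1 := by
        intro q hq q' hq'
        obtain ⟨u1, -⟩ := heq q hq
        obtain ⟨u2, -⟩ := heq q' hq'
        simp only [Q3] at u1 u2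
        apply cc_inj
        have : (b * th ^ 2 - 1) * (cc q.1 - cc q'.1) = 0 := by linear_combination u1 - u2
        rcases mul_eq_zero.1 this with h | h
        · exact absurd (sub_eq_zero.1 h) hb
        · exact sub_eq_zero.1 h
      by_cases hc : c * th ^ 4 = 1
      · apply h3 S' (fun q hq => hsub q hq)
        intro q hq q' hq'
        refine ⟨hz1 q hq q' hq', ?_⟩
        obtain ⟨-, u1⟩ := heq q hq
        obtain ⟨-, u2⟩ := heq q' hq'
        simp only [Q3, Q2, hz1 q hq q' hq'] at u1 u2
        apply cc_inj
        have hc0 : c ≠ 0 := by rintro rfl; simp at hc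
        have : c * (cc q.2.1 - cc q'.2.1) = 0 := by
          linear_combination u2 - u1 - (cc q.2.2 - cc q'.2.2) * hc
        exact sub_eq_zero.1 ((mul_eq_zero.1 this).resolve_left hc0)
      · refine (Finset.card_le_card_of_injOn (fun q => q.2.1) (fun q hq => h2 q (hsub q hq)) ?_).trans hA2
        intro q hq q' hq' hqq
        simp only at hqq
        have e1 := hz1 q hq q' hq'
        obtain ⟨-, u1⟩ := heq q hq
        obtain ⟨-, u2⟩ := heq q' hq'
        simp only [Q3, Q2, e1, hqq] at u1 u2
        have : (c * th ^ 4 - 1) * (cc q.2.2 - cc q'.2.2) = 0 := by linear_combination u2 - u1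
        rcases mul_eq_zero.1 this with h | h
        · exact absurd (sub_eq_zero.1 h) hc
        · exact Prod.ext e1 (Prod.ext hqq (cc_inj (sub_eq_zero.1 h)))
  · refine (Finset.card_le_card_of_injOn (fun q => q.1) (fun q hq => h1 q (hsub q hq)) ?_).trans hA1
    intro q hq q' hq' hqq
    simp only at hqq
    obtain ⟨u1, u2⟩ := heq q hq
    obtain ⟨v1, v2⟩ := heq q' hq'
    simp only [Q3, hqq] at u1 u2 v1 v2
    have : d * (Q2 q - Q2 q') = 0 := by linear_combination v1 - u1
    have hQ : Q2 q = Q2 q' := sub_eq_zero.1 ((mul_eq_zero.1 this).resolve_left hd)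
    have w2 : q.2.2 = q'.2.2 := by
      apply cc_inj
      rw [hQ] at u2
      exact u2.trans v2.symm
    simp only [Q2, w2, hqq] at hQ
    have w1 : q.2.1 = q'.2.1 := by
      apply cc_inj
      linear_combination hQ
    exact Prod.ext hqq (Prod.ext w1 w2)

end application

section final

open Classical in
lemma points_planes (p : ℕ) [Fact p.Prime] (n T : ℕ) (hT : T ^ 3 ≤ 8 * p)
    (P Q : Finset (ZMod p × ZMod p × ZMod p)) (hP : P.card ≤ T ^ 6) (hQ : Q.card ≤ T ^ 6)
    (A1 A2 : Finset (ZMod p)) (hA1 : A1.card ≤ n) (hA2 : A2.card ≤ n)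
    (h1 : ∀ q ∈ Q, q.1 ∈ A1) (h2 : ∀ q ∈ Q, q.2.1 ∈ A2)
    (h3 : ∀ S ⊆ Q, (∀ q ∈ S, ∀ q' ∈ S, q.1 = q'.1 ∧ q.2.1 = q'.2.1) → S.card ≤ n) :
    ((P ×ˢ Q).filter (fun z => z.1.1 * z.2.1 + z.1.2.1 * z.2.2.1 = z.1.2.2 + z.2.2.2)).card
      ≤ 48 * (2 * 2 ^ 19) ^ 6 * (T ^ 9 + n * T ^ 7) := by
  have hinf : Infinite (BF (ZMod p)) := Infinite.of_injective _ (io_inj (F := ZMod p))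
  have hchar : ∀ m : ℕ, 0 < m → m < p → (m : BF (ZMod p)) ≠ 0 := by
    intro m h0 hm h
    have e : cc (m : ZMod p) = cc 0 := by
      simp only [cc, map_natCast, map_zero]
      exact h
    have := (ZMod.natCast_eq_zero_iff m p).1 (cc_inj e)
    exact absurd (Nat.le_of_dvd h0 this) (by omega)
  have ph : Function.Injective (phi (F := ZMod p)) :=
    fun a b h => phi_inj (congrArg Prod.fst h)
  have ps : Function.Injective (psi (F := ZMod p)) :=
    fun a b h => psi_inj (congrArg Prod.fst h)
  have main := incidence (K := BF (ZMod p)) (2 ^ 19) (by norm_num) (by norm_num) p hchar n T hT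
    (P.image phi) (Q.image psi)
    (by
      intro x hx y hy h
      obtain ⟨a, -, rfl⟩ := Finset.mem_image.1 (Finset.mem_coe.1 hx)
      obtain ⟨b, -, rfl⟩ := Finset.mem_image.1 (Finset.mem_coe.1 hy)
      rw [phi_inj h])
    (by
      intro x hx y hy h
      obtain ⟨a, -, rfl⟩ := Finset.mem_image.1 (Finset.mem_coe.1 hx)
      obtain ⟨b, -, rfl⟩ := Finset.mem_image.1 (Finset.mem_coe.1 hy)
      rw [psi_inj h])
    (deg_psi Q n A1 A2 hA1 hA2 h1 h2 h3)
    (Finset.card_image_le.trans hP) (Finset.card_image_le.trans hQ)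
  refine le_trans (le_of_eq ?_) main
  rw [E, Finset.sum_image (fun a _ b _ h => ph h), Finset.card_filter, Finset.sum_product]
  refine Finset.sum_congr rfl fun a _ => ?_
  rw [← Finset.card_filter, Finset.filter_image, Finset.card_image_of_injective _ ps]
  congr 1
  refine Finset.filter_congr fun b _ => ?_
  rw [inc_iff]

lemma sq_fiber {F : Type*} [Field F] [DecidableEq F] (A : Finset F) (c0 : F) :
    A.card ≤ 2 * (A.image (fun c => (c - c0) ^ 2)).card := by
  refine Finset.card_le_mul_card_image (f := fun c => (c - c0) ^ 2) A 2 fun b hb => ?_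
  obtain ⟨c, hc, rfl⟩ := Finset.mem_image.1 hb
  refine (Finset.card_le_card (t := ({c, 2 * c0 - c} : Finset F)) ?_).trans Finset.card_le_two
  intro d hd
  have h := (Finset.mem_filter.1 hd).2
  have : (d - c) * (d - (2 * c0 - c)) = 0 := by linear_combination h
  rw [Finset.mem_insert, Finset.mem_singleton]
  rcases mul_eq_zero.1 this with h | h
  · exact Or.inl (sub_eq_zero.1 h)
  · exact Or.inr (sub_eq_zero.1 h)

lemma cs {α β : Type*} [DecidableEq β] (X : Finset α) (f : α → β) :
    X.card ^ 2 ≤ (X.image f).card * ((X ×ˢ X).filter (fun z => f z.1 = f z.2)).card := by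
  have e1 : X.card = ∑ b ∈ X.image f, (X.filter (fun x => f x = b)).card :=
    Finset.card_eq_sum_card_image f X
  have e2 : ((X ×ˢ X).filter (fun z => f z.1 = f z.2)).card
      = ∑ b ∈ X.image f, (X.filter (fun x => f x = b)).card ^ 2 := by
    rw [Finset.card_eq_sum_card_fiberwise (f := fun z => f z.1) (t := X.image f)]
    · refine Finset.sum_congr rfl fun b _ => ?_
      rw [sq, ← Finset.card_product]
      congr 1
      ext ⟨x, y⟩
      simp only [Finset.mem_filter, Finset.mem_product]
      grind
    · intro z hz
      exact Finset.mem_coe.2 (Finset.mem_image_of_mem _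
        (Finset.mem_product.1 (Finset.mem_filter.1 (Finset.mem_coe.1 hz)).1).1)
  rw [e2]
  nth_rw 1 [e1]
  exact sq_sum_le_card_mul_sum_sq

open Classical in
lemma nat_bound (p : ℕ) [Fact p.Prime] (hp : 2 < p) (A : Finset (ZMod p)) (hA : A.Nonempty)
    (T : ℕ) (hT : T ^ 3 ≤ 8 * p) (hn : A.card ≤ T ^ 2) :
    A.card ^ 6 ≤ 4 * ((((A ×ˢ A) ×ˢ (A ×ˢ A)).image
          (fun q => (q.1.1 - q.1.2) ^ 2 + (q.2.1 - q.2.2) ^ 2)).card *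
          (48 * (2 * 2 ^ 19) ^ 6 * (T ^ 9 + A.card * T ^ 7))) := by
  obtain ⟨c0, hc0⟩ := hA
  set n := A.card with hnn
  set S := A.image (fun c => (c - c0) ^ 2) with hS
  have hS1 : S.card ≤ n := Finset.card_image_le
  have hS2 : n ≤ 2 * S.card := sq_fiber A c0
  set X := A ×ˢ A ×ˢ S with hX
  have hXc : X.card = n * (n * S.card) := by rw [hX, Finset.card_product, Finset.card_product]
  have hXT : X.card ≤ T ^ 6 := by
    rw [hXc]
    calc n * (n * S.card) ≤ T ^ 2 * (T ^ 2 * T ^ 2) := by gcongr; exact hS1.trans hn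
      _ = T ^ 6 := by ring
  have h2 : (2 : ZMod p) ≠ 0 := by
    intro h
    have h' : ((2 : ℕ) : ZMod p) = 0 := by exact_mod_cast h
    have := Nat.le_of_dvd (by norm_num) ((ZMod.natCast_eq_zero_iff 2 p).1 h')
    omega
  set f : ZMod p × ZMod p × ZMod p → ZMod p := fun x => (x.1 - x.2.1) ^ 2 + x.2.2 with hf
  set P := X.image (fun x : ZMod p × ZMod p × ZMod p => (2 * x.1, -2 * x.2.1, x.1 ^ 2 - x.2.1 ^ 2 - x.2.2)) with hP
  set Q := X.image (fun x : ZMod p × ZMod p × ZMod p => (x.2.1, x.1, x.2.1 ^ 2 + x.2.2 - x.1 ^ 2)) with hQ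
  have him : (X.image f).card ≤ (((A ×ˢ A) ×ˢ (A ×ˢ A)).image
          (fun q => (q.1.1 - q.1.2) ^ 2 + (q.2.1 - q.2.2) ^ 2)).card := by
    apply Finset.card_le_card
    intro z hz
    obtain ⟨⟨a, b, s⟩, hx, rfl⟩ := Finset.mem_image.1 hz
    simp only [hX, Finset.mem_product] at hx
    obtain ⟨ha, hb, hs⟩ := hx
    obtain ⟨c, hc, rfl⟩ := Finset.mem_image.1 hs
    refine Finset.mem_image.2 ⟨((a, b), (c, c0)), ?_, rfl⟩
    simp [ha, hb, hc, hc0]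
  have hE : ((X ×ˢ X).filter (fun z => f z.1 = f z.2)).card ≤
      ((P ×ˢ Q).filter (fun z => z.1.1 * z.2.1 + z.1.2.1 * z.2.2.1 = z.1.2.2 + z.2.2.2)).card := by
    refine Finset.card_le_card_of_injOn (fun z => ((2 * z.1.1, -2 * z.2.2.1,
      z.1.1 ^ 2 - z.2.2.1 ^ 2 - z.2.2.2), (z.1.2.1, z.2.1, z.1.2.1 ^ 2 + z.1.2.2 - z.2.1 ^ 2)))
      ?_ ?_
    · rintro ⟨⟨a, b, s⟩, ⟨a', b', s'⟩⟩ hz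
      simp only [hX, Finset.coe_filter, Set.mem_ofPred_eq, Finset.mem_product, hf] at hz
      obtain ⟨⟨⟨ha, hb, hs⟩, ha', hb', hs'⟩, he⟩ := hz
      simp only [Finset.coe_filter, Set.mem_ofPred_eq, Finset.mem_product]
      refine ⟨⟨Finset.mem_image.2 ⟨(a, b', s'), ?_, rfl⟩, Finset.mem_image.2 ⟨(a', b, s), ?_, rfl⟩⟩, ?_⟩
      · simp [hX, ha, hb', hs']
      · simp [hX, ha', hb, hs]
      · linear_combination -he
    · rintro ⟨⟨a, b, s⟩, ⟨a', b', s'⟩⟩ - ⟨⟨x, y, t⟩, ⟨x', y', t'⟩⟩ - h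
      simp only [Prod.mk.injEq] at h
      obtain ⟨⟨e1, e2, e3⟩, e4, e5, e6⟩ := h
      have e1 := mul_left_cancel₀ h2 e1
      have e2 := mul_left_cancel₀ (neg_ne_zero.2 h2) e2
      subst e1 e2 e4 e5
      have e3 : s' = t' := by linear_combination -e3
      have e6 : s = t := by linear_combination e6
      rw [e3, e6]
  have hI := points_planes p n T hT P Q (Finset.card_image_le.trans hXT)
    (Finset.card_image_le.trans hXT) A A le_rfl le_rfl
    (by
      intro q hq
      obtain ⟨⟨a, b, s⟩, hx, rfl⟩ := Finset.mem_image.1 hq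
      simp only [hX, Finset.mem_product] at hx
      exact hx.2.1)
    (by
      intro q hq
      obtain ⟨⟨a, b, s⟩, hx, rfl⟩ := Finset.mem_image.1 hq
      simp only [hX, Finset.mem_product] at hx
      exact hx.1)
    (by
      intro R hR hRR
      refine le_trans (Finset.card_le_card_of_injOn
        (fun q => q.2.2 + q.2.1 ^ 2 - q.1 ^ 2) (t := S) ?_ ?_) hS1
      · intro q hq
        obtain ⟨⟨a, b, s⟩, hx, rfl⟩ := Finset.mem_image.1 (hR hq)
        simp only [hX, Finset.mem_product] at hx
        have : b ^ 2 + s - a ^ 2 + a ^ 2 - b ^ 2 = s := by ring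
        simp only [this]
        exact hx.2.2
      · intro q hq q' hq' h
        obtain ⟨u1, u2⟩ := hRR q hq q' hq'
        simp only [u1, u2] at h
        refine Prod.ext u1 (Prod.ext u2 ?_)
        linear_combination h)
  have hcs := cs X f
  have h6 : n ^ 6 ≤ 4 * X.card ^ 2 := by
    have : n ^ 3 ≤ 2 * X.card := by
      rw [hXc]
      calc n ^ 3 = n * n * n := by ring
        _ ≤ n * n * (2 * S.card) := by gcongr
        _ = _ := by ring
    calc n ^ 6 = (n ^ 3) ^ 2 := by ring
      _ ≤ (2 * X.card) ^ 2 := by gcongr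
      _ = _ := by ring
  refine h6.trans ?_
  gcongr
  refine hcs.trans ?_
  exact Nat.mul_le_mul him (hE.trans hI)

end final

end S19

theorem stmt_19 :
    ∃ c : ℝ, 0 < c ∧ ∀ (p : ℕ), p.Prime → 2 < p →
      ∀ A : Finset (ZMod p), (A.card : ℝ) ≤ (p : ℝ) ^ ((2 : ℝ) / 3) →
      c * (A.card : ℝ) ^ ((3 : ℝ) / 2) ≤
        ((((A ×ˢ A) ×ˢ (A ×ˢ A)).image
          (fun q => (q.1.1 - q.1.2) ^ 2 + (q.2.1 - q.2.2) ^ 2)).card : ℝ) := by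
  refine ⟨1 / (4096 * (48 * (2 * 2 ^ 19) ^ 6)), by positivity, ?_⟩
  intro p hp h2 A hA
  have : Fact p.Prime := ⟨hp⟩
  rcases A.eq_empty_or_nonempty with rfl | hne
  · simp
  have hn1 : 1 ≤ A.card := hne.card_pos
  set n := A.card with hn
  set y : ℝ := Real.sqrt n with hy
  have hy2 : y ^ 2 = n := Real.sq_sqrt (Nat.cast_nonneg n)
  have hn1' : (1 : ℝ) ≤ n := by exact_mod_cast hn1
  have hy1 : 1 ≤ y := Real.one_le_sqrt.2 hn1'
  have hy3 : (n : ℝ) ^ ((3 : ℝ) / 2) = y ^ 3 := by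
    rw [hy, Real.sqrt_eq_rpow, ← Real.rpow_natCast, ← Real.rpow_mul (Nat.cast_nonneg n)]
    norm_num
  have hyp : y ^ 3 ≤ p := by
    rw [← hy3]
    calc (n : ℝ) ^ ((3 : ℝ) / 2) ≤ ((p : ℝ) ^ ((2 : ℝ) / 3)) ^ ((3 : ℝ) / 2) := by
          gcongr
      _ = p := by
          rw [← Real.rpow_mul (Nat.cast_nonneg p)]
          norm_num
  set T := Nat.sqrt n + 1 with hT
  have hTy : (T : ℝ) ≤ 2 * y := by
    have : (Nat.sqrt n : ℝ) ≤ y := Real.nat_sqrt_le_real_sqrt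
    rw [hT]
    push_cast
    linarith
  have hT3 : T ^ 3 ≤ 8 * p := by
    have : (T : ℝ) ^ 3 ≤ 8 * p := by
      calc (T : ℝ) ^ 3 ≤ (2 * y) ^ 3 := by gcongr
        _ = 8 * y ^ 3 := by ring
        _ ≤ 8 * p := by gcongr
    exact_mod_cast this
  have hnT : n ≤ T ^ 2 := by
    have := Nat.lt_succ_sqrt n
    rw [hT, sq]
    exact this.le
  have hb := S19.nat_bound p h2 A hne T hT3 hnT
  rw [← hn] at hb
  rw [hy3]
  set D := (((A ×ˢ A) ×ˢ (A ×ˢ A)).image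
          (fun q => (q.1.1 - q.1.2) ^ 2 + (q.2.1 - q.2.2) ^ 2)).card with hD
  have hb' : (n : ℝ) ^ 6 ≤ 4 * ((D : ℝ) *
          (48 * (2 * 2 ^ 19) ^ 6 * ((T : ℝ) ^ 9 + n * (T : ℝ) ^ 7))) := by exact_mod_cast hb
  have hTT : (T : ℝ) ^ 9 + n * (T : ℝ) ^ 7 ≤ 1024 * y ^ 9 := by
    calc (T : ℝ) ^ 9 + n * (T : ℝ) ^ 7 ≤ (2 * y) ^ 9 + y ^ 2 * (2 * y) ^ 7 := by
          rw [← hy2]; gcongr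
      _ = 640 * y ^ 9 := by ring
      _ ≤ 1024 * y ^ 9 := by gcongr; norm_num
  have hfin : y ^ 9 * y ^ 3 ≤ y ^ 9 * (D * (4096 * (48 * (2 * 2 ^ 19) ^ 6))) := by
    calc y ^ 9 * y ^ 3 = (y ^ 2) ^ 6 := by ring
      _ = (n : ℝ) ^ 6 := by rw [hy2]
      _ ≤ 4 * ((D : ℝ) * (48 * (2 * 2 ^ 19) ^ 6 * ((T : ℝ) ^ 9 + n * (T : ℝ) ^ 7))) := hb'
      _ ≤ 4 * ((D : ℝ) * (48 * (2 * 2 ^ 19) ^ 6 * (1024 * y ^ 9))) := by gcongr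
      _ = _ := by ring
  have hfin2 := le_of_mul_le_mul_left hfin (by positivity)
  rw [one_div, inv_mul_le_iff₀ (by positivity), mul_comm]
  exact hfin2
end
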